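/- For all 1 <= i, j <= N, all k, m in Z, and every P in N_q^-, one has Omega_{psi_j}(k)(x^-_{i,m} P) = delta_ij delta_{k,-m} gamma^k P + sum_{r>=0} g_{i,j,q^{-1}}(r) gamma^r x^-_{i,m+r} (Omega_{psi_j}(k-r)(P)), where only finitely many summands are nonzero. -/

import Mathlib

/-!
STATEMENT 8: the commutation rule of `Ω_{ψ_j}(k)` with left multiplication by
`x^-_{i,m}` on `N_q^-`.
-/


noncomputable section
open scoped BigOperators

/-- The base field `ℚ(q^{1/2})`. -/
abbrev Fq : Type := RatFunc ℚ

/-- `q^{1/2}`. -/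
def sqq : Fq := RatFunc.X

/-- `q`. -/
def qq : Fq := sqq ^ 2

/-- Generators of the quantum affine algebra `U_q(ĝ)` in the Drinfeld realization. -/
inductive Gen (N : ℕ) : Type
  | xp (i : Fin N) (r : ℤ)
  | xm (i : Fin N) (r : ℤ)
  | h  (i : Fin N) (s : ℤ)
  | K (i : Fin N)
  | Kinv (i : Fin N)
  | g2
  | g2inv
  | D
  | Dinv

open Gen

/-- The free algebra on the Drinfeld generators. -/
abbrev FA (N : ℕ) : Type := FreeAlgebra Fq (Gen N)

variable {N : ℕ}

def e (x : Gen N) : FA N := FreeAlgebra.ι Fq x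

variable (d : Fin N → ℤ) (A : Fin N → Fin N → ℤ)

/-- `q_i = q^{d_i}`. -/
def qi (i : Fin N) : Fq := qq ^ (d i)

/-- `q^{(α_i|α_j)} = q^{d_i a_{ij}}`. -/
def qp (i j : Fin N) : Fq := qq ^ (d i * A i j)

/-- The quantum integer `[n]_i`. -/
def qint (i : Fin N) (n : ℤ) : Fq := (qi d i ^ n - qi d i ^ (-n)) / (qi d i - (qi d i)⁻¹)

/-- `[n]_i!`. -/
def qfact (i : Fin N) : ℕ → Fq
  | 0 => 1
  | n + 1 => qint d i (n + 1) * qfact i n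

/-- The `q_i`-binomial coefficient `[n choose r]_{q_i}`. -/
def qbinom (i : Fin N) (n r : ℕ) : Fq := qfact d i n / (qfact d i r * qfact d i (n - r))

/-- `γ^{m/2}` as a (noncommutative) word in the free algebra. -/
def gammaHalf (m : ℤ) : FA N := if 0 ≤ m then (e g2) ^ m.toNat else (e g2inv) ^ (-m).toNat

/-- `γ^{k}`. -/
def gammaPow (k : ℤ) : FA N := gammaHalf (2 * k)

/-- The Schur-like polynomials `S_k((q_i - q_i^{-1}) h_{i,1}, (q_i - q_i^{-1}) h_{i,2}, …)`
appearing in `ψ_{i,k} = K_i S_k`, defined by the recursion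
`k S_k = ∑_{l=1}^{k} l x_l S_{k-l}` for `exp(∑ x_l z^l) = ∑ S_k z^k`. -/
def Ppos (i : Fin N) : ℕ → FA N
  | 0 => 1
  | k + 1 =>
      ((k + 1 : Fq))⁻¹ •
        ∑ l ∈ Finset.range (k + 1),
          (((l + 1 : ℕ) : Fq) * (qi d i - (qi d i)⁻¹)) •
            (e (h i ((l : ℤ) + 1)) * Ppos i (k - l))

/-- The analogous polynomials in the `h_{i,-l}`, `l > 0`, with coefficient
`-(q_i - q_i^{-1})`, appearing in `φ_{i,-k} = K_i^{-1} S_k`. -/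
def Pneg (i : Fin N) : ℕ → FA N
  | 0 => 1
  | k + 1 =>
      ((k + 1 : Fq))⁻¹ •
        ∑ l ∈ Finset.range (k + 1),
          (((l + 1 : ℕ) : Fq) * (-(qi d i - (qi d i)⁻¹))) •
            (e (h i (-((l : ℤ) + 1))) * Pneg i (k - l))

/-- The element `ψ_{i,m}` (zero for `m < 0`). -/
def psiEl (i : Fin N) (m : ℤ) : FA N := if 0 ≤ m then e (K i) * Ppos d i m.toNat else 0

/-- The element `φ_{i,m}` (zero for `m > 0`). -/
def phiEl (i : Fin N) (m : ℤ) : FA N := if m ≤ 0 then e (Kinv i) * Pneg d i (-m).toNat else 0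

/-- A summand of the Drinfeld–Serre relation:
`x_{i,k_{σ(1)}} ⋯ x_{i,k_{σ(r)}} x_{j,l} x_{i,k_{σ(r+1)}} ⋯ x_{i,k_{σ(n)}}`
(`pm = true` for the `x^+` relation, `pm = false` for `x^-`). -/
def dsTerm (pm : Bool) (i j : Fin N) (n' : ℕ) (ks : Fin n' → ℤ) (l : ℤ)
    (σ : Equiv.Perm (Fin n')) (r : ℕ) : FA N :=
  (((List.finRange n').take r).map fun t =>
      e (if pm then xp i (ks (σ t)) else xm i (ks (σ t)))).prod *
    e (if pm then xp j l else xm j l) *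
  (((List.finRange n').drop r).map fun t =>
      e (if pm then xp i (ks (σ t)) else xm i (ks (σ t)))).prod

/-- The defining relations of the quantum affine algebra `U_q(ĝ)`
(Drinfeld realization). -/
inductive QRel (N : ℕ) (d : Fin N → ℤ) (A : Fin N → Fin N → ℤ) : FA N → FA N → Prop
  | K_Kinv (i : Fin N) : QRel N d A (e (K i) * e (Kinv i)) 1
  | Kinv_K (i : Fin N) : QRel N d A (e (Kinv i) * e (K i)) 1
  | D_Dinv : QRel N d A (e D * e Dinv) 1
  | Dinv_D : QRel N d A (e Dinv * e D) 1
  | g_ginv : QRel N d A (e g2 * e g2inv) 1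
  | ginv_g : QRel N d A (e g2inv * e g2) 1
  | g2_comm (x : Gen N) : QRel N d A (e g2 * e x) (e x * e g2)
  | g2inv_comm (x : Gen N) : QRel N d A (e g2inv * e x) (e x * e g2inv)
  | K_comm_K (i j : Fin N) : QRel N d A (e (K i) * e (K j)) (e (K j) * e (K i))
  | K_comm_D (i : Fin N) : QRel N d A (e (K i) * e D) (e D * e (K i))
  | K_comm_h (i j : Fin N) (s : ℤ) :
      QRel N d A (e (K i) * e (h j s)) (e (h j s) * e (K i))
  | h_zero (i : Fin N) : QRel N d A (e (h i 0)) 0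
  | D_h (i : Fin N) (s : ℤ) :
      QRel N d A (e D * e (h i s) * e Dinv) ((qq ^ s) • e (h i s))
  | D_xp (i : Fin N) (r : ℤ) :
      QRel N d A (e D * e (xp i r) * e Dinv) ((qq ^ r) • e (xp i r))
  | D_xm (i : Fin N) (r : ℤ) :
      QRel N d A (e D * e (xm i r) * e Dinv) ((qq ^ r) • e (xm i r))
  | K_xp (i j : Fin N) (r : ℤ) :
      QRel N d A (e (K i) * e (xp j r) * e (Kinv i)) (qp d A i j • e (xp j r))
  | K_xm (i j : Fin N) (r : ℤ) :
      QRel N d A (e (K i) * e (xm j r) * e (Kinv i)) ((qp d A i j)⁻¹ • e (xm j r))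
  | h_h (i j : Fin N) (k l : ℤ) (hk : k ≠ 0) (hl : l ≠ 0) :
      QRel N d A (e (h i k) * e (h j l) - e (h j l) * e (h i k))
        (if l = -k then
          ((k : Fq)⁻¹ * qint d i (k * A i j) * (qi d j - (qi d j)⁻¹)⁻¹) •
            (gammaPow k - gammaPow (-k))
         else 0)
  | h_xp (i j : Fin N) (k l : ℤ) (hk : k ≠ 0) :
      QRel N d A (e (h i k) * e (xp j l) - e (xp j l) * e (h i k))
        (((k : Fq)⁻¹ * qint d i (k * A i j)) • (gammaHalf (-|k|) * e (xp j (k + l))))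
  | h_xm (i j : Fin N) (k l : ℤ) (hk : k ≠ 0) :
      QRel N d A (e (h i k) * e (xm j l) - e (xm j l) * e (h i k))
        ((-((k : Fq)⁻¹ * qint d i (k * A i j))) • (gammaHalf |k| * e (xm j (k + l))))
  | serre_p (i j : Fin N) (k l : ℤ) :
      QRel N d A
        (e (xp i (k+1)) * e (xp j l) - qp d A i j • (e (xp j l) * e (xp i (k+1))))
        (qp d A i j • (e (xp i k) * e (xp j (l+1))) - e (xp j (l+1)) * e (xp i k))
  | serre_m (i j : Fin N) (k l : ℤ) :
      QRel N d A
        (e (xm i (k+1)) * e (xm j l) - (qp d A i j)⁻¹ • (e (xm j l) * e (xm i (k+1))))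
        ((qp d A i j)⁻¹ • (e (xm i k) * e (xm j (l+1))) - e (xm j (l+1)) * e (xm i k))
  | xp_xm (i j : Fin N) (k l : ℤ) :
      QRel N d A (e (xp i k) * e (xm j l) - e (xm j l) * e (xp i k))
        (if i = j then
          ((qi d i - (qi d i)⁻¹)⁻¹) •
            (gammaHalf (k - l) * psiEl d i (k + l) - gammaHalf (l - k) * phiEl d i (k + l))
         else 0)
  | dserre (pm : Bool) (i j : Fin N) (hij : i ≠ j)
      (ks : Fin (1 - A i j).toNat → ℤ) (l : ℤ) :
      QRel N d A
        (∑ σ : Equiv.Perm (Fin (1 - A i j).toNat),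
          ∑ r ∈ Finset.range ((1 - A i j).toNat + 1),
            ((-1 : Fq) ^ r * qbinom d i (1 - A i j).toNat r) •
              dsTerm pm i j (1 - A i j).toNat ks l σ r)
        0

/-- The quantum affine algebra `U_q(ĝ)` (Drinfeld realization). -/
abbrev Uq (N : ℕ) (d : Fin N → ℤ) (A : Fin N → Fin N → ℤ) : Type := RingQuot (QRel N d A)

/-- The image of a generator in `U_q(ĝ)`. -/
def G (x : Gen N) : Uq N d A := RingQuot.mkAlgHom Fq (QRel N d A) (e x)

/-- The image of `ψ_{i,m}` in `U_q(ĝ)`. -/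
def psiU (i : Fin N) (m : ℤ) : Uq N d A := RingQuot.mkAlgHom Fq (QRel N d A) (psiEl d i m)

/-- The image of `φ_{i,m}` in `U_q(ĝ)`. -/
def phiU (i : Fin N) (m : ℤ) : Uq N d A := RingQuot.mkAlgHom Fq (QRel N d A) (phiEl d i m)

/-- The image of `γ^{m/2}` in `U_q(ĝ)`. -/
def gU (m : ℤ) : Uq N d A := RingQuot.mkAlgHom Fq (QRel N d A) (gammaHalf m)


/-- The generating set of the subalgebra `N_q^-`. -/
def NqSet : Set (Uq N d A) :=
  {G d A Gen.g2, G d A Gen.g2inv} ∪ Set.range (fun p : Fin N × ℤ => G d A (Gen.xm p.1 p.2))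

/-- The subalgebra `N_q^-` of `U_q(ĝ)` generated by `γ^{±1/2}` and the `x^-_{i,l}`. -/
def Nq : Subalgebra Fq (Uq N d A) := Algebra.adjoin Fq (NqSet d A)

/-- `γ^{1/2}` as an element of `N_q^-`. -/
def g2N : Nq d A :=
  ⟨G d A Gen.g2, Algebra.subset_adjoin (Set.mem_union_left _ (Set.mem_insert _ _))⟩

/-- `γ^{-1/2}` as an element of `N_q^-`. -/
def g2invN : Nq d A :=
  ⟨G d A Gen.g2inv, Algebra.subset_adjoin (Set.mem_union_left _ (Set.mem_insert_of_mem _ rfl))⟩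

/-- `x^-_{i,m}` as an element of `N_q^-`. -/
def xmN (i : Fin N) (m : ℤ) : Nq d A :=
  ⟨G d A (Gen.xm i m), Algebra.subset_adjoin (Set.mem_union_right _ ⟨(i, m), rfl⟩)⟩

/-- `γ^{m/2}` as an element of `N_q^-`. -/
def gN (m : ℤ) : Nq d A :=
  if 0 ≤ m then (g2N d A) ^ m.toNat else (g2invN d A) ^ (-m).toNat

/-- The characterizing property of the family of operators
`Ω_{ψ_i}(m), Ω_{φ_i}(m) : N_q^- → N_q^-`: they vanish for small (resp. large) index, and
`[x^+_{i,k}, P] = (q_i - q_i^{-1})^{-1} (∑_{p ≥ 0} ψ_{i,p} γ^{p/2} Ω_{ψ_i}(k-p)(P)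
   - ∑_{r ≥ 0} φ_{i,-r} γ^{r/2} Ω_{φ_i}(k+r)(P))`,
both sums having only finitely many nonzero terms.  (By the commutator lemma there is a
unique such family.) -/
def IsOmegaFamily (Ωψ Ωφ : Fin N → ℤ → ((Nq d A) →ₗ[Fq] (Nq d A))) : Prop :=
  (∀ (i : Fin N) (P : Nq d A), ∃ b : ℤ, ∀ m : ℤ, m ≤ b → Ωψ i m P = 0) ∧
  (∀ (i : Fin N) (P : Nq d A), ∃ b : ℤ, ∀ m : ℤ, b ≤ m → Ωφ i m P = 0) ∧
  (∀ (i : Fin N) (k : ℤ) (P : Nq d A), ∃ M : ℕ,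
    (∀ p : ℕ, M < p → Ωψ i (k - (p : ℤ)) P = 0 ∧ Ωφ i (k + (p : ℤ)) P = 0) ∧
    G d A (Gen.xp i k) * (P : Uq N d A) - (P : Uq N d A) * G d A (Gen.xp i k) =
      ((qi d i - (qi d i)⁻¹)⁻¹) •
        ((∑ p ∈ Finset.range (M + 1),
            psiU d A i (p : ℤ) * gU d A (p : ℤ) *
              ((Ωψ i (k - (p : ℤ)) P : Nq d A) : Uq N d A)) -
         (∑ r ∈ Finset.range (M + 1),
            phiU d A i (-(r : ℤ)) * gU d A (r : ℤ) *
              ((Ωφ i (k + (r : ℤ)) P : Nq d A) : Uq N d A))))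

/-- The Taylor coefficients at `t = 0` of `(a t - 1)/(t - a)` (for `a = q^{(α_i|α_j)}`
this is the series `g_{i,j}(t)`; for `a = q^{-(α_i|α_j)}` it is `g_{i,j,q^{-1}}(t)`). -/
def gcoef (a : Fq) : ℕ → Fq
  | 0 => a⁻¹
  | r + 1 => a ^ (-(r : ℤ) - 2) - a ^ (-(r : ℤ))

section GaussianBinomial

variable {F : Type*} [Field F]

/-- Symmetric Gaussian binomial coefficients, defined by their Pascal rule. -/
def gaussBinom (Q : F) : ℕ → ℕ → F
  | _, 0 => 1
  | 0, _ + 1 => 0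
  | n + 1, r + 1 =>
      Q ^ (r + 1) * gaussBinom Q n (r + 1) + Q ^ ((r : ℤ) - n) * gaussBinom Q n r

lemma gaussBinom_zero_right (Q : F) (n : ℕ) : gaussBinom Q n 0 = 1 := by
  cases n <;> rfl

lemma gaussBinom_succ_succ (Q : F) (n r : ℕ) : gaussBinom Q (n + 1) (r + 1) =
    Q ^ (r + 1) * gaussBinom Q n (r + 1) + Q ^ ((r : ℤ) - n) * gaussBinom Q n r := rfl

lemma gaussBinom_eq_zero (Q : F) {n r : ℕ} (hr : n < r) : gaussBinom Q n r = 0 := by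
  induction n generalizing r with
  | zero => cases r with
    | zero => omega
    | succ r => rfl
  | succ n ih => cases r with
    | zero => omega
    | succ r => rw [gaussBinom_succ_succ, ih (by omega), ih (by omega)]; simp

/-- The symmetric difference `Q ^ n - Q ^ (-n)`. -/
def symDiffPow (Q : F) (n : ℤ) : F := Q ^ n - Q ^ (-n)

/-- Products of the first `n` symmetric differences. -/
def symFact (Q : F) : ℕ → F
  | 0 => 1
  | n + 1 => symDiffPow Q (n + 1) * symFact Q n

lemma symDiffPow_inv (Q : F) (n : ℤ) : symDiffPow Q⁻¹ n = -symDiffPow Q n := by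
  simp [symDiffPow]

lemma symDiffPow_add {Q : F} (hQ : Q ≠ 0) (a b : ℤ) :
    Q ^ a * symDiffPow Q b + Q ^ (-b) * symDiffPow Q a = symDiffPow Q (a + b) := by
  simp only [symDiffPow, zpow_add₀ hQ, zpow_neg, neg_add]
  have ha := zpow_ne_zero a hQ
  have hb := zpow_ne_zero b hQ
  field_simp
  ring

lemma gaussBinom_mul_symFact {Q : F} (hQ : Q ≠ 0) {n r : ℕ} (hr : r ≤ n) :
    gaussBinom Q n r * (symFact Q r * symFact Q (n - r)) = symFact Q n := by
  induction n generalizing r with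
  | zero => obtain rfl : r = 0 := by omega
            simp [gaussBinom_zero_right, symFact]
  | succ n ih =>
    cases r with
    | zero => simp [gaussBinom_zero_right, symFact]
    | succ r =>
      have h2 := ih (r := r) (by omega)
      rw [gaussBinom_succ_succ, Nat.add_sub_add_right]
      rcases Nat.lt_or_ge r n with hlt | hge
      · have h1 := ih (r := r + 1) (by omega)
        have hs : n - r = (n - (r + 1)) + 1 := by omega
        rw [hs] at h2 ⊢
        simp only [symFact] at h1 h2 ⊢
        have key := symDiffPow_add hQ ((r : ℤ) + 1) ((n : ℤ) - r)
        have e1 : (((n - (r + 1) : ℕ) : ℤ) + 1) = (n : ℤ) - r := by omega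
        have e2 : -((n : ℤ) - r) = r - n := by ring
        have e3 : (r : ℤ) + 1 + (n - r) = n + 1 := by ring
        rw [e1] at h2 ⊢
        rw [e2, e3] at key
        rw [← key]
        have e4 : (Q : F) ^ (r + 1) = Q ^ ((r : ℤ) + 1) := by norm_cast
        rw [e4]
        linear_combination (Q ^ ((r : ℤ) + 1) * symDiffPow Q (n - r)) * h1 +
          (Q ^ ((r : ℤ) - n) * symDiffPow Q (r + 1)) * h2
      · obtain rfl : r = n := by omega
        rw [gaussBinom_eq_zero Q (Nat.lt_succ_self r)]
        simp only [symFact, Nat.sub_self, sub_self, zpow_zero] at h2 ⊢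
        linear_combination symDiffPow Q (r + 1) * h2

/-- `Q` is nonzero and not a root of unity. -/
def IsGeneric (Q : F) : Prop := Q ≠ 0 ∧ ∀ n : ℕ, 0 < n → symDiffPow Q n ≠ 0

lemma IsGeneric.inv {Q : F} (hQ : IsGeneric Q) : IsGeneric Q⁻¹ :=
  ⟨inv_ne_zero hQ.1, fun n hn => by rw [symDiffPow_inv]; exact neg_ne_zero.2 (hQ.2 n hn)⟩

lemma symFact_ne_zero {Q : F} (hQ : IsGeneric Q) (n : ℕ) : symFact Q n ≠ 0 := by
  induction n with
  | zero => simp [symFact]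
  | succ n ih => exact mul_ne_zero (by exact_mod_cast hQ.2 (n + 1) (Nat.succ_pos n)) ih

lemma gaussBinom_eq_div {Q : F} (hQ : IsGeneric Q) {n r : ℕ} (hr : r ≤ n) :
    gaussBinom Q n r = symFact Q n / (symFact Q r * symFact Q (n - r)) :=
  eq_div_of_mul_eq (mul_ne_zero (symFact_ne_zero hQ _) (symFact_ne_zero hQ _))
    (gaussBinom_mul_symFact hQ.1 hr)

lemma symFact_inv (Q : F) (n : ℕ) : symFact Q⁻¹ n = (-1) ^ n * symFact Q n := by
  induction n with
  | zero => simp [symFact]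
  | succ n ih => simp only [symFact, ih, symDiffPow_inv, pow_succ]; ring

lemma gaussBinom_inv {Q : F} (hQ : IsGeneric Q) (n r : ℕ) :
    gaussBinom Q⁻¹ n r = gaussBinom Q n r := by
  rcases Nat.lt_or_ge n r with hr | hr
  · rw [gaussBinom_eq_zero _ hr, gaussBinom_eq_zero _ hr]
  · rw [gaussBinom_eq_div hQ hr, gaussBinom_eq_div hQ.inv hr, symFact_inv, symFact_inv,
      symFact_inv]
    have : (-1 : F) ^ n = (-1) ^ r * (-1) ^ (n - r) := by
      rw [← pow_add]; congr 1; omega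
    rw [this, show (-1 : F) ^ r * symFact Q r * ((-1) ^ (n - r) * symFact Q (n - r)) =
      ((-1 : F) ^ r * (-1) ^ (n - r)) * (symFact Q r * symFact Q (n - r)) by ring]
    rw [mul_div_mul_left]
    simp

lemma gaussBinom_succ_mul_left {Q : F} (hQ : IsGeneric Q) {m r : ℕ} (hr : r ≤ m) :
    gaussBinom Q (m + 1) (r + 1) * symDiffPow Q (r + 1) =
      symDiffPow Q (m + 1) * gaussBinom Q m r := by
  rw [gaussBinom_eq_div hQ hr, gaussBinom_eq_div hQ (by omega : r + 1 ≤ m + 1),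
    Nat.add_sub_add_right]
  simp only [symFact]
  have h1 := symFact_ne_zero hQ r
  have h2 := symFact_ne_zero hQ (m - r)
  have h3 : symDiffPow Q ((r : ℤ) + 1) ≠ 0 := by exact_mod_cast hQ.2 (r + 1) (Nat.succ_pos r)
  field_simp

lemma gaussBinom_succ_mul_right {Q : F} (hQ : IsGeneric Q) {m r : ℕ} (hr : r ≤ m) :
    gaussBinom Q (m + 1) r * symDiffPow Q ((m + 1 : ℤ) - r) =
      symDiffPow Q (m + 1) * gaussBinom Q m r := by
  rw [gaussBinom_eq_div hQ hr, gaussBinom_eq_div hQ (by omega : r ≤ m + 1),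
    show m + 1 - r = (m - r) + 1 by omega]
  have e1 : (m + 1 : ℤ) - r = ((m - r : ℕ) : ℤ) + 1 := by omega
  rw [e1]
  simp only [symFact]
  have h1 := symFact_ne_zero hQ r
  have h2 := symFact_ne_zero hQ (m - r)
  have h3 : symDiffPow Q (((m - r : ℕ) : ℤ) + 1) ≠ 0 := by
    exact_mod_cast hQ.2 (m - r + 1) (Nat.succ_pos _)
  field_simp

lemma gaussBinom_succ_right_mul {Q : F} (hQ : IsGeneric Q) {m r : ℕ} (hr : r < m) :
    gaussBinom Q m (r + 1) * symDiffPow Q (r + 1) =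
      gaussBinom Q m r * symDiffPow Q ((m : ℤ) - r) := by
  rw [gaussBinom_eq_div hQ hr.le, gaussBinom_eq_div hQ (by omega : r + 1 ≤ m),
    show m - r = (m - (r + 1)) + 1 by omega]
  have e1 : (m : ℤ) - r = ((m - (r + 1) : ℕ) : ℤ) + 1 := by omega
  rw [e1]
  simp only [symFact]
  have h1 := symFact_ne_zero hQ r
  have h2 := symFact_ne_zero hQ (m - (r + 1))
  have h3 : symDiffPow Q (((m - (r + 1) : ℕ) : ℤ) + 1) ≠ 0 := by
    exact_mod_cast hQ.2 (m - (r + 1) + 1) (Nat.succ_pos _)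
  have h4 : symDiffPow Q ((r : ℤ) + 1) ≠ 0 := by exact_mod_cast hQ.2 (r + 1) (Nat.succ_pos r)
  field_simp

end GaussianBinomial

section QuantumPlane

variable {F : Type*} [Field F] {R : Type*} [Ring R] [Algebra F R]

/-- The `Q`-binomial sum `∑ (-c)^r [k r] α^r β^(k-r)`. -/
def qBinomSum (Q : F) (α β : R) (k : ℕ) (c : F) : R :=
  ∑ r ∈ Finset.range (k + 1), ((-c) ^ r * gaussBinom Q k r) • (α ^ r * β ^ (k - r))

lemma qBinomSum_succ (Q : F) (hQ : Q ≠ 0) (α β : R) (k : ℕ) (c : F) :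
    qBinomSum Q α β (k + 1) c = qBinomSum Q α β k (c * Q) * β -
      (c * Q ^ (-(k : ℤ))) • (α * qBinomSum Q α β k (c * Q)) := by
  have h1 : qBinomSum Q α β k (c * Q) * β = ∑ r ∈ Finset.range (k + 2),
      ((-(c * Q)) ^ r * gaussBinom Q k r) • (α ^ r * β ^ (k + 1 - r)) := by
    rw [Finset.sum_range_succ, gaussBinom_eq_zero Q (Nat.lt_succ_self k), mul_zero, zero_smul,
      add_zero, qBinomSum, Finset.sum_mul]
    refine Finset.sum_congr rfl fun r hr => ?_
    have : k + 1 - r = (k - r) + 1 := by have := Finset.mem_range.1 hr; omega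
    rw [this, pow_succ β, smul_mul_assoc, mul_assoc]
  rw [h1, Finset.sum_range_succ', qBinomSum, Finset.sum_range_succ', qBinomSum, Finset.mul_sum,
    Finset.smul_sum, add_sub_right_comm, ← Finset.sum_sub_distrib]
  congr 1
  · refine Finset.sum_congr rfl fun r hr => ?_
    rw [gaussBinom_succ_succ, Nat.add_sub_add_right, mul_smul_comm, smul_smul, ← mul_assoc α,
      ← pow_succ' α, ← sub_smul]
    congr 1
    rw [zpow_sub₀ hQ, zpow_neg, zpow_natCast, zpow_natCast]
    have := pow_ne_zero k hQ
    field_simp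
    ring
  · simp [gaussBinom_zero_right]

lemma qPlane_mul_pow {Q : F} {E Y : R} (hYE : Y * E = (Q ^ 2) • (E * Y)) (k : ℕ) :
    Y * E ^ k = (Q ^ (2 * k)) • (E ^ k * Y) := by
  induction k with
  | zero => simp
  | succ k ih =>
    rw [pow_succ, ← mul_assoc, ih, smul_mul_assoc, mul_assoc, hYE, mul_smul_comm, smul_smul,
      mul_assoc]
    congr 1
    ring

lemma qBinomSum_eq_zero {Q : F} (hQ : Q ≠ 0) {E Y : R} (hYE : Y * E = (Q ^ 2) • (E * Y))
    {n : ℕ} (hn : 0 < n) :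
    qBinomSum Q (Q ^ (1 - n : ℤ) • Y - E) (Y - Q ^ (1 - n : ℤ) • E) n 1 = 0 := by
  set P : F := Q ^ (1 - n : ℤ) with hP
  have key : ∀ k : ℕ, k ≤ n → qBinomSum Q (P • Y - E) (Y - P • E) k (Q ^ ((n : ℤ) - k)) =
      (∏ t ∈ Finset.range k, (Q ^ ((n : ℤ) - 1 - 2 * t) - P)) • E ^ k := by
    intro k
    induction k with
    | zero => intro _; simp [qBinomSum, gaussBinom_zero_right]
    | succ k ih =>
      intro hk
      have e1 : Q ^ ((n : ℤ) - (k + 1 : ℕ)) * Q = Q ^ ((n : ℤ) - k) := by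
        rw [← zpow_add_one₀ hQ]; congr 1; push_cast; ring
      have e2 : Q ^ ((n : ℤ) - (k + 1 : ℕ)) * Q ^ (-(k : ℤ)) = Q ^ ((n : ℤ) - 1 - 2 * k) := by
        rw [← zpow_add₀ hQ]; congr 1; push_cast; ring
      have e3 : Q ^ ((n : ℤ) - 1 - 2 * k) * P * Q ^ (2 * k) = 1 := by
        rw [hP, ← zpow_natCast, ← zpow_add₀ hQ, ← zpow_add₀ hQ,
          ← zpow_zero Q]
        congr 1; push_cast; ring
      rw [qBinomSum_succ Q hQ, e1, ih (by omega), e2, Finset.prod_range_succ]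
      simp only [smul_mul_assoc, mul_smul_comm, mul_sub, sub_mul, qPlane_mul_pow hYE,
        ← pow_succ, ← pow_succ', smul_sub, smul_smul]
      match_scalars
      · linear_combination (-(∏ t ∈ Finset.range k, (Q ^ ((n : ℤ) - 1 - 2 * t) - P))) * e3
      · ring
  have h := key n le_rfl
  rw [sub_self, zpow_zero] at h
  rw [h, Finset.prod_eq_zero (Finset.mem_range.2 (Nat.sub_lt hn Nat.one_pos)), zero_smul]
  rw [hP, sub_eq_zero]
  congr 1
  omega

lemma qPlane_pow_left {Q : F} {E Y : R} (hYE : Y * E = (Q ^ 2) • (E * Y)) (r : ℕ) :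
    ((Q ^ 2) • Y - E) ^ (r + 1) = (Y - E) ^ r * ((Q ^ (2 * r + 2)) • Y - E) := by
  induction r with
  | zero => simp
  | succ r ih =>
    rw [pow_succ, ih, pow_succ (Y - E), mul_assoc, mul_assoc]
    congr 1
    simp only [smul_mul_assoc, mul_smul_comm, mul_sub, sub_mul, hYE, smul_sub, smul_smul]
    match_scalars <;> ring

lemma qPlane_pow_right {Q : F} {E Y : R} (hYE : Y * E = (Q ^ 2) • (E * Y)) (r : ℕ) :
    (Y - (Q ^ 2) • E) ^ (r + 1) = (Y - (Q ^ (2 * r + 2)) • E) * (Y - E) ^ r := by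
  induction r with
  | zero => simp
  | succ r ih =>
    rw [pow_succ', ih, pow_succ' (Y - E), ← mul_assoc, ← mul_assoc]
    congr 1
    simp only [smul_mul_assoc, mul_smul_comm, mul_sub, sub_mul, hYE, smul_sub, smul_smul]
    match_scalars <;> ring

/-- The complete homogeneous sum `∑ α^s β^(r-1-s)`. -/
def homogSum (α β : R) (r : ℕ) : R := ∑ s ∈ Finset.range r, α ^ s * β ^ (r - 1 - s)

lemma homogSum_succ (α β : R) (r : ℕ) :
    homogSum α β (r + 1) = α * homogSum α β r + β ^ r := by
  rw [homogSum, Finset.sum_range_succ', homogSum, Finset.mul_sum]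
  congr 1
  · refine Finset.sum_congr rfl fun s _ => ?_
    rw [pow_succ', mul_assoc]
    congr 3
    omega
  · simp

lemma homogSum_qPlane {Q : F} (hQ : IsGeneric Q) {E Y : R}
    (hYE : Y * E = (Q ^ 2) • (E * Y)) (r : ℕ) :
    homogSum ((Q ^ 2) • Y - E) (Y - (Q ^ 2) • E) (r + 1) =
      (Q ^ r * symDiffPow Q (r + 1) / symDiffPow Q 1) • (Y - E) ^ r := by
  have h1 : symDiffPow Q 1 ≠ 0 := by exact_mod_cast hQ.2 1 Nat.one_pos
  induction r with
  | zero => simp [homogSum, div_self h1]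
  | succ r ih =>
    rw [homogSum_succ, ih, qPlane_pow_right hYE, mul_smul_comm, ← smul_mul_assoc,
      ← add_mul, pow_succ' (Y - E), ← smul_mul_assoc]
    congr 1
    simp only [smul_sub, smul_smul]
    have hQ0 := hQ.1
    have e : symDiffPow Q 1 = Q - Q⁻¹ := by simp [symDiffPow]
    rw [e] at h1 ⊢
    have e1 : symDiffPow Q (r + 1) = Q ^ r * Q - (Q ^ r * Q)⁻¹ := by
      rw [symDiffPow, zpow_neg, zpow_add_one₀ hQ0, zpow_natCast]
    have e2 : symDiffPow Q ((r + 1 : ℕ) + 1) = Q ^ r * Q * Q - (Q ^ r * Q * Q)⁻¹ := by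
      rw [symDiffPow, zpow_neg, zpow_add_one₀ hQ0, zpow_natCast, pow_succ]
    rw [e1, e2]
    have hr := pow_ne_zero r hQ0
    have h2 : Q ^ 2 - 1 ≠ 0 := by
      intro h2
      apply h1
      field_simp
      linear_combination h2
    match_scalars <;> field_simp <;> ring

lemma qPlane_local {q u v x y : F} (hq : q ≠ 0) (hu : u ≠ 0) (hv : v ≠ 0)
    (hxy : y * (u * q - (u * q)⁻¹) = -(x * (v * q - (v * q)⁻¹))) {E Y U W : R}
    (hrel : Y * U - (u * v * q)⁻¹ • (E * W) + W * E - (u * v * q)⁻¹ • (U * Y) = 0) :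
    (y * v) • (((u * q) ^ 2 • Y - E) * ((u * v * q)⁻¹ • W - U)) -
      (x * u) • ((W - (u * v * q)⁻¹ • U) * (Y - (v * q) ^ 2 • E)) =
    (Y - E) * (y • ((u * q) • W - v • U)) - (x • (u • W - (v * q) • U)) * (Y - E) := by
  have h := congrArg (fun z => (x * (v * q - (v * q)⁻¹) * (u * v * q)) • z) hrel
  rw [← sub_eq_zero]
  simp only [smul_zero] at h
  rw [← h]
  simp only [smul_mul_assoc, mul_smul_comm, mul_sub, sub_mul, smul_sub, smul_add, smul_smul]
  have hxy' : y * v * (u ^ 2 * q ^ 2 - 1) = -(x * u * (v ^ 2 * q ^ 2 - 1)) := by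
    field_simp at hxy
    linear_combination hxy
  match_scalars
  all_goals field_simp
  all_goals first
    | ring1
    | linear_combination hxy'
    | linear_combination -hxy'

lemma qPlane_derivation_sum {Q : F} (hQ : IsGeneric Q) {E Y U W : R}
    (hYE : Y * E = (Q ^ 2) • (E * Y)) (m : ℕ)
    (hrel : Y * U - Q ^ (-(m : ℤ)) • (E * W) + W * E - Q ^ (-(m : ℤ)) • (U * Y) = 0) :
    ∑ r ∈ Finset.range (m + 2), ((-1 : F) ^ r * gaussBinom Q (m + 1) r) •
      (homogSum ((Q ^ 2) • Y - E) (Y - (Q ^ 2) • E) r * (W - Q ^ (-(m : ℤ)) • U) *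
          (Y - (Q ^ 2) • E) ^ (m + 1 - r) +
        ((Q ^ 2) • Y - E) ^ r * (Q ^ (-(m : ℤ)) • W - U) *
          homogSum ((Q ^ 2) • Y - E) (Y - (Q ^ 2) • E) (m + 1 - r)) = 0 := by
  have hQ0 := hQ.1
  have h1 : symDiffPow Q 1 ≠ 0 := by exact_mod_cast hQ.2 1 Nat.one_pos
  set α := (Q ^ 2) • Y - E with hα
  set β := Y - (Q ^ 2) • E with hβ
  set P : F := Q ^ (-(m : ℤ)) with hP
  set α₀ := P • W - U with hα₀
  set β₀ := W - P • U with hβ₀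
  set L := Y - E with hL
  let x : ℕ → F := fun r => (-1 : F) ^ r * gaussBinom Q m r
  let f : ℕ → R := fun r => (x r * Q ^ (m - r)) • (α ^ r * α₀ * L ^ (m - r))
  let s : ℕ → R := fun r => (x r * Q ^ r) • (L ^ r * β₀ * β ^ (m - r))
  let Φ : ℕ → R := fun r => L ^ r * (x r • (Q ^ r • W - Q ^ (m - r) • U)) * L ^ (m - r)
  have hstep : ∀ r, r < m → f (r + 1) - s r = Φ (r + 1) - Φ r := by
    intro r hr
    obtain ⟨t, rfl⟩ : ∃ t, m = r + t + 1 := ⟨m - r - 1, by omega⟩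
    have e1 : r + t + 1 - (r + 1) = t := by omega
    have e2 : r + t + 1 - r = t + 1 := by omega
    have hP' : P = (Q ^ r * Q ^ t * Q)⁻¹ := by
      rw [hP, zpow_neg, zpow_natCast, pow_succ, pow_add]
    have hxy : x (r + 1) * (Q ^ r * Q - (Q ^ r * Q)⁻¹) =
        -(x r * (Q ^ t * Q - (Q ^ t * Q)⁻¹)) := by
      have h := gaussBinom_succ_right_mul hQ hr
      have e3 : symDiffPow Q ((r : ℤ) + 1) = Q ^ r * Q - (Q ^ r * Q)⁻¹ := by
        rw [symDiffPow, zpow_neg, zpow_add_one₀ hQ0, zpow_natCast]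
      have e4 : symDiffPow Q (((r + t + 1 : ℕ) : ℤ) - r) = Q ^ t * Q - (Q ^ t * Q)⁻¹ := by
        rw [symDiffPow, zpow_neg, show ((r + t + 1 : ℕ) : ℤ) - r = t + 1 by push_cast; ring,
          zpow_add_one₀ hQ0, zpow_natCast]
      rw [e3, e4] at h
      simp only [x, pow_succ]
      linear_combination (-(-1 : F) ^ r) * h
    have hloc := qPlane_local hQ0 (pow_ne_zero r hQ0) (pow_ne_zero t hQ0) hxy (hP' ▸ hrel)
    rw [← hP', ← pow_succ, ← pow_succ, ← hα₀, ← hβ₀, ← hL] at hloc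
    simp only [f, s, Φ, e1, e2]
    rw [hα, qPlane_pow_left hYE, hβ, qPlane_pow_right hYE, ← hL]
    have e5 : 2 * r + 2 = (r + 1) * 2 := by ring
    have e6 : 2 * t + 2 = (t + 1) * 2 := by ring
    rw [e5, e6, pow_mul, pow_mul]
    have h := congrArg (fun z => L ^ r * z * L ^ t) hloc
    simp only [mul_sub (L ^ r) (_ • _), sub_mul _ _ (L ^ t), mul_smul_comm, smul_mul_assoc] at h
    rw [pow_succ L r, pow_succ' L t]
    simp only [mul_assoc, mul_smul_comm, smul_mul_assoc] at h ⊢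
    exact h
  have h0 : f 0 = Φ 0 := by
    have hPm : Q ^ m * P = 1 := by
      rw [hP, zpow_neg, zpow_natCast, mul_inv_cancel₀ (pow_ne_zero m hQ0)]
    simp only [f, Φ, x, hα₀, pow_zero, one_mul, gaussBinom_zero_right, Nat.sub_zero, one_smul]
    rw [← smul_mul_assoc, smul_sub, smul_smul, hPm, one_smul]
  have hm : s m = Φ m := by
    have hPm : Q ^ m * P = 1 := by
      rw [hP, zpow_neg, zpow_natCast, mul_inv_cancel₀ (pow_ne_zero m hQ0)]
    simp only [s, Φ, hβ₀, pow_zero, mul_one, Nat.sub_self]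
    rw [← mul_smul_comm, mul_smul, smul_sub (Q ^ m), smul_smul (Q ^ m), hPm, one_smul]
  have hfs : ∑ r ∈ Finset.range (m + 1), f r = ∑ r ∈ Finset.range (m + 1), s r := by
    rw [Finset.sum_range_succ' f, Finset.sum_range_succ s, h0, hm, ← sub_eq_zero,
      add_sub_add_comm, ← Finset.sum_sub_distrib,
      Finset.sum_congr rfl fun r hr => hstep r (Finset.mem_range.1 hr), Finset.sum_range_sub]
    abel
  simp only [smul_add, Finset.sum_add_distrib]
  have hfirst : ∑ r ∈ Finset.range (m + 2), ((-1 : F) ^ r * gaussBinom Q (m + 1) r) •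
      (homogSum α β r * β₀ * β ^ (m + 1 - r)) =
      -((symDiffPow Q (m + 1) / symDiffPow Q 1) • ∑ r ∈ Finset.range (m + 1), s r) := by
    rw [Finset.sum_range_succ', Finset.smul_sum, ← Finset.sum_neg_distrib]
    have hz : homogSum α β 0 = 0 := by simp [homogSum]
    rw [hz, zero_mul, zero_mul, smul_zero, add_zero]
    refine Finset.sum_congr rfl fun r hr => ?_
    rw [homogSum_qPlane hQ hYE, Nat.add_sub_add_right]
    simp only [s, x, smul_mul_assoc, smul_smul, ← neg_smul]
    congr 1
    have h := gaussBinom_succ_mul_left hQ (Nat.lt_succ_iff.1 (Finset.mem_range.1 hr))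
    rw [pow_succ]
    linear_combination (-(-1 : F) ^ r * Q ^ r / symDiffPow Q 1) * h
  have hsecond : ∑ r ∈ Finset.range (m + 2), ((-1 : F) ^ r * gaussBinom Q (m + 1) r) •
      (α ^ r * α₀ * homogSum α β (m + 1 - r)) =
      (symDiffPow Q (m + 1) / symDiffPow Q 1) • ∑ r ∈ Finset.range (m + 1), f r := by
    rw [Finset.sum_range_succ, Finset.smul_sum]
    have hz : homogSum α β 0 = 0 := by simp [homogSum]
    rw [Nat.sub_self, hz, mul_zero, smul_zero, add_zero]
    refine Finset.sum_congr rfl fun r hr => ?_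
    have hr' := Nat.lt_succ_iff.1 (Finset.mem_range.1 hr)
    have e1 : m + 1 - r = (m - r) + 1 := by omega
    rw [e1, homogSum_qPlane hQ hYE]
    simp only [f, x, mul_smul_comm, smul_smul]
    congr 1
    have h := gaussBinom_succ_mul_right hQ hr'
    have e2 : ((m - r : ℕ) : ℤ) + 1 = (m + 1 : ℤ) - r := by omega
    rw [e2]
    linear_combination ((-1 : F) ^ r * Q ^ (m - r) / symDiffPow Q 1) * h
  rw [hfirst, hsecond, hfs]
  abel

end QuantumPlane

section Polarization

variable {F : Type*} [Field F] {R : Type*} [Ring R] [Algebra F R]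

/-- The product of the `v t` in order, with `z` inserted at position `r`. -/
def insertProd {n : ℕ} (v : Fin n → R) (z : R) (r : ℕ) : R :=
  (((List.finRange n).take r).map v).prod * z * (((List.finRange n).drop r).map v).prod

lemma insertProd_const {n r : ℕ} (hr : r ≤ n) (x z : R) :
    insertProd (fun _ : Fin n => x) z r = x ^ r * z * x ^ (n - r) := by
  simp [insertProd, List.map_const', List.prod_replicate, min_eq_left hr]

lemma exists_multilinear_insertProd (F : Type*) [Field F] [Algebra F R] {n r : ℕ} (hr : r ≤ n)
    (z : R) :
    ∃ f : MultilinearMap F (fun _ : Fin n => R) R, ∀ v, f v = insertProd v z r := by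
  rcases hr.lt_or_eq with hlt | rfl
  · let f : MultilinearMap F (fun _ : Fin n => R) R :=
      (MultilinearMap.mkPiAlgebraFin F n R).compLinearMap
        fun t => if t = ⟨r, hlt⟩ then LinearMap.mulLeft F z else LinearMap.id
    refine ⟨f, fun v => ?_⟩
    have hsplit : List.finRange n = (List.finRange n).take r ++
        (⟨r, hlt⟩ :: (List.finRange n).drop (r + 1)) := by
      conv_lhs => rw [← List.take_append_drop r (List.finRange n),
        List.drop_eq_getElem_cons (by simpa using hlt)]
      simp
    have hnd := List.nodup_finRange n
    rw [hsplit, List.nodup_append] at hnd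
    have hT : ∀ t ∈ (List.finRange n).take r, t ≠ ⟨r, hlt⟩ := fun t ht =>
      hnd.2.2 t ht _ (List.mem_cons_self)
    have hD : ∀ t ∈ (List.finRange n).drop (r + 1), t ≠ ⟨r, hlt⟩ := fun t ht h =>
      (List.nodup_cons.1 hnd.2.1).1 (h ▸ ht)
    have hdrop : (List.finRange n).drop r =
        ⟨r, hlt⟩ :: (List.finRange n).drop (r + 1) := by
      rw [List.drop_eq_getElem_cons (by simpa using hlt)]
      simp
    simp only [f, MultilinearMap.compLinearMap_apply, MultilinearMap.mkPiAlgebraFin_apply]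
    rw [List.ofFn_eq_map, hsplit, List.map_append, List.map_cons, List.prod_append,
      List.prod_cons, insertProd, hdrop, List.map_cons, List.prod_cons]
    have e1 := List.map_congr_left (g := v) (f := fun t =>
      (if t = ⟨r, hlt⟩ then LinearMap.mulLeft F z else LinearMap.id : R →ₗ[F] R) (v t))
      (l := (List.finRange n).take r) fun t ht => by rw [if_neg (hT t ht)]; rfl
    have e2 := List.map_congr_left (g := v) (f := fun t =>
      (if t = ⟨r, hlt⟩ then LinearMap.mulLeft F z else LinearMap.id : R →ₗ[F] R) (v t))
      (l := (List.finRange n).drop (r + 1)) fun t ht => by rw [if_neg (hD t ht)]; rfl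
    rw [e1, e2]
    simp [mul_assoc]
  · refine ⟨(LinearMap.mulRight F z).compMultilinearMap (MultilinearMap.mkPiAlgebraFin F r R),
      fun v => ?_⟩
    have h1 : (List.finRange r).take r = List.finRange r := List.take_of_length_le (by simp)
    have h2 : (List.finRange r).drop r = [] := List.drop_of_length_le (by simp)
    simp [insertProd, h1, h2, List.ofFn_eq_map]

lemma MultilinearMap.sum_perm_eq {n : ℕ} (f : MultilinearMap F (fun _ : Fin n => R) R)
    (v : Fin n → R) :
    ∑ σ : Equiv.Perm (Fin n), f (fun t => v (σ t)) =
      ∑ U : Finset (Fin n), (-1 : ℤ) ^ U.card • f (fun _ => ∑ s ∈ Uᶜ, v s) := by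
  classical
  have h1 : ∀ U : Finset (Fin n), f (fun _ => ∑ s ∈ Uᶜ, v s) =
      ∑ g : Fin n → Fin n, if U ⊆ (Finset.univ.image g)ᶜ then f (fun t => v (g t)) else 0 := by
    intro U
    rw [f.map_sum_finset (fun _ s => v s) (fun _ => Uᶜ), ← Finset.sum_filter]
    refine Finset.sum_congr ?_ fun _ _ => rfl
    ext g
    simp only [Fintype.mem_piFinset, Finset.mem_compl, Finset.mem_filter, Finset.mem_univ,
      true_and, Finset.subset_iff, Finset.mem_image, not_exists]
    exact ⟨fun h s hs t ht => h t (ht ▸ hs), fun h t ht => h ht t rfl⟩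
  simp only [h1, Finset.smul_sum]
  rw [Finset.sum_comm]
  have h2 : ∀ g : Fin n → Fin n, (∑ U : Finset (Fin n), (-1 : ℤ) ^ U.card •
      (if U ⊆ (Finset.univ.image g)ᶜ then f (fun t => v (g t)) else 0)) =
      if Function.Surjective g then f (fun t => v (g t)) else 0 := by
    intro g
    simp only [smul_ite, smul_zero]
    rw [← Finset.sum_filter]
    have h3 : (Finset.univ.filter fun U => U ⊆ (Finset.univ.image g)ᶜ) =
        ((Finset.univ.image g)ᶜ).powerset := by
      ext; simp
    rw [h3, ← Finset.sum_smul, Finset.sum_powerset_neg_one_pow_card]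
    have h4 : (Finset.univ.image g)ᶜ = ∅ ↔ Function.Surjective g := by
      rw [Finset.compl_eq_empty_iff, ← Finset.coe_inj, Finset.coe_image, Finset.coe_univ,
        Set.image_univ, Set.range_eq_univ]
    simp only [h4]
    split_ifs <;> simp
  simp only [h2]
  rw [← Finset.sum_filter]
  refine Finset.sum_bij (fun σ _ => (σ : Fin n → Fin n)) ?_ ?_ ?_ ?_
  · intro σ _; simpa using σ.surjective
  · intro σ _ τ _ h; exact Equiv.coe_fn_injective h
  · intro g hg
    have hs : Function.Surjective g := by simpa using hg
    exact ⟨Equiv.ofBijective g (Finite.surjective_iff_bijective.1 hs), Finset.mem_univ _, rfl⟩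
  · intro σ _; rfl

lemma sum_perm_insertProd (c : ℕ → F) {n : ℕ} (v : Fin n → R) (z : R) :
    ∑ σ : Equiv.Perm (Fin n), ∑ r ∈ Finset.range (n + 1),
        c r • insertProd (fun t => v (σ t)) z r =
      ∑ U : Finset (Fin n), (-1 : ℤ) ^ U.card • ∑ r ∈ Finset.range (n + 1),
        c r • ((∑ s ∈ Uᶜ, v s) ^ r * z * (∑ s ∈ Uᶜ, v s) ^ (n - r)) := by
  simp only [Finset.smul_sum]
  rw [Finset.sum_comm, Finset.sum_comm (s := Finset.univ)]
  refine Finset.sum_congr rfl fun r hr => ?_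
  have hr' := Nat.lt_succ_iff.1 (Finset.mem_range.1 hr)
  obtain ⟨f, hf⟩ := exists_multilinear_insertProd F hr' z
  have h := MultilinearMap.sum_perm_eq f v
  simp only [hf, insertProd_const hr'] at h
  rw [← Finset.smul_sum, h, Finset.smul_sum]
  refine Finset.sum_congr rfl fun U _ => ?_
  rw [smul_comm]

end Polarization

section Exchange

variable {F : Type*} [Field F] {R : Type*} [Ring R] [Algebra F R]

/-- The quadratic exchange relation between the currents with modes `a` and `b`. -/
def Exch (p : F) (a b : ℤ → R) : Prop :=
  ∀ k l : ℤ, a (k + 1) * b l - p • (b l * a (k + 1)) =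
    p • (a k * b (l + 1)) - b (l + 1) * a k

namespace Exch

variable {p : F} {a b : ℤ → R}

lemma symm (h : Exch p a b) : Exch p b a := by
  intro k l
  have := h l k
  linear_combination (norm := module) this

lemma shift (h : Exch p a b) (s t : ℤ) : Exch p (fun k => a (k + s)) (fun k => b (k + t)) := by
  intro k l
  have := h (k + s) (l + t)
  simp only [add_right_comm _ (1 : ℤ)]
  exact this

lemma reflect (hp : p ≠ 0) (h : Exch p a b) :
    Exch p⁻¹ (fun k => a (-k)) (fun k => b (-k)) := by
  intro k l
  have := h (-(k + 1)) (-(l + 1))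
  rw [show -(k + 1) + 1 = -k by ring, show -(l + 1) + 1 = -l by ring] at this
  have h2 := congrArg (fun z => p⁻¹ • z) this
  simp only [smul_sub, smul_smul, inv_mul_cancel₀ hp, one_smul] at h2 ⊢
  linear_combination (norm := module) -h2

lemma zero_left (p : F) (b : ℤ → R) : Exch p (fun _ => 0) b := by
  intro k l; simp

lemma sum_left {ι : Type*} (T : Finset ι) {a : ι → ℤ → R} (h : ∀ s ∈ T, Exch p (a s) b) :
    Exch p (fun k => ∑ s ∈ T, a s k) b := by
  intro k l
  simp only [Finset.sum_mul, Finset.mul_sum, Finset.smul_sum, ← Finset.sum_sub_distrib]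
  exact Finset.sum_congr rfl fun s hs => h s hs k l

end Exch

lemma commute_quadratic {p : F} {y : R} {a b a' b' : ℤ → R}
    (ha : ∀ k, y * a k - a k * y = a' k) (hb : ∀ k, y * b k - b k * y = b' k)
    (h₁ : Exch p a' b) (h₂ : Exch p a b') (k l : ℤ) :
    Commute y (a (k + 1) * b l - p • (b l * a (k + 1)) -
      (p • (a k * b (l + 1)) - b (l + 1) * a k)) := by
  have comm : ∀ u v u' v' : R, y * u - u * y = u' → y * v - v * y = v' →
      y * (u * v) - u * v * y = u' * v + u * v' := by
    rintro u v _ _ rfl rfl; noncomm_ring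
  have e1 := comm _ _ _ _ (ha (k + 1)) (hb l)
  have e2 := comm _ _ _ _ (hb l) (ha (k + 1))
  have e3 := comm _ _ _ _ (ha k) (hb (l + 1))
  have e4 := comm _ _ _ _ (hb (l + 1)) (ha k)
  have f1 := h₁ k l
  have f2 := h₂ k l
  show y * _ = _ * y
  simp only [mul_sub, sub_mul, mul_smul_comm, smul_mul_assoc]
  linear_combination (norm := module) e1 - p • e2 - p • e3 + e4 + f1 + f2

open PowerSeries

lemma exch_powerSeries {p : F} {a b : ℤ → R} (hab : Exch p a b) (e' f : ℕ → F) :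
    (X * mk fun j : ℕ => e' j • a (j + 1)) * (mk fun j : ℕ => f j • b j) -
      p • ((mk fun j : ℕ => e' j • a j) * (X * mk fun j : ℕ => f j • b (j + 1))) +
      (X * mk fun j : ℕ => f j • b (j + 1)) * (mk fun j : ℕ => e' j • a j) -
      p • ((mk fun j : ℕ => f j • b j) * (X * mk fun j : ℕ => e' j • a (j + 1))) =
        (0 : PowerSeries R) := by
  set Y : PowerSeries R := mk fun j : ℕ => e' j • a (j + 1)
  set E : PowerSeries R := mk fun j : ℕ => e' j • a j
  set W : PowerSeries R := mk fun j : ℕ => f j • b (j + 1)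
  set U : PowerSeries R := mk fun j : ℕ => f j • b j
  have hX : ∀ z w : PowerSeries R, z * (X * w) = X * (z * w) := fun z w => by
    rw [← mul_assoc, ← mul_assoc, (PowerSeries.commute_X z).eq]
  have key : Y * U - p • (E * W) + W * E - p • (U * Y) = 0 := by
    have hsm : ∀ (n : ℕ) (φ : PowerSeries R), coeff n (p • φ) = p • coeff n φ :=
      fun _ _ => rfl
    ext n
    simp only [map_add, map_sub, hsm, map_zero, coeff_mul, Finset.smul_sum]
    rw [← Finset.Nat.sum_antidiagonal_swap (f := fun x => coeff x.1 W * coeff x.2 E),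
      ← Finset.Nat.sum_antidiagonal_swap (f := fun x => p • (coeff x.1 U * coeff x.2 Y)),
      ← Finset.sum_sub_distrib, ← Finset.sum_add_distrib, ← Finset.sum_sub_distrib]
    refine Finset.sum_eq_zero fun x _ => ?_
    have h := congrArg (fun z => (e' x.1 * f x.2) • z) (hab x.1 x.2)
    simp only [Y, E, W, U, coeff_mk, Prod.fst_swap, Prod.snd_swap, smul_mul_smul_comm]
    simp only [smul_sub, smul_smul] at h ⊢
    linear_combination (norm := module) h
  rw [hX, hX, mul_assoc, mul_assoc, ← mul_smul_comm p X, ← mul_smul_comm p X, ← mul_sub,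
    ← mul_add, ← mul_sub, key, mul_zero]

/-- The coefficients of the resolvent `(Y - P E) = a 0`. -/
def resolventCoeff (P : F) (j : ℕ) : F := -(P⁻¹) ^ (j + 1)

lemma resolvent_eq {P : F} (hP : P ≠ 0) (a : ℤ → R) :
    (X * mk fun j : ℕ => resolventCoeff P j • a (j + 1)) -
      P • (mk fun j : ℕ => resolventCoeff P j • a j) = C (a 0) := by
  have hsm : ∀ (n : ℕ) (φ : PowerSeries R), coeff n (P • φ) = P • coeff n φ := fun _ _ => rfl
  ext n
  cases n with
  | zero =>
    simp only [map_sub, hsm, coeff_zero_X_mul, coeff_mk, smul_smul, coeff_C, resolventCoeff]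
    simp [hP]
  | succ n =>
    simp only [map_sub, hsm, coeff_succ_X_mul, coeff_mk, smul_smul, coeff_C, resolventCoeff]
    rw [if_neg n.succ_ne_zero, show P * -P⁻¹ ^ (n + 1 + 1) = -P⁻¹ ^ (n + 1) by
      rw [pow_succ']; field_simp]
    simp

/-- The modes vanish far in the negative direction. -/
def ZeroBelow (a : ℤ → R) : Prop := ∃ k₀, ∀ k < k₀, a k = 0

/-- The modes vanish far in the positive direction. -/
def ZeroAbove (a : ℤ → R) : Prop := ∃ k₀, ∀ k > k₀, a k = 0

lemma exch_powerSeries_bounded {p : F} {a b : ℤ → R} (hab : Exch p a b) (e' : ℕ → F)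
    {k₀ : ℤ} (hb : b k₀ = 0) :
    ((X * mk fun j : ℕ => e' j • a (j + 1)) - p • (mk fun j : ℕ => e' j • a j)) *
      (mk fun j : ℕ => b (k₀ + j)) =
    (mk fun j : ℕ => b (k₀ + j)) * (p • (X * mk fun j : ℕ => e' j • a (j + 1)) -
      (mk fun j : ℕ => e' j • a j)) := by
  have h := exch_powerSeries (hab.shift 0 k₀) e' (fun _ => 1)
  have hW : (X * mk fun j : ℕ => (1 : F) • b ((j : ℤ) + 1 + k₀) : PowerSeries R) =
      mk fun j : ℕ => b (k₀ + j) := by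
    ext n
    cases n with
    | zero => simp [hb]
    | succ n =>
      rw [coeff_succ_X_mul, coeff_mk, coeff_mk, one_smul]
      congr 1; push_cast; ring
  have hU : (mk fun j : ℕ => (1 : F) • b ((j : ℤ) + k₀) : PowerSeries R) =
      mk fun j : ℕ => b (k₀ + j) := by
    ext n; rw [coeff_mk, coeff_mk, one_smul, add_comm]
  rw [hW, hU] at h
  simp only [add_zero] at h
  simp only [sub_mul, mul_sub, smul_mul_assoc, mul_smul_comm]
  linear_combination (norm := module) h

lemma resolvent_qPlane [CharZero F] {q : F} {a : ℤ → R} (ha : Exch (q ^ 2) a a) (e' : ℕ → F) :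
    (X * mk fun j : ℕ => e' j • a (j + 1)) * (mk fun j : ℕ => e' j • a j : PowerSeries R) =
      q ^ 2 • ((mk fun j : ℕ => e' j • a j) * (X * mk fun j : ℕ => e' j • a (j + 1))) := by
  have h := exch_powerSeries ha e' e'
  have h2 := congrArg (fun z => (2⁻¹ : F) • z) h
  simp only [smul_zero, smul_sub, smul_add, smul_smul] at h2
  rw [← sub_eq_zero, ← h2]
  match_scalars <;> ring

lemma serre_of_zeroBelow [CharZero F] {q : F} (hq : q ≠ 0) {n : ℕ} (hn : 0 < n)
    {a b : ℤ → R} (haa : Exch (q ^ 2) a a) (hab : Exch (q ^ (1 - n : ℤ)) a b)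
    (hb : ZeroBelow b) (k : ℤ) :
    ∑ r ∈ Finset.range (n + 1), ((-1) ^ r * gaussBinom q n r) •
      (a 0 ^ r * b k * a 0 ^ (n - r)) = 0 := by
  obtain ⟨k₀, hk₀⟩ := hb
  rcases lt_or_ge k k₀ with hk | hk
  · simp [hk₀ k hk]
  set P : F := q ^ (1 - n : ℤ) with hP
  have hP0 : P ≠ 0 := zpow_ne_zero _ hq
  have h1 := resolvent_eq hP0 a
  have h2 := exch_powerSeries_bounded hab (resolventCoeff P) (hk₀ (k₀ - 1) (by omega))
  have h3 := qBinomSum_eq_zero hq (resolvent_qPlane haa (resolventCoeff P)) hn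
  rw [← hP, h1] at h3
  rw [h1] at h2
  set B : PowerSeries R := mk fun j : ℕ => b (k₀ - 1 + j)
  set α : PowerSeries R := _ - mk fun j : ℕ => resolventCoeff P j • a j
  have h4 : ∀ r, C (a 0) ^ r * B = B * α ^ r := fun r =>
    ((show SemiconjBy B α (C (a 0)) from h2.symm).pow_right r).symm
  have h5 : ∑ r ∈ Finset.range (n + 1), ((-1 : F) ^ r * gaussBinom q n r) •
      (C (a 0) ^ r * B * C (a 0) ^ (n - r)) = 0 := by
    rw [← mul_zero B, ← h3, qBinomSum, Finset.mul_sum]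
    refine Finset.sum_congr rfl fun r _ => ?_
    rw [h4, mul_smul_comm, mul_assoc]
  have h6 := congrArg (coeff (k - (k₀ - 1)).toNat) h5
  have hsm : ∀ (c : F) (n : ℕ) (φ : PowerSeries R), coeff n (c • φ) = c • coeff n φ :=
    fun _ _ _ => rfl
  simp only [map_sum, hsm, ← map_pow, coeff_C_mul, coeff_mul_C, map_zero, B, coeff_mk] at h6
  rw [← h6, Int.toNat_of_nonneg (by omega)]
  simp

lemma serre_of_zeroAbove [CharZero F] {q : F} (hq : IsGeneric q) {n : ℕ} (hn : 0 < n)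
    {a b : ℤ → R} (haa : Exch (q ^ 2) a a) (hab : Exch (q ^ (1 - n : ℤ)) a b)
    (hb : ZeroAbove b) (k : ℤ) :
    ∑ r ∈ Finset.range (n + 1), ((-1) ^ r * gaussBinom q n r) •
      (a 0 ^ r * b k * a 0 ^ (n - r)) = 0 := by
  obtain ⟨k₀, hk₀⟩ := hb
  have h1 := haa.reflect (pow_ne_zero 2 hq.1)
  have h2 := hab.reflect (zpow_ne_zero _ hq.1)
  rw [← inv_pow] at h1
  rw [← inv_zpow] at h2
  have h := serre_of_zeroBelow (inv_ne_zero hq.1) hn h1 h2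
    ⟨-k₀, fun k hk => hk₀ _ (by omega)⟩ (-k)
  simpa only [gaussBinom_inv hq, neg_neg, neg_zero] using h

lemma serre_derivation_of_zeroBelow [CharZero F] {q : F} (hq : IsGeneric q) (m : ℕ)
    {a b c : ℤ → R} (haa : Exch (q ^ 2) a a) (hab : Exch (q ^ (-m : ℤ)) a b)
    (hac : Exch (q ^ 2) a c) (hbc : Exch (q ^ (-m : ℤ)) b c)
    (hc : ZeroBelow c) (k : ℤ) :
    ∑ r ∈ Finset.range (m + 2), ((-1 : F) ^ r * gaussBinom q (m + 1) r) •
      ((∑ s ∈ Finset.range r, a 0 ^ s * c k * a 0 ^ (r - 1 - s)) * b 0 * a 0 ^ (m + 1 - r) +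
        a 0 ^ r * b 0 *
          ∑ s ∈ Finset.range (m + 1 - r), a 0 ^ s * c k * a 0 ^ (m + 1 - r - 1 - s)) = 0 := by
  obtain ⟨k₀, hk₀⟩ := hc
  rcases lt_or_ge k k₀ with hk | hk
  · simp [hk₀ k hk]
  set P : F := q ^ (-m : ℤ) with hP
  have hP0 : P ≠ 0 := zpow_ne_zero _ hq.1
  have hq2 : q ^ 2 ≠ 0 := pow_ne_zero 2 hq.1
  have ea := resolvent_eq hq2 a
  have eb := resolvent_eq hP0 b
  have fa := exch_powerSeries_bounded hac (resolventCoeff (q ^ 2)) (hk₀ (k₀ - 1) (by omega))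
  have fb := exch_powerSeries_bounded hbc (resolventCoeff P) (hk₀ (k₀ - 1) (by omega))
  have h3 := qPlane_derivation_sum hq (resolvent_qPlane haa (resolventCoeff (q ^ 2))) m
    (exch_powerSeries hab (resolventCoeff (q ^ 2)) (resolventCoeff P))
  rw [← hP, ea, eb] at h3
  rw [ea] at fa
  rw [eb] at fb
  set B : PowerSeries R := mk fun j : ℕ => c (k₀ - 1 + j)
  set α : PowerSeries R := _ - mk fun j : ℕ => resolventCoeff (q ^ 2) j • a j
  set α₀ : PowerSeries R := _ - mk fun j : ℕ => resolventCoeff P j • b j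
  have h4 : ∀ r, C (a 0) ^ r * B = B * α ^ r := fun r =>
    ((show SemiconjBy B α (C (a 0)) from fa.symm).pow_right r).symm
  have hH : ∀ r, ∑ s ∈ Finset.range r, C (a 0) ^ s * B * C (a 0) ^ (r - 1 - s) =
      B * homogSum α (C (a 0)) r := fun r => by
    rw [homogSum, Finset.mul_sum]
    exact Finset.sum_congr rfl fun s _ => by rw [h4, mul_assoc]
  have h5 : ∑ r ∈ Finset.range (m + 2), ((-1 : F) ^ r * gaussBinom q (m + 1) r) •
      ((∑ s ∈ Finset.range r, C (a 0) ^ s * B * C (a 0) ^ (r - 1 - s)) * C (b 0) *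
          C (a 0) ^ (m + 1 - r) +
        C (a 0) ^ r * C (b 0) *
          ∑ s ∈ Finset.range (m + 1 - r), C (a 0) ^ s * B * C (a 0) ^ (m + 1 - r - 1 - s)) =
        0 := by
    rw [← mul_zero B, ← h3, Finset.mul_sum]
    refine Finset.sum_congr rfl fun r _ => ?_
    have h7 : C (a 0) ^ r * C (b 0) * B = B * (α ^ r * α₀) := by
      rw [mul_assoc, fb, ← mul_assoc, h4, mul_assoc]
    rw [hH, hH, mul_smul_comm, mul_add, ← mul_assoc _ B, h7]
    simp only [mul_assoc]
  have h6 := congrArg (coeff (k - (k₀ - 1)).toNat) h5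
  have hsm : ∀ (c : F) (n : ℕ) (φ : PowerSeries R), coeff n (c • φ) = c • coeff n φ :=
    fun _ _ _ => rfl
  simp only [map_sum, hsm, ← map_pow, ← map_mul, mul_assoc, map_add, Finset.sum_mul,
    Finset.mul_sum, coeff_C_mul, coeff_mul_C, map_zero, B, coeff_mk] at h6
  simp only [← mul_assoc] at h6
  rw [Int.toNat_of_nonneg (by omega)] at h6
  simp only [Finset.sum_mul, Finset.mul_sum, ← mul_assoc]
  rw [← h6]
  simp

lemma serre_derivation_of_zeroAbove [CharZero F] {q : F} (hq : IsGeneric q) (m : ℕ)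
    {a b c : ℤ → R} (haa : Exch (q ^ 2) a a) (hab : Exch (q ^ (-m : ℤ)) a b)
    (hac : Exch (q ^ 2) a c) (hbc : Exch (q ^ (-m : ℤ)) b c)
    (hc : ZeroAbove c) (k : ℤ) :
    ∑ r ∈ Finset.range (m + 2), ((-1 : F) ^ r * gaussBinom q (m + 1) r) •
      ((∑ s ∈ Finset.range r, a 0 ^ s * c k * a 0 ^ (r - 1 - s)) * b 0 * a 0 ^ (m + 1 - r) +
        a 0 ^ r * b 0 *
          ∑ s ∈ Finset.range (m + 1 - r), a 0 ^ s * c k * a 0 ^ (m + 1 - r - 1 - s)) = 0 := by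
  obtain ⟨k₀, hk₀⟩ := hc
  have h1 := haa.reflect (pow_ne_zero 2 hq.1)
  have h2 := hab.reflect (zpow_ne_zero _ hq.1)
  have h3 := hac.reflect (pow_ne_zero 2 hq.1)
  have h4 := hbc.reflect (zpow_ne_zero _ hq.1)
  rw [← inv_pow] at h1 h3
  rw [← inv_zpow] at h2 h4
  have h := serre_derivation_of_zeroBelow hq.inv m h1 h2 h3 h4
    ⟨-k₀, fun k hk => hk₀ _ (by omega)⟩ (-k)
  simpa only [gaussBinom_inv hq, neg_neg, neg_zero] using h

lemma commutator_pow (y a : R) (r : ℕ) : y * a ^ r - a ^ r * y =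
    ∑ s ∈ Finset.range r, a ^ s * (y * a - a * y) * a ^ (r - 1 - s) := by
  induction r with
  | zero => simp
  | succ r ih =>
    rw [Finset.sum_range_succ, Nat.add_sub_cancel, Nat.sub_self, pow_zero, mul_one]
    have h : ∑ s ∈ Finset.range r, a ^ s * (y * a - a * y) * a ^ (r - s) =
        (∑ s ∈ Finset.range r, a ^ s * (y * a - a * y) * a ^ (r - 1 - s)) * a := by
      rw [Finset.sum_mul]
      refine Finset.sum_congr rfl fun s hs => ?_
      have : r - s = (r - 1 - s) + 1 := by have := Finset.mem_range.1 hs; omega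
      rw [this, pow_succ]
      simp only [mul_assoc]
    rw [h, ← ih, pow_succ]
    noncomm_ring

/-- The diagonal quantum Serre element. -/
def serreElt (q : F) (n : ℕ) (x z : R) : R :=
  ∑ r ∈ Finset.range (n + 1), ((-1) ^ r * gaussBinom q n r) • (x ^ r * z * x ^ (n - r))

lemma commute_serreElt [CharZero F] {q : F} (hq : IsGeneric q) (m : ℕ) {y : R}
    {a b cp cm bp bm : ℤ → R} (haa : Exch (q ^ 2) a a) (hab : Exch (q ^ (-m : ℤ)) a b)
    (hacp : Exch (q ^ 2) a cp) (hacm : Exch (q ^ 2) a cm)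
    (hbcp : Exch (q ^ (-m : ℤ)) b cp) (hbcm : Exch (q ^ (-m : ℤ)) b cm)
    (habp : Exch (q ^ (-m : ℤ)) a bp) (habm : Exch (q ^ (-m : ℤ)) a bm)
    (hcp : ZeroBelow cp) (hcm : ZeroAbove cm) (hbp : ZeroBelow bp) (hbm : ZeroAbove bm)
    (hya : y * a 0 - a 0 * y = cp 0 - cm 0) (hyb : y * b 0 - b 0 * y = bp 0 - bm 0) :
    Commute y (serreElt q (m + 1) (a 0) (b 0)) := by
  have e0 : (1 - (m + 1 : ℕ) : ℤ) = -m := by push_cast; ring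
  have e1 := serre_of_zeroBelow hq.1 m.succ_pos haa (by rwa [e0]) hbp 0
  have e2 := serre_of_zeroAbove hq m.succ_pos haa (by rwa [e0]) hbm 0
  have e3 := serre_derivation_of_zeroBelow hq m haa hab hacp hbcp hcp 0
  have e4 := serre_derivation_of_zeroAbove hq m haa hab hacm hbcm hcm 0
  show y * _ = _ * y
  rw [← sub_eq_zero, serreElt, Finset.mul_sum, Finset.sum_mul, ← Finset.sum_sub_distrib]
  have hterm : ∀ r, y * ((-1 : F) ^ r * gaussBinom q (m + 1) r) •
        (a 0 ^ r * b 0 * a 0 ^ (m + 1 - r)) -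
      ((-1 : F) ^ r * gaussBinom q (m + 1) r) • (a 0 ^ r * b 0 * a 0 ^ (m + 1 - r)) * y =
      ((-1 : F) ^ r * gaussBinom q (m + 1) r) • ((∑ s ∈ Finset.range r,
          a 0 ^ s * cp 0 * a 0 ^ (r - 1 - s)) * b 0 * a 0 ^ (m + 1 - r) +
        a 0 ^ r * b 0 *
          ∑ s ∈ Finset.range (m + 1 - r), a 0 ^ s * cp 0 * a 0 ^ (m + 1 - r - 1 - s)) -
      ((-1 : F) ^ r * gaussBinom q (m + 1) r) • ((∑ s ∈ Finset.range r,
          a 0 ^ s * cm 0 * a 0 ^ (r - 1 - s)) * b 0 * a 0 ^ (m + 1 - r) +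
        a 0 ^ r * b 0 *
          ∑ s ∈ Finset.range (m + 1 - r), a 0 ^ s * cm 0 * a 0 ^ (m + 1 - r - 1 - s)) +
      ((-1 : F) ^ r * gaussBinom q (m + 1) r) • (a 0 ^ r * bp 0 * a 0 ^ (m + 1 - r)) -
      ((-1 : F) ^ r * gaussBinom q (m + 1) r) • (a 0 ^ r * bm 0 * a 0 ^ (m + 1 - r)) := by
    intro r
    have hsub : ∀ t : ℕ, ∑ s ∈ Finset.range t, a 0 ^ s * (cp 0 - cm 0) * a 0 ^ (t - 1 - s) =
        (∑ s ∈ Finset.range t, a 0 ^ s * cp 0 * a 0 ^ (t - 1 - s)) -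
          ∑ s ∈ Finset.range t, a 0 ^ s * cm 0 * a 0 ^ (t - 1 - s) := fun t => by
      rw [← Finset.sum_sub_distrib]
      exact Finset.sum_congr rfl fun s _ => by rw [mul_sub, sub_mul]
    have c1 := commutator_pow y (a 0) r
    have c2 := commutator_pow y (a 0) (m + 1 - r)
    rw [hya, hsub] at c1 c2
    rw [mul_smul_comm, smul_mul_assoc, ← smul_sub, ← smul_sub, ← smul_add, ← smul_sub]
    congr 1
    set S₁ := ∑ s ∈ Finset.range r, a 0 ^ s * cp 0 * a 0 ^ (r - 1 - s)
    set S₂ := ∑ s ∈ Finset.range r, a 0 ^ s * cm 0 * a 0 ^ (r - 1 - s)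
    set T₁ := ∑ s ∈ Finset.range (m + 1 - r), a 0 ^ s * cp 0 * a 0 ^ (m + 1 - r - 1 - s)
    set T₂ := ∑ s ∈ Finset.range (m + 1 - r), a 0 ^ s * cm 0 * a 0 ^ (m + 1 - r - 1 - s)
    set u := a 0 ^ r
    set v := a 0 ^ (m + 1 - r)
    calc y * (u * b 0 * v) - u * b 0 * v * y =
        (y * u - u * y) * b 0 * v + u * (y * b 0 - b 0 * y) * v + u * b 0 * (y * v - v * y) := by
          noncomm_ring
      _ = _ := by rw [c1, c2, hyb]; noncomm_ring
  rw [Finset.sum_congr rfl fun r _ => hterm r, Finset.sum_sub_distrib, Finset.sum_add_distrib,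
    Finset.sum_sub_distrib, e1, e2, e3, e4]
  simp

end Exchange

section PolarizedExchange

variable {F : Type*} [Field F] {R : Type*} [Ring R] [Algebra F R]

lemma ZeroBelow.sum_shift {ι : Type*} {c : ℤ → R} (hc : ZeroBelow c) (T : Finset ι) (s : ι → ℤ) :
    ZeroBelow fun k => ∑ t ∈ T, c (k + s t) := by
  classical
  obtain ⟨k₀, hk₀⟩ := hc
  induction T using Finset.induction_on with
  | empty => exact ⟨0, fun k _ => by simp⟩
  | insert t T ht ih =>
    obtain ⟨k₁, hk₁⟩ := ih
    refine ⟨min k₁ (k₀ - s t), fun k hk => ?_⟩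
    beta_reduce at hk₁ ⊢
    rw [Finset.sum_insert ht, hk₁ k (lt_of_lt_of_le hk (min_le_left _ _)),
      hk₀ _ (by have := lt_of_lt_of_le hk (min_le_right k₁ (k₀ - s t)); omega), add_zero]

lemma ZeroAbove.sum_shift {ι : Type*} {c : ℤ → R} (hc : ZeroAbove c) (T : Finset ι) (s : ι → ℤ) :
    ZeroAbove fun k => ∑ t ∈ T, c (k + s t) := by
  classical
  obtain ⟨k₀, hk₀⟩ := hc
  induction T using Finset.induction_on with
  | empty => exact ⟨0, fun k _ => by simp⟩
  | insert t T ht ih =>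
    obtain ⟨k₁, hk₁⟩ := ih
    refine ⟨max k₁ (k₀ - s t), fun k hk => ?_⟩
    beta_reduce at hk₁ ⊢
    rw [Finset.sum_insert ht, hk₁ k (lt_of_le_of_lt (le_max_left _ _) hk),
      hk₀ _ (by have := lt_of_le_of_lt (le_max_right k₁ (k₀ - s t)) hk; omega), add_zero]

lemma ZeroBelow.shift {c : ℤ → R} (hc : ZeroBelow c) (s : ℤ) : ZeroBelow fun k => c (k + s) := by
  simpa using hc.sum_shift ({()} : Finset Unit) fun _ => s

lemma ZeroAbove.shift {c : ℤ → R} (hc : ZeroAbove c) (s : ℤ) : ZeroAbove fun k => c (k + s) := by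
  simpa using hc.sum_shift ({()} : Finset Unit) fun _ => s

lemma Exch.sum_shift_left {ι : Type*} {p : F} {a b : ℤ → R} (h : Exch p a b) (T : Finset ι)
    (s : ι → ℤ) : Exch p (fun k => ∑ t ∈ T, a (k + s t)) b :=
  Exch.sum_left T fun t _ => by simpa using h.shift (s t) 0

lemma Exch.sum_shift_right {ι : Type*} {p : F} {a b : ℤ → R} (h : Exch p a b) (T : Finset ι)
    (s : ι → ℤ) : Exch p a (fun k => ∑ t ∈ T, b (k + s t)) :=
  (h.symm.sum_shift_left T s).symm

lemma Exch.shift_right {p : F} {a b : ℤ → R} (h : Exch p a b) (s : ℤ) :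
    Exch p a (fun k => b (k + s)) := by
  simpa using h.shift 0 s

lemma Exch.shift_left {p : F} {a b : ℤ → R} (h : Exch p a b) (s : ℤ) :
    Exch p (fun k => a (k + s)) b := by
  simpa using h.shift s 0

/-- An operator whose commutators with the modes of two exchanging currents are differences of
bounded currents commutes with the quantum Serre elements of the two currents. -/
lemma commute_symSerreElt [CharZero F] {q : F} (hq : IsGeneric q) (m : ℕ) {y : R}
    {a b cp cm bp bm : ℤ → R} (haa : Exch (q ^ 2) a a) (hab : Exch (q ^ (-m : ℤ)) a b)
    (hacp : Exch (q ^ 2) a cp) (hacm : Exch (q ^ 2) a cm)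
    (hbcp : Exch (q ^ (-m : ℤ)) b cp) (hbcm : Exch (q ^ (-m : ℤ)) b cm)
    (habp : Exch (q ^ (-m : ℤ)) a bp) (habm : Exch (q ^ (-m : ℤ)) a bm)
    (hcp : ZeroBelow cp) (hcm : ZeroAbove cm) (hbp : ZeroBelow bp) (hbm : ZeroAbove bm)
    (hya : ∀ k, y * a k - a k * y = cp k - cm k) (hyb : ∀ k, y * b k - b k * y = bp k - bm k)
    (ks : Fin (m + 1) → ℤ) (l : ℤ) :
    Commute y (∑ σ : Equiv.Perm (Fin (m + 1)), ∑ r ∈ Finset.range (m + 1 + 1),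
      ((-1) ^ r * gaussBinom q (m + 1) r) • insertProd (fun t => a (ks (σ t))) (b l) r) := by
  rw [sum_perm_insertProd (fun r => (-1) ^ r * gaussBinom q (m + 1) r) (fun t => a (ks t))]
  refine Commute.sum_right _ _ _ fun U _ => Commute.smul_right ?_ _
  have h := commute_serreElt hq m (y := y) (a := fun k => ∑ t ∈ Uᶜ, a (k + ks t))
    (b := fun k => b (k + l)) (cp := fun k => ∑ t ∈ Uᶜ, cp (k + ks t))
    (cm := fun k => ∑ t ∈ Uᶜ, cm (k + ks t)) (bp := fun k => bp (k + l))
    (bm := fun k => bm (k + l))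
    ((haa.sum_shift_left _ _).sum_shift_right _ _) ((hab.sum_shift_left _ _).shift_right _)
    ((hacp.sum_shift_left _ _).sum_shift_right _ _)
    ((hacm.sum_shift_left _ _).sum_shift_right _ _)
    ((hbcp.shift_left _).sum_shift_right _ _) ((hbcm.shift_left _).sum_shift_right _ _)
    ((habp.sum_shift_left _ _).shift_right _) ((habm.sum_shift_left _ _).shift_right _)
    (hcp.sum_shift _ _) (hcm.sum_shift _ _) (hbp.shift _) (hbm.shift _)
    (by simp only [Finset.mul_sum, Finset.sum_mul, ← Finset.sum_sub_distrib, hya]) (hyb _)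
  simpa [serreElt] using h

end PolarizedExchange

section Scalars

variable {d}

lemma qq_ne_zero : qq ≠ 0 := pow_ne_zero 2 RatFunc.X_ne_zero

lemma qq_pow_ne_one {n : ℕ} (hn : 0 < n) : qq ^ n ≠ 1 := by
  intro h
  have h1 : (RatFunc.X : RatFunc ℚ) ^ (2 * n) = 1 := by rw [pow_mul]; exact h
  rw [← RatFunc.algebraMap_X, ← map_pow, ← map_one (algebraMap (Polynomial ℚ) (RatFunc ℚ))] at h1
  have h2 := congrArg Polynomial.natDegree (RatFunc.algebraMap_injective ℚ h1)
  rw [Polynomial.natDegree_X_pow, Polynomial.natDegree_one] at h2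
  omega

lemma qi_ne_zero (i : Fin N) : qi d i ≠ 0 := zpow_ne_zero _ qq_ne_zero

lemma qp_ne_zero {A : Fin N → Fin N → ℤ} (i j : Fin N) : qp d A i j ≠ 0 :=
  zpow_ne_zero _ qq_ne_zero

lemma isGeneric_qi {i : Fin N} (hd : 0 < d i) : IsGeneric (qi d i) := by
  refine ⟨qi_ne_zero i, fun n hn h => ?_⟩
  obtain ⟨m, hm⟩ := Int.eq_ofNat_of_zero_le hd.le
  have hm0 : 0 < m := by omega
  refine qq_pow_ne_one (n := 2 * (m * n)) (by positivity) ?_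
  rw [symDiffPow, sub_eq_zero, qi, hm, ← zpow_mul, ← zpow_mul] at h
  have h1 : qq ^ ((m : ℤ) * n) * qq ^ ((m : ℤ) * n) = 1 := by
    nth_rw 2 [h]
    rw [← zpow_add₀ qq_ne_zero]
    simp
  rw [two_mul, pow_add]
  exact_mod_cast h1

lemma qi_sub_inv_ne_zero {i : Fin N} (hd : 0 < d i) : qi d i - (qi d i)⁻¹ ≠ 0 := by
  simpa [symDiffPow] using (isGeneric_qi hd).2 1 one_pos

lemma qbinom_eq_gaussBinom {i : Fin N} (hd : 0 < d i) {n r : ℕ} (hr : r ≤ n) :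
    qbinom d i n r = gaussBinom (qi d i) n r := by
  have h0 := qi_sub_inv_ne_zero hd
  have hf : ∀ n, qfact d i n = symFact (qi d i) n / (qi d i - (qi d i)⁻¹) ^ n := by
    intro n
    induction n with
    | zero => simp [qfact, symFact]
    | succ n ih =>
      rw [qfact, ih, symFact, qint, pow_succ, symDiffPow]
      field_simp
  have h1 := symFact_ne_zero (isGeneric_qi hd) r
  have h2 := symFact_ne_zero (isGeneric_qi hd) (n - r)
  rw [qbinom, gaussBinom_eq_div (isGeneric_qi hd) hr, hf, hf, hf]
  obtain ⟨s, rfl⟩ := Nat.exists_eq_add_of_le hr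
  rw [Nat.add_sub_cancel_left] at h2 ⊢
  rw [pow_add]
  generalize qi d i - (qi d i)⁻¹ = δ at h0
  field_simp

lemma qp_self {A : Fin N → Fin N → ℤ} (hdiag : ∀ i, A i i = 2) (i : Fin N) :
    qp d A i i = qi d i ^ 2 := by
  rw [qp, qi, hdiag, zpow_mul]; rfl

lemma qp_eq_zpow {A : Fin N → Fin N → ℤ} (i j : Fin N) : qp d A i j = qi d i ^ A i j := by
  rw [qp, qi, zpow_mul]

lemma qp_comm {A : Fin N → Fin N → ℤ} (hsym : ∀ i j, d i * A i j = d j * A j i) (i j : Fin N) :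
    qp d A i j = qp d A j i := by
  rw [qp, qp, hsym]

lemma qi_sub_inv_mul_qint {i : Fin N} (hd : 0 < d i) (A : Fin N → Fin N → ℤ) (j : Fin N) (k : ℤ) :
    (qi d i - (qi d i)⁻¹) * qint d i (k * A i j) = qp d A i j ^ k - qp d A i j ^ (-k) := by
  rw [qint, mul_div_cancel₀ _ (qi_sub_inv_ne_zero hd), qp_eq_zpow, ← zpow_mul, ← zpow_mul,
    mul_comm k, mul_neg]

end Scalars

section Relations

/-- The relations not involving the modes of the currents `x^±`, together with the centrality
of `γ^{±1/2}`. -/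
inductive CartanRel (N : ℕ) (d : Fin N → ℤ) (A : Fin N → Fin N → ℤ) : FA N → FA N → Prop
  | K_Kinv (i : Fin N) : CartanRel N d A (e (K i) * e (Kinv i)) 1
  | Kinv_K (i : Fin N) : CartanRel N d A (e (Kinv i) * e (K i)) 1
  | D_Dinv : CartanRel N d A (e D * e Dinv) 1
  | Dinv_D : CartanRel N d A (e Dinv * e D) 1
  | g_ginv : CartanRel N d A (e g2 * e g2inv) 1
  | ginv_g : CartanRel N d A (e g2inv * e g2) 1
  | g2_comm (x : Gen N) : CartanRel N d A (e g2 * e x) (e x * e g2)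
  | g2inv_comm (x : Gen N) : CartanRel N d A (e g2inv * e x) (e x * e g2inv)
  | K_comm_K (i j : Fin N) : CartanRel N d A (e (K i) * e (K j)) (e (K j) * e (K i))
  | K_comm_D (i : Fin N) : CartanRel N d A (e (K i) * e D) (e D * e (K i))
  | K_comm_h (i j : Fin N) (s : ℤ) :
      CartanRel N d A (e (K i) * e (h j s)) (e (h j s) * e (K i))
  | h_zero (i : Fin N) : CartanRel N d A (e (h i 0)) 0
  | D_h (i : Fin N) (s : ℤ) :
      CartanRel N d A (e D * e (h i s) * e Dinv) ((qq ^ s) • e (h i s))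
  | h_h (i j : Fin N) (k l : ℤ) (hk : k ≠ 0) (hl : l ≠ 0) :
      CartanRel N d A (e (h i k) * e (h j l) - e (h j l) * e (h i k))
        (if l = -k then
          ((k : Fq)⁻¹ * qint d i (k * A i j) * (qi d j - (qi d j)⁻¹)⁻¹) •
            (gammaPow k - gammaPow (-k))
         else 0)

/-- All relations except those among the `x^+` and among the `x^-`. -/
inductive BaseRel (N : ℕ) (d : Fin N → ℤ) (A : Fin N → Fin N → ℤ) : FA N → FA N → Prop
  | cartan {a b : FA N} (hab : CartanRel N d A a b) : BaseRel N d A a b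
  | D_xp (i : Fin N) (r : ℤ) :
      BaseRel N d A (e D * e (xp i r) * e Dinv) ((qq ^ r) • e (xp i r))
  | D_xm (i : Fin N) (r : ℤ) :
      BaseRel N d A (e D * e (xm i r) * e Dinv) ((qq ^ r) • e (xm i r))
  | K_xp (i j : Fin N) (r : ℤ) :
      BaseRel N d A (e (K i) * e (xp j r) * e (Kinv i)) (qp d A i j • e (xp j r))
  | K_xm (i j : Fin N) (r : ℤ) :
      BaseRel N d A (e (K i) * e (xm j r) * e (Kinv i)) ((qp d A i j)⁻¹ • e (xm j r))
  | h_xp (i j : Fin N) (k l : ℤ) (hk : k ≠ 0) :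
      BaseRel N d A (e (h i k) * e (xp j l) - e (xp j l) * e (h i k))
        (((k : Fq)⁻¹ * qint d i (k * A i j)) • (gammaHalf (-|k|) * e (xp j (k + l))))
  | h_xm (i j : Fin N) (k l : ℤ) (hk : k ≠ 0) :
      BaseRel N d A (e (h i k) * e (xm j l) - e (xm j l) * e (h i k))
        ((-((k : Fq)⁻¹ * qint d i (k * A i j))) • (gammaHalf |k| * e (xm j (k + l))))
  | xp_xm (i j : Fin N) (k l : ℤ) :
      BaseRel N d A (e (xp i k) * e (xm j l) - e (xm j l) * e (xp i k))
        (if i = j then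
          ((qi d i - (qi d i)⁻¹)⁻¹) •
            (gammaHalf (k - l) * psiEl d i (k + l) - gammaHalf (l - k) * phiEl d i (k + l))
         else 0)

variable {d A}

lemma CartanRel.toQRel {a b : FA N} (hab : CartanRel N d A a b) : QRel N d A a b := by
  cases hab <;> constructor <;> assumption

lemma BaseRel.toQRel {a b : FA N} (hab : BaseRel N d A a b) : QRel N d A a b := by
  cases hab with
  | cartan hab => exact hab.toQRel
  | _ => constructor <;> assumption

/-- The Drinfeld–Serre element. -/
def serreEl (d : Fin N → ℤ) (pm : Bool) (i j : Fin N) (n : ℕ) (ks : Fin n → ℤ) (l : ℤ) : FA N :=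
  ∑ σ : Equiv.Perm (Fin n), ∑ r ∈ Finset.range (n + 1),
    ((-1 : Fq) ^ r * qbinom d i n r) • dsTerm pm i j n ks l σ r

/-- The quadratic element in the modes of `x^+_i` and `x^+_j`, or of `x^-_i` and `x^-_j`. -/
def quadEl (d : Fin N → ℤ) (A : Fin N → Fin N → ℤ) (pm : Bool) (i j : Fin N) (k l : ℤ) : FA N :=
  match pm with
  | true => e (xp i (k + 1)) * e (xp j l) - qp d A i j • (e (xp j l) * e (xp i (k + 1))) -
      (qp d A i j • (e (xp i k) * e (xp j (l + 1))) - e (xp j (l + 1)) * e (xp i k))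
  | false => e (xm i (k + 1)) * e (xm j l) - (qp d A i j)⁻¹ • (e (xm j l) * e (xm i (k + 1))) -
      ((qp d A i j)⁻¹ • (e (xm i k) * e (xm j (l + 1))) - e (xm j (l + 1)) * e (xm i k))

/-- An algebra homomorphism out of the free algebra identifying the two sides of the given
relations. -/
def Respects {R : Type*} [Ring R] [Algebra Fq R] (rel : FA N → FA N → Prop)
    (ρ : FA N →ₐ[Fq] R) : Prop :=
  ∀ ⦃a b : FA N⦄, rel a b → ρ a = ρ b

section

variable {R : Type*} [Ring R] [Algebra Fq R] {ρ : FA N →ₐ[Fq] R}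

lemma Respects.cartan (hρ : Respects (BaseRel N d A) ρ) : Respects (CartanRel N d A) ρ :=
  fun _ _ h => hρ (.cartan h)

/-- The image of `γ^{1/2}`. -/
def Respects.gUnit (hρ : Respects (CartanRel N d A) ρ) : Rˣ where
  val := ρ (e g2)
  inv := ρ (e g2inv)
  val_inv := by rw [← map_mul, hρ .g_ginv, map_one]
  inv_val := by rw [← map_mul, hρ .ginv_g, map_one]

lemma Respects.map_gammaHalf (hρ : Respects (CartanRel N d A) ρ) (m : ℤ) :
    ρ (gammaHalf m) = (hρ.gUnit ^ m : Rˣ) := by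
  rw [gammaHalf]
  split_ifs with hm
  · obtain ⟨n, rfl⟩ := Int.eq_ofNat_of_zero_le hm
    simp [Respects.gUnit]
  · obtain ⟨n, hn⟩ := Int.eq_ofNat_of_zero_le (by omega : 0 ≤ -m)
    obtain rfl : m = -n := by omega
    simp [Respects.gUnit]

lemma Respects.commute_gUnit (hρ : Respects (CartanRel N d A) ρ) (u : FA N) :
    Commute (hρ.gUnit : R) (ρ u) := by
  induction u using FreeAlgebra.induction with
  | grade0 r => rw [AlgHom.commutes]; exact (Algebra.commutes r _).symm
  | grade1 x =>
    have h := hρ (.g2_comm x)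
    rw [map_mul, map_mul] at h
    exact h
  | mul a b ha hb => rw [map_mul]; exact ha.mul_right hb
  | add a b ha hb => rw [map_add]; exact ha.add_right hb

lemma Respects.commute_gUnit_zpow (hρ : Respects (CartanRel N d A) ρ) (m : ℤ) (u : FA N) :
    Commute ((hρ.gUnit ^ m : Rˣ) : R) (ρ u) :=
  (hρ.commute_gUnit u).units_zpow_left m

lemma Respects.commute_gammaHalf (hρ : Respects (CartanRel N d A) ρ) (m : ℤ) (u : FA N) :
    Commute (ρ (gammaHalf m)) (ρ u) := by
  rw [hρ.map_gammaHalf]; exact hρ.commute_gUnit_zpow m u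

lemma map_serreEl {i : Fin N} (hd : 0 < d i) (ρ : FA N →ₐ[Fq] R) (pm : Bool) (j : Fin N) (n : ℕ)
    (ks : Fin n → ℤ) (l : ℤ) :
    ρ (serreEl d pm i j n ks l) = ∑ σ : Equiv.Perm (Fin n), ∑ r ∈ Finset.range (n + 1),
      ((-1 : Fq) ^ r * gaussBinom (qi d i) n r) •
        insertProd (fun t => ρ (e (if pm then xp i (ks (σ t)) else xm i (ks (σ t)))))
          (ρ (e (if pm then xp j l else xm j l))) r := by
  simp only [serreEl, map_sum, map_smul]
  refine Finset.sum_congr rfl fun σ _ => Finset.sum_congr rfl fun r hr => ?_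
  rw [qbinom_eq_gaussBinom hd (Nat.lt_succ_iff.1 (Finset.mem_range.1 hr)), dsTerm, insertProd,
    map_mul, map_mul, map_list_prod, map_list_prod, List.map_map, List.map_map]
  rfl

end

end Relations

section ExpSeries

variable {F : Type*} [Field F] {R : Type*} [Ring R] [Algebra F R]

open PowerSeries

/-- The Euler operator `z d/dz` on power series with noncommutative coefficients. -/
def eulerOp (F : Type*) [Field F] [Algebra F R] (φ : PowerSeries R) : PowerSeries R :=
  mk fun n => (n : F) • coeff n φ

lemma eulerOp_mul (φ χ : PowerSeries R) :
    eulerOp F (φ * χ) = eulerOp F φ * χ + φ * eulerOp F χ := by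
  ext n
  simp only [eulerOp, coeff_mk, map_add, coeff_mul, Finset.smul_sum, ← Finset.sum_add_distrib]
  refine Finset.sum_congr rfl fun x hx => ?_
  rw [← Finset.HasAntidiagonal.mem_antidiagonal.1 hx, Nat.cast_add, add_smul, smul_mul_assoc, mul_smul_comm]

lemma eq_of_eulerOp_eq [CharZero F] {η φ χ : PowerSeries R} (hη : coeff 0 η = 0)
    (hφ : eulerOp F φ = η * φ) (hχ : eulerOp F χ = η * χ) (h0 : coeff 0 φ = coeff 0 χ) :
    φ = χ := by
  ext n
  induction n using Nat.strong_induction_on with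
  | _ n ih =>
    rcases n.eq_zero_or_pos with rfl | hn
    · exact h0
    have h1 := congrArg (coeff n) hφ
    have h2 := congrArg (coeff n) hχ
    simp only [eulerOp, coeff_mk, coeff_mul] at h1 h2
    have h3 : ∑ x ∈ Finset.HasAntidiagonal.antidiagonal n, coeff x.1 η * coeff x.2 φ =
        ∑ x ∈ Finset.HasAntidiagonal.antidiagonal n, coeff x.1 η * coeff x.2 χ := by
      refine Finset.sum_congr rfl fun x hx => ?_
      rcases Nat.eq_zero_or_pos x.1 with h | h
      · rw [h, hη, zero_mul, zero_mul]
      · rw [ih x.2 (by have := Finset.HasAntidiagonal.mem_antidiagonal.1 hx; omega)]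
    rw [h3, ← h2] at h1
    exact smul_right_injective R (Nat.cast_ne_zero.2 hn.ne' : (n : F) ≠ 0) h1

/-- The Taylor coefficients of `(1 - b t) / (1 - a t)`. -/
def mobiusCoeff (a b : F) : ℕ → F
  | 0 => 1
  | n + 1 => a ^ n * (a - b)

lemma sum_mobiusCoeff (a b : F) (n : ℕ) :
    ∑ x ∈ Finset.HasAntidiagonal.antidiagonal n, (a ^ (x.1 + 1) - b ^ (x.1 + 1)) * mobiusCoeff a b x.2 =
      (n + 1) * mobiusCoeff a b (n + 1) := by
  have hs : ∀ (c : F) (n : ℕ), ∑ x ∈ Finset.HasAntidiagonal.antidiagonal (n + 1),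
      c ^ (x.1 + 1) * mobiusCoeff a b x.2 =
      c * ∑ x ∈ Finset.HasAntidiagonal.antidiagonal n, c ^ (x.1 + 1) * mobiusCoeff a b x.2 +
        c * mobiusCoeff a b (n + 1) := fun c n => by
    rw [Finset.Nat.sum_antidiagonal_succ, Finset.mul_sum, add_comm]
    simp only [pow_succ, zero_add, pow_zero, one_mul]
    congr 1
    exact Finset.sum_congr rfl fun x _ => by ring
  have h1 : ∀ n : ℕ, ∑ x ∈ Finset.HasAntidiagonal.antidiagonal n, a ^ (x.1 + 1) * mobiusCoeff a b x.2 =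
      a ^ (n + 1) + n * a ^ n * (a - b) := fun n => by
    induction n with
    | zero => simp [mobiusCoeff]
    | succ n ih => rw [hs, ih, mobiusCoeff]; push_cast; ring
  have h2 : ∀ n : ℕ, ∑ x ∈ Finset.HasAntidiagonal.antidiagonal n, b ^ (x.1 + 1) * mobiusCoeff a b x.2 =
      b * a ^ n := fun n => by
    induction n with
    | zero => simp [mobiusCoeff]
    | succ n ih => rw [hs, ih, mobiusCoeff]; ring
  simp only [sub_mul, Finset.sum_sub_distrib, h1, h2]
  rw [mobiusCoeff]
  ring

lemma expSeq_exchange [CharZero F] {δ a b : F} {H S : ℕ → R} {x : ℤ → R} {c : ℕ → F}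
    (hS₀ : S 0 = 1)
    (hS : ∀ k : ℕ, ((k : F) + 1) • S (k + 1) =
      ∑ l ∈ Finset.range (k + 1), (((l + 1 : ℕ) : F) * δ) • (H l * S (k - l)))
    (hx : ∀ l m, H l * x m - x m * H l = c l • x (m + (l + 1)))
    (hc : ∀ l : ℕ, ((l + 1 : ℕ) : F) * δ * c l = a ^ (l + 1) - b ^ (l + 1)) (k : ℕ) (m : ℤ) :
    S (k + 1) * x m - a • (S k * x (m + 1)) = x m * S (k + 1) - b • (x (m + 1) * S k) := by
  set η : PowerSeries R := X * mk fun l => (((l + 1 : ℕ) : F) * δ) • H l with hη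
  have hη0 : coeff 0 η = 0 := by simp [η]
  have hES : eulerOp F (mk S) = η * mk S := by
    ext n
    cases n with
    | zero => simp [eulerOp, η]
    | succ k =>
      rw [eulerOp, coeff_mk, coeff_mk, hη, mul_assoc, coeff_succ_X_mul, coeff_mul,
        Finset.Nat.sum_antidiagonal_eq_sum_range_succ_mk, Nat.cast_succ, hS]
      simp only [coeff_mk, smul_mul_assoc]
  set Z : ℤ → PowerSeries R := fun m => mk fun n => mobiusCoeff a b n • x (m + n)
  have hEZ : ∀ m, η * Z m = eulerOp F (Z m) + Z m * η := fun m => by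
    have hX : Z m * η = X * (Z m * mk fun l => (((l + 1 : ℕ) : F) * δ) • H l) := by
      rw [hη, ← mul_assoc, ← mul_assoc, (PowerSeries.commute_X _).eq]
    rw [← sub_eq_iff_eq_add, hX, hη, mul_assoc, ← mul_sub]
    ext n
    cases n with
    | zero => simp [eulerOp]
    | succ n =>
      rw [coeff_succ_X_mul, eulerOp, coeff_mk, map_sub, coeff_mul, coeff_mul,
        ← Finset.Nat.sum_antidiagonal_swap, ← Finset.sum_sub_distrib]
      simp only [Z, coeff_mk, smul_smul, Prod.fst_swap, Prod.snd_swap]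
      rw [Nat.cast_succ, ← sum_mobiusCoeff, Finset.sum_smul]
      rw [← Finset.Nat.sum_antidiagonal_swap (f := fun y => ((a ^ (y.1 + 1) - b ^ (y.1 + 1)) *
        mobiusCoeff a b y.2) • x (m + ((n + 1 : ℕ) : ℤ)))]
      refine Finset.sum_congr rfl fun y hy => ?_
      have h1 := congrArg (fun z => (((y.2 + 1 : ℕ) : F) * δ * mobiusCoeff a b y.1) • z)
        (hx y.2 (m + y.1))
      have h2 : m + (y.1 : ℤ) + (y.2 + 1) = m + ((n + 1 : ℕ) : ℤ) := by
        rw [← Finset.HasAntidiagonal.mem_antidiagonal.1 hy]; push_cast; ring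
      simp only [Prod.fst_swap, Prod.snd_swap, smul_mul_smul_comm] at h1 ⊢
      rw [h2] at h1
      rw [← hc]
      simp only [smul_sub, smul_smul] at h1
      linear_combination (norm := module) h1
  have hEC : ∀ u : R, eulerOp F (C u) = 0 := fun u => by
    ext n
    rw [eulerOp, coeff_mk, coeff_C]
    split_ifs with h <;> simp [h]
  have key : ∀ m, mk S * C (x m) = Z m * mk S := fun m => by
    refine eq_of_eulerOp_eq (F := F) hη0 ?_ ?_ ?_
    · rw [eulerOp_mul, hEC, mul_zero, add_zero, hES, mul_assoc]
    · rw [eulerOp_mul, hES, ← mul_assoc, ← add_mul, ← hEZ, mul_assoc]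
    · simp [hS₀, Z, mobiusCoeff, coeff_mul]
  have h1 := congrArg (coeff (k + 1)) (key m)
  have h2 := congrArg (coeff k) (key (m + 1))
  rw [coeff_mul_C, coeff_mul, Finset.Nat.sum_antidiagonal_succ] at h1
  rw [coeff_mul_C, coeff_mul] at h2
  simp only [Z, coeff_mk, mobiusCoeff, one_smul, Nat.cast_zero, add_zero] at h1 h2
  rw [h1, h2, Finset.smul_sum, add_sub_assoc, ← Finset.sum_sub_distrib, sub_eq_add_neg]
  cases k with
  | zero => simp; module
  | succ k =>
    rw [Finset.Nat.sum_antidiagonal_succ, Finset.sum_eq_zero]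
    · simp only [Nat.cast_zero, zero_add, Nat.cast_one, add_zero, smul_mul_assoc]
      module
    · intro y _
      simp only [smul_mul_assoc, smul_smul]
      rw [show m + ((y.1 + 1 + 1 : ℕ) : ℤ) = m + 1 + ((y.1 + 1 : ℕ) : ℤ) by push_cast; ring,
        ← sub_smul]
      convert zero_smul F _ using 2
      ring

/-- The one-sided sequence `K S_k` satisfies the exchange relation. -/
lemma exch_of_expSeq [CharZero F] {δ p : F} (hp : p ≠ 0) {H S : ℕ → R} {x : ℤ → R} {c : ℕ → F}
    {κ : R} (hS₀ : S 0 = 1)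
    (hS : ∀ k : ℕ, ((k : F) + 1) • S (k + 1) =
      ∑ l ∈ Finset.range (k + 1), (((l + 1 : ℕ) : F) * δ) • (H l * S (k - l)))
    (hx : ∀ l m, H l * x m - x m * H l = c l • x (m + (l + 1)))
    (hc : ∀ l : ℕ, ((l + 1 : ℕ) : F) * δ * c l = p ^ (l + 1) - p⁻¹ ^ (l + 1))
    (hκ : ∀ m, κ * x m = p • (x m * κ)) :
    Exch p (fun k => if 0 ≤ k then κ * S k.toNat else 0) x := by
  intro k m
  rcases lt_trichotomy k (-1) with hk | rfl | hk
  · simp [show ¬ 0 ≤ k + 1 by omega, show ¬ 0 ≤ k by omega]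
  · simp [hS₀, hκ]
  · obtain ⟨n, rfl⟩ := Int.eq_ofNat_of_zero_le (by omega : 0 ≤ k)
    have h1 := expSeq_exchange hS₀ hS hx hc n m
    have h2 := congrArg (fun z => κ * z) h1
    simp only [mul_sub, mul_smul_comm, ← mul_assoc, hκ, smul_mul_assoc, smul_smul,
      inv_mul_cancel₀ hp, one_smul] at h2
    have e1 : ((n : ℤ) + 1).toNat = n + 1 := by omega
    simp only [show (0 : ℤ) ≤ n + 1 by omega, show (0 : ℤ) ≤ n by omega, if_true, e1,
      Int.toNat_natCast, ← mul_assoc]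
    linear_combination (norm := module) h2

lemma Exch.dress {p : F} {a b : ℤ → R} (h : Exch p a b) {u : Rˣ}
    (hb : ∀ k, Commute (u : R) (b k)) (ha : ∀ k, Commute (u : R) (a k)) (s t : ℤ) :
    Exch p (fun k => ((u ^ (k + s) : Rˣ) : R) * a k) (fun k => ((u ^ (k + t) : Rˣ) : R) * b k) := by
  have key : ∀ (z w : ℤ → R) (_ : ∀ k, Commute (u : R) (z k)) (k l m m' : ℤ),
      ((u ^ m : Rˣ) : R) * z k * (((u ^ m' : Rˣ) : R) * w l) =
        ((u ^ (m + m') : Rˣ) : R) * (z k * w l) := fun z w hz k l m m' => by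
    rw [zpow_add, Units.val_mul]
    simp only [mul_assoc]
    rw [← mul_assoc (z k), ← ((hz k).units_zpow_left m').eq, mul_assoc]
  intro k l
  have h1 := congrArg (fun z => ((u ^ (k + 1 + s + (l + t)) : Rˣ) : R) * z) (h k l)
  simp only [key a b ha, key b a hb]
  rw [show l + t + (k + 1 + s) = k + 1 + s + (l + t) by ring,
    show k + s + (l + 1 + t) = k + 1 + s + (l + t) by ring,
    show l + 1 + t + (k + s) = k + 1 + s + (l + t) by ring]
  simpa only [mul_sub, mul_smul_comm] using h1

end ExpSeries

section CartanCurrents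

variable {F : Type*} [Field F] {R : Type*} [Ring R] [Algebra F R]

open PowerSeries in
lemma expSeq_commutator [CharZero F] {δ : F} {H S : ℕ → R} {y z : R} {s : ℕ}
    (hS₀ : S 0 = 1)
    (hS : ∀ k : ℕ, ((k : F) + 1) • S (k + 1) =
      ∑ l ∈ Finset.range (k + 1), (((l + 1 : ℕ) : F) * δ) • (H l * S (k - l)))
    (hs : 0 < s) (hy : ∀ l, y * H l - H l * y = if l + 1 = s then z else 0)
    (hz : ∀ l, Commute z (H l)) (n : ℕ) :
    y * S n - S n * y = if s ≤ n then δ • (z * S (n - s)) else 0 := by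
  set η : PowerSeries R := X * mk fun l => (((l + 1 : ℕ) : F) * δ) • H l with hη
  have hη0 : coeff 0 η = 0 := by simp [η]
  have hES : eulerOp F (mk S) = η * mk S := by
    ext n
    cases n with
    | zero => simp [eulerOp, η]
    | succ k =>
      rw [eulerOp, coeff_mk, coeff_mk, hη, mul_assoc, coeff_succ_X_mul, coeff_mul,
        Finset.Nat.sum_antidiagonal_eq_sum_range_succ_mk, Nat.cast_succ, hS]
      simp only [coeff_mk, smul_mul_assoc]
  have hEC : ∀ u : R, eulerOp F (C u) = 0 := fun u => by
    ext n
    rw [eulerOp, coeff_mk, coeff_C]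
    split_ifs with h <;> simp [h]
  have hsub : ∀ φ χ : PowerSeries R, eulerOp F (φ - χ) = eulerOp F φ - eulerOp F χ :=
    fun φ χ => by ext n; simp [eulerOp, smul_sub]
  obtain ⟨t, rfl⟩ := Nat.exists_eq_succ_of_ne_zero hs.ne'
  set w : PowerSeries R := monomial (t + 1) (δ • z) with hw
  have hEw : eulerOp F w = C y * η - η * C y := by
    ext n
    rw [eulerOp, coeff_mk, map_sub, coeff_C_mul, coeff_mul_C, hw, coeff_monomial, hη]
    cases n with
    | zero => simp
    | succ n =>
      have := congrArg (fun v => (((n + 1 : ℕ) : F) * δ) • v) (hy n)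
      simp only [coeff_succ_X_mul, coeff_mk, mul_smul_comm, smul_mul_assoc, ← smul_sub] at this ⊢
      rw [this]
      by_cases h : n + 1 = t + 1 <;> simp [h, smul_smul]
  have hwη : w * η = η * w := by
    have h1 : w = X ^ (t + 1) * C (δ • z) := by
      ext n
      rw [hw, coeff_mul_C, coeff_X_pow, coeff_monomial]
      split_ifs <;> simp
    have h2 : C (δ • z) * η = η * C (δ • z) := by
      ext n
      cases n with
      | zero => simp [hη]
      | succ n =>
        rw [coeff_C_mul, coeff_mul_C, hη, coeff_succ_X_mul, coeff_mk, smul_mul_smul_comm,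
          smul_mul_smul_comm, (hz n).eq, mul_comm]
    have h3 : X ^ (t + 1) * η = η * X ^ (t + 1) := ((PowerSeries.commute_X η).pow_right _).eq.symm
    rw [h1, mul_assoc, h2, ← mul_assoc, h3, mul_assoc]
  have key : C y * mk S - mk S * C y - w * mk S = 0 := by
    refine eq_of_eulerOp_eq (F := F) hη0 ?_ (by ext n; simp [eulerOp]) ?_
    · simp only [hsub, eulerOp_mul, hES, hEC, hEw, zero_mul, mul_zero, zero_add, add_zero]
      simp only [mul_sub, sub_mul, ← mul_assoc, hwη]
      abel
    · have h0 : coeff 0 w = 0 := by rw [hw, coeff_monomial, if_neg (Nat.succ_ne_zero t).symm]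
      rw [coeff_zero_eq_constantCoeff_apply] at h0
      simp [hS₀, h0]
  have h1 := congrArg (coeff n) key
  have h2 : w = X ^ (t + 1) * C (δ • z) := by
    ext n
    rw [hw, coeff_mul_C, coeff_X_pow, coeff_monomial]
    split_ifs <;> simp
  rw [h2, mul_assoc, map_sub, map_sub, coeff_C_mul, coeff_mul_C, coeff_X_pow_mul', coeff_mk,
    map_zero, sub_eq_zero] at h1
  rw [h1]
  simp only [coeff_C_mul, coeff_mk, smul_mul_assoc]

end CartanCurrents

section Respects

variable {d A} {R : Type*} [Ring R] [Algebra Fq R] {ρ : FA N →ₐ[Fq] R}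

lemma map_psiEl (ρ : FA N →ₐ[Fq] R) (i : Fin N) (k : ℤ) :
    ρ (psiEl d i k) = if 0 ≤ k then ρ (e (K i)) * ρ (Ppos d i k.toNat) else 0 := by
  rw [psiEl]; split_ifs <;> simp

lemma map_phiEl_neg (ρ : FA N →ₐ[Fq] R) (i : Fin N) (k : ℤ) :
    ρ (phiEl d i (-k)) = if 0 ≤ k then ρ (e (Kinv i)) * ρ (Pneg d i k.toNat) else 0 := by
  rw [phiEl]; simp only [Left.neg_nonpos_iff, neg_neg]; split_ifs <;> simp

lemma map_Ppos_succ (ρ : FA N →ₐ[Fq] R) (i : Fin N) (k : ℕ) :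
    ((k : Fq) + 1) • ρ (Ppos d i (k + 1)) = ∑ l ∈ Finset.range (k + 1),
      (((l + 1 : ℕ) : Fq) * (qi d i - (qi d i)⁻¹)) •
        (ρ (e (h i ((l : ℤ) + 1))) * ρ (Ppos d i (k - l))) := by
  rw [Ppos, map_smul, smul_smul, mul_inv_cancel₀ (Nat.cast_add_one_ne_zero k), one_smul]
  simp only [map_sum, map_smul, map_mul]

lemma map_Pneg_succ (ρ : FA N →ₐ[Fq] R) (i : Fin N) (k : ℕ) :
    ((k : Fq) + 1) • ρ (Pneg d i (k + 1)) = ∑ l ∈ Finset.range (k + 1),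
      (((l + 1 : ℕ) : Fq) * (-(qi d i - (qi d i)⁻¹))) •
        (ρ (e (h i (-((l : ℤ) + 1)))) * ρ (Pneg d i (k - l))) := by
  rw [Pneg, map_smul, smul_smul, mul_inv_cancel₀ (Nat.cast_add_one_ne_zero k), one_smul]
  simp only [map_sum, map_smul, map_mul]

lemma exch_psi {i : Fin N} {p : Fq} (hp : p ≠ 0) {x : ℤ → R} {c : ℕ → Fq}
    (hx : ∀ (l : ℕ) m, ρ (e (h i ((l : ℤ) + 1))) * x m - x m * ρ (e (h i ((l : ℤ) + 1))) =
      c l • x (m + (l + 1)))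
    (hc : ∀ l : ℕ, ((l + 1 : ℕ) : Fq) * (qi d i - (qi d i)⁻¹) * c l =
      p ^ (l + 1) - p⁻¹ ^ (l + 1))
    (hK : ∀ m, ρ (e (K i)) * x m = p • (x m * ρ (e (K i)))) :
    Exch p (fun k => ρ (psiEl d i k)) x := by
  simp only [map_psiEl]
  exact exch_of_expSeq (S := fun k => ρ (Ppos d i k)) hp (by simp [Ppos]) (map_Ppos_succ ρ i)
    hx hc hK

lemma exch_phi {i : Fin N} {p : Fq} (hp : p ≠ 0) {x : ℤ → R} {c : ℕ → Fq}
    (hx : ∀ (l : ℕ) m, ρ (e (h i (-((l : ℤ) + 1)))) * x m -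
      x m * ρ (e (h i (-((l : ℤ) + 1)))) = c l • x (m - (l + 1)))
    (hc : ∀ l : ℕ, ((l + 1 : ℕ) : Fq) * (qi d i - (qi d i)⁻¹) * c l =
      p ^ (l + 1) - p⁻¹ ^ (l + 1))
    (hK : ∀ m, ρ (e (K i)) * x m = p • (x m * ρ (e (K i))))
    (hKK : ρ (e (Kinv i)) * ρ (e (K i)) = 1) (hKK' : ρ (e (K i)) * ρ (e (Kinv i)) = 1) :
    Exch p (fun k => ρ (phiEl d i k)) x := by
  have hK' : ∀ m, ρ (e (Kinv i)) * x m = p⁻¹ • (x m * ρ (e (Kinv i))) := fun m => by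
    have h1 := congrArg (fun z => p⁻¹ • (ρ (e (Kinv i)) * z * ρ (e (Kinv i)))) (hK m)
    simp only [mul_smul_comm, smul_mul_assoc, smul_smul, inv_mul_cancel₀ hp, one_smul] at h1
    rw [← mul_assoc, hKK, one_mul, mul_assoc, mul_assoc, hKK', mul_one] at h1
    exact h1.symm
  have h1 := exch_of_expSeq (S := fun k => ρ (Pneg d i k)) (inv_ne_zero hp)
    (H := fun l => ρ (e (h i (-((l : ℤ) + 1))))) (x := fun m => x (-m)) (c := c) (by simp [Pneg])
    (map_Pneg_succ ρ i) (fun l m => by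
      rw [hx, show -m - ((l : ℤ) + 1) = -(m + (l + 1)) by ring])
    (fun l => by rw [mul_neg, neg_mul, hc, inv_inv]; ring) (fun m => hK' (-m))
  have h2 := h1.reflect (inv_ne_zero hp)
  simp only [inv_inv, neg_neg] at h2
  simp only [← map_phiEl_neg, neg_neg] at h2
  exact h2

lemma zpow_neg_sub_aux (p : Fq) (l : ℕ) :
    p ^ ((l : ℤ) + 1) - p ^ (-((l : ℤ) + 1)) = p ^ (l + 1) - p⁻¹ ^ (l + 1) := by
  rw [zpow_neg, inv_pow]
  norm_cast

lemma mul_unit_conj {K Kinv x : R} {p : Fq} (hK : Kinv * K = 1)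
    (hx : K * x * Kinv = p • x) : K * x = p • (x * K) := by
  rw [← smul_mul_assoc, ← hx, mul_assoc, hK, mul_one]

omit [Algebra Fq R] in
lemma commutator_unit_mul {u : Rˣ} {y x : R} (hu : Commute (u : R) y) (n : ℤ) :
    y * (((u ^ n : Rˣ) : R) * x) - ((u ^ n : Rˣ) : R) * x * y =
      ((u ^ n : Rˣ) : R) * (y * x - x * y) := by
  rw [← mul_assoc, ← (hu.units_zpow_left n).eq, mul_sub, mul_assoc, mul_assoc]

lemma neg_qint_aux (i j : Fin N) (l : ℕ) :
    (((-((l : ℤ) + 1) : ℤ) : Fq))⁻¹ * qint d i (-((l : ℤ) + 1) * A i j) =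
      (((l : ℤ) + 1 : ℤ) : Fq)⁻¹ * qint d i (((l : ℤ) + 1) * A i j) := by
  rw [neg_mul, qint, qint, neg_neg, Int.cast_neg, inv_neg, ← neg_sub (_ ^ _), neg_div]
  ring

namespace Respects

lemma Kinv_mul_K (hρ : Respects (CartanRel N d A) ρ) (i : Fin N) :
    ρ (e (K i)) * ρ (e (Kinv i)) = 1 ∧ ρ (e (Kinv i)) * ρ (e (K i)) = 1 := by
  rw [← map_mul, ← map_mul, hρ (.K_Kinv i), hρ (.Kinv_K i), map_one]
  exact ⟨rfl, rfl⟩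

variable (hρ : Respects (BaseRel N d A) ρ)
include hρ

lemma K_mul_xp (i j : Fin N) (m : ℤ) :
    ρ (e (K i)) * ρ (e (xp j m)) = qp d A i j • (ρ (e (xp j m)) * ρ (e (K i))) := by
  have h1 := hρ (.K_xp i j m)
  rw [map_mul, map_mul, map_smul] at h1
  exact mul_unit_conj (hρ.cartan.Kinv_mul_K i).2 h1

lemma K_mul_xm (i j : Fin N) (m : ℤ) :
    ρ (e (K i)) * ρ (e (xm j m)) = (qp d A i j)⁻¹ • (ρ (e (xm j m)) * ρ (e (K i))) := by
  have h1 := hρ (.K_xm i j m)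
  rw [map_mul, map_mul, map_smul] at h1
  exact mul_unit_conj (hρ.cartan.Kinv_mul_K i).2 h1

lemma K_mul_dressed {i : Fin N} {x : ℤ → FA N} {p : Fq}
    (hx : ∀ m, ρ (e (K i)) * ρ (x m) = p • (ρ (x m) * ρ (e (K i)))) (n : ℤ) (m : ℤ) :
    ρ (e (K i)) * (((hρ.cartan.gUnit ^ n : Rˣ) : R) * ρ (x m)) =
      p • (((hρ.cartan.gUnit ^ n : Rˣ) : R) * ρ (x m) * ρ (e (K i))) := by
  rw [← mul_assoc, ← (hρ.cartan.commute_gUnit_zpow n _).eq, mul_assoc, hx, mul_smul_comm,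
    mul_assoc]

lemma h_dressed_xp (i j : Fin N) {k : ℤ} (hk : k ≠ 0) (m n n' : ℤ) (hn : n - |k| = n') :
    ρ (e (h i k)) * (((hρ.cartan.gUnit ^ n : Rˣ) : R) * ρ (e (xp j m))) -
      ((hρ.cartan.gUnit ^ n : Rˣ) : R) * ρ (e (xp j m)) * ρ (e (h i k)) =
    ((k : Fq)⁻¹ * qint d i (k * A i j)) •
      (((hρ.cartan.gUnit ^ n' : Rˣ) : R) * ρ (e (xp j (k + m)))) := by
  have h1 := hρ (.h_xp i j k m hk)
  rw [map_sub, map_mul, map_mul, map_smul, map_mul, hρ.cartan.map_gammaHalf] at h1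
  rw [commutator_unit_mul (hρ.cartan.commute_gUnit _), h1, mul_smul_comm, ← mul_assoc,
    ← Units.val_mul, ← zpow_add, ← sub_eq_add_neg, hn]

lemma h_dressed_xm (i j : Fin N) {k : ℤ} (hk : k ≠ 0) (m n n' : ℤ) (hn : n + |k| = n') :
    ρ (e (h i k)) * (((hρ.cartan.gUnit ^ n : Rˣ) : R) * ρ (e (xm j m))) -
      ((hρ.cartan.gUnit ^ n : Rˣ) : R) * ρ (e (xm j m)) * ρ (e (h i k)) =
    (-((k : Fq)⁻¹ * qint d i (k * A i j))) •
      (((hρ.cartan.gUnit ^ n' : Rˣ) : R) * ρ (e (xm j (k + m)))) := by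
  have h1 := hρ (.h_xm i j k m hk)
  rw [map_sub, map_mul, map_mul, map_smul, map_mul, hρ.cartan.map_gammaHalf] at h1
  rw [commutator_unit_mul (hρ.cartan.commute_gUnit _), h1, mul_smul_comm, ← mul_assoc,
    ← Units.val_mul, ← zpow_add, hn]

variable (hd : ∀ i, 0 < d i)
include hd

lemma psi_exch_xp (i j : Fin N) : Exch (qp d A i j) (fun k => ρ (psiEl d i k))
    (fun m => ((hρ.cartan.gUnit ^ (-m) : Rˣ) : R) * ρ (e (xp j m))) := by
  refine exch_psi (c := fun l => (((l : ℤ) + 1 : ℤ) : Fq)⁻¹ * qint d i (((l : ℤ) + 1) * A i j))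
    (qp_ne_zero i j) (fun l m => ?_) (fun l => ?_)
    (fun m => hρ.K_mul_dressed (hρ.K_mul_xp i j) (-m) m)
  · rw [hρ.h_dressed_xp i j (by omega) m (-m) (-(m + (l + 1))) (by rw [abs_of_pos] <;> omega),
      add_comm m]
  · rw [← zpow_neg_sub_aux, ← qi_sub_inv_mul_qint (hd i)]
    have : ((l : Fq) + 1) ≠ 0 := Nat.cast_add_one_ne_zero l
    push_cast
    field_simp

lemma psi_exch_xm (i j : Fin N) : Exch (qp d A i j)⁻¹ (fun k => ρ (psiEl d i k))
    (fun m => ((hρ.cartan.gUnit ^ m : Rˣ) : R) * ρ (e (xm j m))) := by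
  refine exch_psi (c := fun l => -((((l : ℤ) + 1 : ℤ) : Fq)⁻¹ *
      qint d i (((l : ℤ) + 1) * A i j)))
    (inv_ne_zero (qp_ne_zero i j)) (fun l m => ?_) (fun l => ?_)
    (fun m => hρ.K_mul_dressed (hρ.K_mul_xm i j) m m)
  · rw [hρ.h_dressed_xm i j (by omega) m m (m + (l + 1)) (by rw [abs_of_pos]; omega),
      add_comm m]
  · rw [inv_inv, ← neg_sub (qp d A i j ^ (l + 1)), ← zpow_neg_sub_aux, ← qi_sub_inv_mul_qint (hd i)]
    have : ((l : Fq) + 1) ≠ 0 := Nat.cast_add_one_ne_zero l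
    push_cast
    field_simp

lemma phi_exch_xp (i j : Fin N) : Exch (qp d A i j) (fun k => ρ (phiEl d i k))
    (fun m => ((hρ.cartan.gUnit ^ m : Rˣ) : R) * ρ (e (xp j m))) := by
  refine exch_phi (c := fun l => (((l : ℤ) + 1 : ℤ) : Fq)⁻¹ * qint d i (((l : ℤ) + 1) * A i j))
    (qp_ne_zero i j) (fun l m => ?_) (fun l => ?_)
    (fun m => hρ.K_mul_dressed (hρ.K_mul_xp i j) m m) (hρ.cartan.Kinv_mul_K i).2
    (hρ.cartan.Kinv_mul_K i).1
  · rw [hρ.h_dressed_xp i j (by omega) m m (m - (l + 1)) (by rw [abs_neg, abs_of_pos]; omega),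
      neg_qint_aux, neg_add_eq_sub]
  · rw [← zpow_neg_sub_aux, ← qi_sub_inv_mul_qint (hd i)]
    have : ((l : Fq) + 1) ≠ 0 := Nat.cast_add_one_ne_zero l
    push_cast
    field_simp

lemma phi_exch_xm (i j : Fin N) : Exch (qp d A i j)⁻¹ (fun k => ρ (phiEl d i k))
    (fun m => ((hρ.cartan.gUnit ^ (-m) : Rˣ) : R) * ρ (e (xm j m))) := by
  refine exch_phi (c := fun l => -((((l : ℤ) + 1 : ℤ) : Fq)⁻¹ *
      qint d i (((l : ℤ) + 1) * A i j)))
    (inv_ne_zero (qp_ne_zero i j)) (fun l m => ?_) (fun l => ?_)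
    (fun m => hρ.K_mul_dressed (hρ.K_mul_xm i j) (-m) m) (hρ.cartan.Kinv_mul_K i).2
    (hρ.cartan.Kinv_mul_K i).1
  · rw [hρ.h_dressed_xm i j (by omega) m (-m) (-(m - (l + 1)))
      (by rw [abs_neg, abs_of_pos] <;> omega), neg_qint_aux, neg_add_eq_sub]
  · rw [inv_inv, ← neg_sub (qp d A i j ^ (l + 1)), ← zpow_neg_sub_aux, ← qi_sub_inv_mul_qint (hd i)]
    have : ((l : Fq) + 1) ≠ 0 := Nat.cast_add_one_ne_zero l
    push_cast
    field_simp

end Respects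

end Respects

section SerreCommute

variable {d A} {R : Type*} [Ring R] [Algebra Fq R] {ρ : FA N →ₐ[Fq] R}

lemma Exch.smul_left {F S : Type*} [Field F] [Ring S] [Algebra F S] {p : F} {a b : ℤ → S}
    (h : Exch p a b) (c : F) : Exch p (fun k => c • a k) b := fun k l => by
  have h1 := congrArg (c • ·) (h k l)
  simp only [smul_sub, smul_mul_assoc, mul_smul_comm, smul_comm c p] at h1 ⊢
  exact h1

lemma Exch.sub_left {F S : Type*} [Field F] [Ring S] [Algebra F S] {p : F} {a a' b : ℤ → S}
    (h : Exch p a b) (h' : Exch p a' b) : Exch p (fun k => a k - a' k) b := fun k l => by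
  have h1 := h k l
  have h2 := h' k l
  simp only [sub_mul, mul_sub]
  linear_combination (norm := module) h1 - h2

/-- The generator `x^+_{i,k}` or `x^-_{i,k}`. -/
def currentGen (pm : Bool) (i : Fin N) (k : ℤ) : Gen N := if pm then xp i k else xm i k

variable (d A) in
/-- The exchange parameter of the currents `x^±_i` and `x^±_j`. -/
def currentParam (pm : Bool) (i j : Fin N) : Fq := if pm then qp d A i j else (qp d A i j)⁻¹

lemma exch_of_quadEl {pm : Bool} {i j : Fin N} (h : ∀ k l, ρ (quadEl d A pm i j k l) = 0) :
    Exch (currentParam d A pm i j) (fun k => ρ (e (currentGen pm i k)))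
      (fun k => ρ (e (currentGen pm j k))) := fun k l => by
  have h1 := h k l
  cases pm <;>
    simpa [quadEl, currentGen, currentParam, sub_eq_zero] using h1

lemma map_quadEl (ρ : FA N →ₐ[Fq] R) (pm : Bool) (i j : Fin N) (k l : ℤ) :
    ρ (quadEl d A pm i j k l) =
      ρ (e (currentGen pm i (k + 1))) * ρ (e (currentGen pm j l)) -
        currentParam d A pm i j • (ρ (e (currentGen pm j l)) * ρ (e (currentGen pm i (k + 1)))) -
      (currentParam d A pm i j • (ρ (e (currentGen pm i k)) * ρ (e (currentGen pm j (l + 1)))) -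
        ρ (e (currentGen pm j (l + 1))) * ρ (e (currentGen pm i k))) := by
  cases pm <;> simp [quadEl, currentGen, currentParam]

namespace Respects

variable (hρ : Respects (BaseRel N d A) ρ) (hd : ∀ i, 0 < d i)

lemma exch_dressed {p : Fq} {f : ℤ → FA N} {g : ℤ → FA N} (hρ : Respects (CartanRel N d A) ρ)
    {ε : ℤ}
    (h : Exch p (fun k => ρ (f k)) (fun m => ((hρ.gUnit ^ (-(ε * m)) : Rˣ) : R) * ρ (g m)))
    (n : ℤ) :
    Exch p (fun k => ((hρ.gUnit ^ (ε * (k - n)) : Rˣ) : R) * ρ (f (k + n)))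
      (fun k => ρ (g k)) := by
  have h1 := (h.dress (u := hρ.gUnit ^ ε)
    (fun k => ((Commute.refl _).units_zpow_left ε).units_zpow_right _ |>.mul_right
      (hρ.commute_gUnit_zpow _ _))
    (fun k => hρ.commute_gUnit_zpow _ _) (-2 * n) 0).shift_left n
  simp only [← zpow_mul, add_zero, ← mul_assoc, ← Units.val_mul, ← zpow_add, add_neg_cancel,
    zpow_zero, Units.val_one, one_mul] at h1
  convert h1 using 5
  ring

include hρ hd in
lemma exists_commutator (pm : Bool) (i a : Fin N) (n : ℤ) :
    ∃ cp cm : ℤ → R, ZeroBelow cp ∧ ZeroAbove cm ∧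
      (∀ j, Exch (currentParam d A pm i j) cp (fun k => ρ (e (currentGen pm j k)))) ∧
      (∀ j, Exch (currentParam d A pm i j) cm (fun k => ρ (e (currentGen pm j k)))) ∧
      ∀ k, ρ (e (currentGen (!pm) a n)) * ρ (e (currentGen pm i k)) -
        ρ (e (currentGen pm i k)) * ρ (e (currentGen (!pm) a n)) = cp k - cm k := by
  by_cases hia : i = a
  swap
  · refine ⟨fun _ => 0, fun _ => 0, ⟨0, fun _ _ => rfl⟩, ⟨0, fun _ _ => rfl⟩,
      fun j => Exch.zero_left _ _, fun j => Exch.zero_left _ _, fun k => ?_⟩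
    cases pm
    · have h1 := hρ (.xp_xm a i n k)
      rw [if_neg (Ne.symm hia)] at h1
      simpa [currentGen] using h1
    · have h1 := congrArg Neg.neg (hρ (.xp_xm i a k n))
      rw [if_neg hia] at h1
      simpa [currentGen] using h1
  subst hia
  have hψ0 : ∀ k < -n, psiEl d i (k + n) = 0 := fun k hk => by rw [psiEl, if_neg (by omega)]
  have hφ0 : ∀ k > -n, phiEl d i (k + n) = 0 := fun k hk => by rw [phiEl, if_neg (by omega)]
  cases pm
  · set c := (qi d i - (qi d i)⁻¹)⁻¹
    refine ⟨fun k => c • (((hρ.cartan.gUnit ^ (-1 * (k - n)) : Rˣ) : R) * ρ (psiEl d i (k + n))),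
      fun k => c • (((hρ.cartan.gUnit ^ (1 * (k - n)) : Rˣ) : R) * ρ (phiEl d i (k + n))),
      ⟨-n, fun k hk => by simp [hψ0 k hk]⟩, ⟨-n, fun k hk => by simp [hφ0 k hk]⟩,
      fun j => (hρ.cartan.exch_dressed (ε := -1) ?_ n).smul_left c,
      fun j => (hρ.cartan.exch_dressed (ε := 1) ?_ n).smul_left c, fun k => ?_⟩
    · simpa [currentGen, currentParam] using hρ.psi_exch_xm hd i j
    · simpa [currentGen, currentParam] using hρ.phi_exch_xm hd i j
    · have h1 := hρ (.xp_xm i i n k)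
      rw [if_pos rfl] at h1
      simpa [currentGen, hρ.cartan.map_gammaHalf, smul_sub, add_comm n k] using h1
  · set c := (qi d i - (qi d i)⁻¹)⁻¹
    refine ⟨fun k => (-c) •
        (((hρ.cartan.gUnit ^ (1 * (k - n)) : Rˣ) : R) * ρ (psiEl d i (k + n))),
      fun k => (-c) • (((hρ.cartan.gUnit ^ (-1 * (k - n)) : Rˣ) : R) * ρ (phiEl d i (k + n))),
      ⟨-n, fun k hk => by simp [hψ0 k hk]⟩, ⟨-n, fun k hk => by simp [hφ0 k hk]⟩,
      fun j => (hρ.cartan.exch_dressed (ε := 1) ?_ n).smul_left (-c),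
      fun j => (hρ.cartan.exch_dressed (ε := -1) ?_ n).smul_left (-c), fun k => ?_⟩
    · simpa [currentGen, currentParam] using hρ.psi_exch_xp hd i j
    · simpa [currentGen, currentParam] using hρ.phi_exch_xp hd i j
    · have h1 := congrArg Neg.neg (hρ (.xp_xm i i k n))
      rw [if_pos rfl] at h1
      simpa [currentGen, hρ.cartan.map_gammaHalf, smul_sub, c, neg_add_eq_sub] using h1

lemma currentParam_comm (hsym : ∀ i j, d i * A i j = d j * A j i) (pm : Bool) (i j : Fin N) :
    currentParam d A pm i j = currentParam d A pm j i := by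
  rw [currentParam, currentParam, qp_comm hsym]

include hρ hd in
lemma commute_quadEl (hsym : ∀ i j, d i * A i j = d j * A j i) (pm : Bool) (a : Fin N) (n : ℤ)
    (i j : Fin N) (k l : ℤ) :
    Commute (ρ (e (currentGen (!pm) a n))) (ρ (quadEl d A pm i j k l)) := by
  obtain ⟨cp, cm, -, -, h1, h2, h3⟩ := hρ.exists_commutator hd pm i a n
  obtain ⟨cp', cm', -, -, h1', h2', h3'⟩ := hρ.exists_commutator hd pm j a n
  have h4 := ((h1' i).sub_left (h2' i)).symm
  rw [currentParam_comm hsym] at h4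
  rw [map_quadEl]
  exact commute_quadratic h3 h3' ((h1 j).sub_left (h2 j)) h4 k l

include hρ hd in
lemma commute_serreEl (hsym : ∀ i j, d i * A i j = d j * A j i) (hdiag : ∀ i, A i i = 2)
    (hoff : ∀ i j, i ≠ j → A i j ≤ 0) (pm : Bool)
    (hquad : ∀ i j k l, ρ (quadEl d A pm i j k l) = 0) (a : Fin N) (n : ℤ)
    {i j : Fin N} (hij : i ≠ j) (ks : Fin (1 - A i j).toNat → ℤ) (l : ℤ) :
    Commute (ρ (e (currentGen (!pm) a n))) (ρ (serreEl d pm i j (1 - A i j).toNat ks l)) := by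
  obtain ⟨m, hm⟩ := Int.eq_ofNat_of_zero_le (by linarith [hoff i j hij] : 0 ≤ -A i j)
  obtain ⟨cp, cm, hcp, hcm, h1, h2, h3⟩ := hρ.exists_commutator hd pm i a n
  obtain ⟨cp', cm', hcp', hcm', h1', h2', h3'⟩ := hρ.exists_commutator hd pm j a n
  have hn : (1 - A i j).toNat = m + 1 := by omega
  generalize (1 - A i j).toNat = n' at hn ks
  subst hn
  rw [map_serreEl (hd i)]
  set Q : Fq := if pm then qi d i else (qi d i)⁻¹ with hQ
  have hgen : IsGeneric Q := by
    rw [hQ]; split_ifs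
    · exact isGeneric_qi (hd i)
    · exact (isGeneric_qi (hd i)).inv
  have hbin : ∀ n r, gaussBinom (qi d i) n r = gaussBinom Q n r := fun n r => by
    rw [hQ]; split_ifs
    · rfl
    · rw [gaussBinom_inv (isGeneric_qi (hd i))]
  have hQ2 : currentParam d A pm i i = Q ^ 2 := by
    cases pm <;> simp [currentParam, hQ, qp_self hdiag]
  have hQm : currentParam d A pm i j = Q ^ (-m : ℤ) := by
    rw [← hm, neg_neg]
    cases pm <;> simp [currentParam, hQ, qp_eq_zpow]
  have haa := exch_of_quadEl (hquad i i)
  have hab := exch_of_quadEl (hquad i j)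
  have h4 := h1 i
  have h5 := h2 i
  have h6 := h1 j
  have h7 := h2 j
  have h8 := h1' i
  have h9 := h2' i
  rw [currentParam_comm hsym pm j i] at h8 h9
  rw [hQ2] at haa h4 h5
  rw [hQm] at hab h6 h7 h8 h9
  simp only [hbin]
  exact commute_symSerreElt hgen m haa hab h4.symm h5.symm h6.symm h7.symm h8.symm h9.symm
    hcp hcm hcp' hcm' h3 h3' ks l

end Respects

end SerreCommute

section CartanAction

variable {d A} {R : Type*} [Ring R] [Algebra Fq R] {ρ : FA N →ₐ[Fq] R}

namespace Respects

variable (hρ : Respects (CartanRel N d A) ρ)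
include hρ

lemma commute_K_h (i j : Fin N) (s : ℤ) : Commute (ρ (e (K i))) (ρ (e (h j s))) := by
  have h1 := hρ (.K_comm_h i j s)
  rwa [map_mul, map_mul] at h1

lemma commute_K_K (i j : Fin N) : Commute (ρ (e (K i))) (ρ (e (K j))) := by
  have h1 := hρ (.K_comm_K i j)
  rwa [map_mul, map_mul] at h1

/-- The image of `K_i`. -/
def kUnit (i : Fin N) : Rˣ where
  val := ρ (e (K i))
  inv := ρ (e (Kinv i))
  val_inv := (hρ.Kinv_mul_K i).1
  inv_val := (hρ.Kinv_mul_K i).2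

lemma commute_Kinv {i : Fin N} {y : R} (h : Commute (ρ (e (K i))) y) :
    Commute (ρ (e (Kinv i))) y := Commute.units_inv_left (u := hρ.kUnit i) h

lemma map_commutator_h_h (i j : Fin N) {k l : ℤ} (hk : k ≠ 0) (hl : l ≠ 0) :
    ρ (e (h i k)) * ρ (e (h j l)) - ρ (e (h j l)) * ρ (e (h i k)) =
      if l = -k then ((k : Fq)⁻¹ * qint d i (k * A i j) * (qi d j - (qi d j)⁻¹)⁻¹) •
        (((hρ.gUnit ^ (2 * k) : Rˣ) : R) - ((hρ.gUnit ^ (-(2 * k)) : Rˣ) : R)) else 0 := by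
  have h1 := hρ (.h_h i j k l hk hl)
  rw [map_sub, map_mul, map_mul] at h1
  rw [h1]
  split_ifs
  · rw [map_smul, map_sub, gammaPow, gammaPow, hρ.map_gammaHalf, hρ.map_gammaHalf, mul_neg]
  · rw [map_zero]

lemma commutator_h_Ppos (hd : ∀ i, 0 < d i) (i j : Fin N) {k : ℤ} (hk : k ≠ 0) (n : ℕ) :
    ρ (e (h i k)) * ρ (Ppos d j n) - ρ (Ppos d j n) * ρ (e (h i k)) =
      if k < 0 ∧ 0 ≤ n + k then ((k : Fq)⁻¹ * qint d i (k * A i j)) •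
        ((((hρ.gUnit ^ (2 * k) : Rˣ) : R) - ((hρ.gUnit ^ (-(2 * k)) : Rˣ) : R)) *
          ρ (Ppos d j (n + k).toNat)) else 0 := by
  rcases lt_or_gt_of_ne hk with hk' | hk'
  · obtain ⟨s, hs⟩ := Int.eq_ofNat_of_zero_le (by omega : 0 ≤ -k)
    obtain rfl : k = -s := by omega
    rw [expSeq_commutator (S := fun n => ρ (Ppos d j n)) (s := s) (by simp [Ppos])
      (map_Ppos_succ ρ j) (by omega)
      (fun l => by
        rw [hρ.map_commutator_h_h i j hk (by omega)]
        exact if_congr (by omega) rfl rfl)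
      (fun l => ((((hρ.commute_gUnit_zpow _ _).sub_left (hρ.commute_gUnit_zpow _ _)).smul_left
        _)))]
    refine if_ctx_congr (by omega) (fun h1 => ?_) fun _ => rfl
    rw [smul_mul_assoc, smul_smul, mul_left_comm,
      mul_inv_cancel₀ (qi_sub_inv_ne_zero (hd j)), mul_one]
    congr 4
    omega
  · rw [if_neg (by omega), expSeq_commutator (S := fun n => ρ (Ppos d j n)) (s := 1) (z := 0)
      (by simp [Ppos]) (map_Ppos_succ ρ j) one_pos
      (fun l => by
        rw [hρ.map_commutator_h_h i j hk (by omega), if_neg (by omega), ite_self])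
      (fun l => Commute.zero_left _)]
    simp

lemma commutator_h_Pneg (hd : ∀ i, 0 < d i) (i j : Fin N) {k : ℤ} (hk : k ≠ 0) (n : ℕ) :
    ρ (e (h i k)) * ρ (Pneg d j n) - ρ (Pneg d j n) * ρ (e (h i k)) =
      if 0 < k ∧ 0 ≤ n - k then (-((k : Fq)⁻¹ * qint d i (k * A i j))) •
        ((((hρ.gUnit ^ (2 * k) : Rˣ) : R) - ((hρ.gUnit ^ (-(2 * k)) : Rˣ) : R)) *
          ρ (Pneg d j (n - k).toNat)) else 0 := by
  rcases lt_or_gt_of_ne hk with hk' | hk'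
  · rw [if_neg (by omega), expSeq_commutator (S := fun n => ρ (Pneg d j n)) (s := 1) (z := 0)
      (by simp [Pneg]) (map_Pneg_succ ρ j) one_pos
      (fun l => by
        rw [hρ.map_commutator_h_h i j hk (by omega), if_neg (by omega), ite_self])
      (fun l => Commute.zero_left _)]
    simp
  · obtain ⟨s, rfl⟩ := Int.eq_ofNat_of_zero_le hk'.le
    rw [expSeq_commutator (S := fun n => ρ (Pneg d j n)) (s := s) (by simp [Pneg])
      (map_Pneg_succ ρ j) (by omega)
      (fun l => by
        rw [hρ.map_commutator_h_h i j hk (by omega)]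
        exact if_congr (by omega) rfl rfl)
      (fun l => ((((hρ.commute_gUnit_zpow _ _).sub_left (hρ.commute_gUnit_zpow _ _)).smul_left
        _)))]
    refine if_ctx_congr (by omega) (fun h1 => ?_) fun _ => rfl
    rw [smul_mul_assoc, smul_smul, neg_mul, mul_left_comm,
      mul_inv_cancel₀ (qi_sub_inv_ne_zero (hd j)), mul_one]
    congr 4
    omega

lemma commutator_h_psiEl (hd : ∀ i, 0 < d i) (i j : Fin N) {k : ℤ} (hk : k ≠ 0) (n : ℤ) :
    ρ (e (h i k)) * ρ (psiEl d j n) - ρ (psiEl d j n) * ρ (e (h i k)) =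
      if k < 0 then ((k : Fq)⁻¹ * qint d i (k * A i j)) •
        ((((hρ.gUnit ^ (2 * k) : Rˣ) : R) - ((hρ.gUnit ^ (-(2 * k)) : Rˣ) : R)) *
          ρ (psiEl d j (n + k))) else 0 := by
  rw [map_psiEl, map_psiEl]
  by_cases hn : 0 ≤ n
  · obtain ⟨n, rfl⟩ := Int.eq_ofNat_of_zero_le hn
    have hu := fun m => hρ.commute_gUnit_zpow m (e (K j))
    have h1 := hρ.commutator_h_Ppos hd i j hk n
    rw [if_pos hn, ← mul_assoc, ← (hρ.commute_K_h j i k).eq, mul_assoc, mul_assoc, ← mul_sub,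
      Int.toNat_natCast, h1]
    by_cases hk' : k < 0
    · by_cases hnk : 0 ≤ n + k
      · rw [if_pos ⟨hk', hnk⟩, if_pos hk', if_pos hnk, mul_smul_comm, ← mul_assoc, ← mul_assoc,
          ((hu _).sub_left (hu _)).eq]
      · rw [if_neg (fun h => hnk h.2), if_pos hk', if_neg hnk, mul_zero, mul_zero, smul_zero]
    · rw [if_neg (fun h => hk' h.1), if_neg hk', mul_zero]
  · rw [if_neg hn]
    split_ifs
    · omega
    all_goals simp

lemma commutator_h_phiEl (hd : ∀ i, 0 < d i) (i j : Fin N) {k : ℤ} (hk : k ≠ 0) (n : ℤ) :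
    ρ (e (h i k)) * ρ (phiEl d j n) - ρ (phiEl d j n) * ρ (e (h i k)) =
      if 0 < k then (-((k : Fq)⁻¹ * qint d i (k * A i j))) •
        ((((hρ.gUnit ^ (2 * k) : Rˣ) : R) - ((hρ.gUnit ^ (-(2 * k)) : Rˣ) : R)) *
          ρ (phiEl d j (n + k))) else 0 := by
  obtain ⟨n, rfl⟩ : ∃ n', n = -n' := ⟨-n, by ring⟩
  rw [show -n + k = -(n - k) by ring, map_phiEl_neg, map_phiEl_neg]
  by_cases hn : 0 ≤ n
  · obtain ⟨n, rfl⟩ := Int.eq_ofNat_of_zero_le hn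
    have hu := fun m => hρ.commute_gUnit_zpow m (e (Kinv j))
    have h1 := hρ.commutator_h_Pneg hd i j hk n
    rw [if_pos hn, ← mul_assoc, ← (hρ.commute_Kinv (hρ.commute_K_h j i k)).eq, mul_assoc,
      mul_assoc, ← mul_sub, Int.toNat_natCast, h1]
    by_cases hk' : 0 < k
    · by_cases hnk : 0 ≤ n - k
      · rw [if_pos ⟨hk', hnk⟩, if_pos hk', if_pos hnk, mul_smul_comm, ← mul_assoc, ← mul_assoc,
          ((hu _).sub_left (hu _)).eq]
      · rw [if_neg (fun h => hnk h.2), if_pos hk', if_neg hnk, mul_zero, mul_zero, smul_zero]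
    · rw [if_neg (fun h => hk' h.1), if_neg hk', mul_zero]
  · rw [if_neg hn]
    split_ifs
    · omega
    all_goals simp

omit hρ in
lemma commute_psiEl {y : R} {j : Fin N} (hK : Commute y (ρ (e (K j))))
    (hh : ∀ s > 0, Commute y (ρ (e (h j s)))) (n : ℤ) : Commute y (ρ (psiEl d j n)) := by
  have h1 : ∀ n, Commute y (ρ (Ppos d j n)) := fun n => by
    induction n using Nat.strong_induction_on with
    | _ n ih =>
      cases n with
      | zero => rw [Ppos, map_one]; exact Commute.one_right _
      | succ n =>
        rw [Ppos, map_smul, map_sum]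
        refine (Commute.sum_right _ _ _ fun l hl => ?_).smul_right _
        rw [map_smul, map_mul]
        exact ((hh _ (by omega)).mul_right (ih _ (by omega))).smul_right _
  rw [map_psiEl]
  split_ifs
  · exact hK.mul_right (h1 _)
  · exact Commute.zero_right _

lemma commute_phiEl {y : R} {j : Fin N} (hK : Commute y (ρ (e (K j))))
    (hh : ∀ s < 0, Commute y (ρ (e (h j s)))) (n : ℤ) : Commute y (ρ (phiEl d j n)) := by
  have h1 : ∀ n, Commute y (ρ (Pneg d j n)) := fun n => by
    induction n using Nat.strong_induction_on with
    | _ n ih =>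
      cases n with
      | zero => rw [Pneg, map_one]; exact Commute.one_right _
      | succ n =>
        rw [Pneg, map_smul, map_sum]
        refine (Commute.sum_right _ _ _ fun l hl => ?_).smul_right _
        rw [map_smul, map_mul]
        exact ((hh _ (by omega)).mul_right (ih _ (by omega))).smul_right _
  obtain ⟨n, rfl⟩ : ∃ n', n = -n' := ⟨-n, by ring⟩
  rw [map_phiEl_neg]
  split_ifs
  · exact (hρ.commute_Kinv hK.symm).symm.mul_right (h1 _)
  · exact Commute.zero_right _

lemma commute_K_psiEl (i j : Fin N) (n : ℤ) : Commute (ρ (e (K i))) (ρ (psiEl d j n)) :=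
  commute_psiEl (hρ.commute_K_K i j) (fun s _ => hρ.commute_K_h i j s) n

lemma commute_K_phiEl (i j : Fin N) (n : ℤ) : Commute (ρ (e (K i))) (ρ (phiEl d j n)) :=
  hρ.commute_phiEl (hρ.commute_K_K i j) (fun s _ => hρ.commute_K_h i j s) n

lemma Dinv_mul_D : ρ (e Dinv) * ρ (e D) = 1 := by
  rw [← map_mul, hρ .Dinv_D, map_one]

lemma D_mul_h (i : Fin N) (s : ℤ) :
    ρ (e D) * ρ (e (h i s)) = qq ^ s • (ρ (e (h i s)) * ρ (e D)) := by
  have h1 := hρ (.D_h i s)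
  rw [map_mul, map_mul, map_smul] at h1
  exact mul_unit_conj hρ.Dinv_mul_D h1

lemma commute_D_K (i : Fin N) : Commute (ρ (e D)) (ρ (e (K i))) := by
  have h1 := hρ (.K_comm_D i)
  rw [map_mul, map_mul] at h1
  exact h1.symm

omit hρ in
lemma smul_comm_mul {y a b : R} {s t : Fq} (ha : y * a = s • (a * y)) (hb : y * b = t • (b * y)) :
    y * (a * b) = (s * t) • (a * b * y) := by
  rw [← mul_assoc, ha, smul_mul_assoc, mul_assoc, hb, mul_smul_comm, smul_smul, mul_assoc]

lemma D_mul_psiEl (j : Fin N) (n : ℤ) :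
    ρ (e D) * ρ (psiEl d j n) = qq ^ n • (ρ (psiEl d j n) * ρ (e D)) := by
  have h1 : ∀ n : ℕ, ρ (e D) * ρ (Ppos d j n) = qq ^ (n : ℤ) • (ρ (Ppos d j n) * ρ (e D)) :=
    fun n => by
    induction n using Nat.strong_induction_on with
    | _ n ih =>
      cases n with
      | zero => simp [Ppos]
      | succ n =>
        rw [Ppos, map_smul, map_sum, mul_smul_comm, smul_mul_assoc, smul_comm, Finset.mul_sum,
          Finset.sum_mul]
        congr 1
        rw [Finset.smul_sum]
        refine Finset.sum_congr rfl fun l hl => ?_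
        rw [Finset.mem_range] at hl
        rw [map_smul, map_mul, mul_smul_comm, smul_mul_assoc, smul_comm (qq ^ _),
          smul_comm_mul (hρ.D_mul_h j _) (ih (n - l) (by omega)), ← zpow_add₀ qq_ne_zero,
          Nat.cast_sub (by omega)]
        congr 3
        push_cast
        ring
  rw [map_psiEl]
  split_ifs with hn
  · obtain ⟨n, rfl⟩ := Int.eq_ofNat_of_zero_le hn
    rw [smul_comm_mul (s := 1) (by rw [one_smul, (hρ.commute_D_K j).eq]) (h1 _), one_mul]
    rfl
  · simp

lemma D_mul_phiEl (j : Fin N) (n : ℤ) :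
    ρ (e D) * ρ (phiEl d j n) = qq ^ n • (ρ (phiEl d j n) * ρ (e D)) := by
  have h1 : ∀ n : ℕ, ρ (e D) * ρ (Pneg d j n) = qq ^ (-n : ℤ) • (ρ (Pneg d j n) * ρ (e D)) :=
    fun n => by
    induction n using Nat.strong_induction_on with
    | _ n ih =>
      cases n with
      | zero => simp [Pneg]
      | succ n =>
        rw [Pneg, map_smul, map_sum, mul_smul_comm, smul_mul_assoc, smul_comm, Finset.mul_sum,
          Finset.sum_mul]
        congr 1
        rw [Finset.smul_sum]
        refine Finset.sum_congr rfl fun l hl => ?_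
        rw [Finset.mem_range] at hl
        rw [map_smul, map_mul, mul_smul_comm, smul_mul_assoc, smul_comm (qq ^ _),
          smul_comm_mul (hρ.D_mul_h j _) (ih (n - l) (by omega)), ← zpow_add₀ qq_ne_zero,
          Nat.cast_sub (by omega)]
        congr 3
        push_cast
        ring
  obtain ⟨n, rfl⟩ : ∃ n', n = -n' := ⟨-n, by ring⟩
  rw [map_phiEl_neg]
  split_ifs with hn
  · obtain ⟨n, rfl⟩ := Int.eq_ofNat_of_zero_le hn
    rw [smul_comm_mul (s := 1)
      (by rw [one_smul, (hρ.commute_Kinv (hρ.commute_D_K j).symm).symm.eq]) (h1 _), one_mul]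
    rfl
  · simp

end Respects

end CartanAction

section WordModule

/-- The tensor product of the free module on the words in `I` with `S`. -/
abbrev WordModule (I S : Type*) [AddCommGroup S] : Type _ := List I →₀ S

namespace WordModule

variable {F : Type*} [Field F] {I S : Type*} [AddCommGroup S] [Module F S]

variable (F S) in
/-- Prepending a letter. -/
def letter (a : I) : Module.End F (WordModule I S) := Finsupp.lmapDomain S F (List.cons a)

variable (F I S) in
/-- The vectors supported at the empty word. -/
def base : S →ₗ[F] WordModule I S := Finsupp.lsingle []

/-- The values at the vectors supported at a given word of `WordModule.lift`. -/
def liftAux (T : S →ₗ[F] WordModule I S) (σ : I → F) (C : I → Module.End F (WordModule I S)) :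
    List I → S →ₗ[F] WordModule I S
  | [] => T
  | a :: w => σ a • (letter F S a).comp (liftAux T σ C w) + (C a).comp (Finsupp.lsingle w)

/-- The operator with prescribed values on the empty word and prescribed twisted commutators
with the letters. -/
def lift (T : S →ₗ[F] WordModule I S) (σ : I → F) (C : I → Module.End F (WordModule I S)) :
    Module.End F (WordModule I S) := Finsupp.lsum F (liftAux T σ C)

lemma letter_single (a : I) (w : List I) (s : S) :
    letter F S a (Finsupp.single w s) = Finsupp.single (a :: w) s := by
  rw [letter, Finsupp.lmapDomain_apply, Finsupp.mapDomain_single]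

lemma lift_base (T : S →ₗ[F] WordModule I S) (σ : I → F)
    (C : I → Module.End F (WordModule I S)) (s : S) : lift T σ C (base F I S s) = T s := by
  rw [base, lift, Finsupp.lsingle_apply, Finsupp.lsum_single]
  rfl

lemma lift_mul_letter (T : S →ₗ[F] WordModule I S) (σ : I → F)
    (C : I → Module.End F (WordModule I S)) (a : I) :
    lift T σ C * letter F S a = σ a • (letter F S a * lift T σ C) + C a := by
  refine Finsupp.lhom_ext fun w s => ?_
  rw [Module.End.mul_apply, letter_single, LinearMap.add_apply, LinearMap.smul_apply,
    Module.End.mul_apply, lift, Finsupp.lsum_single, Finsupp.lsum_single]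
  rfl

/-- An operator which vanishes on the empty word and commutes with the letters up to scalars is
zero. -/
lemma eq_zero_of_mul_letter {T : Module.End F (WordModule I S)} (h₀ : ∀ s, T (base F I S s) = 0)
    (c : I → F) (h : ∀ a, T * letter F S a = c a • (letter F S a * T)) : T = 0 := by
  refine Finsupp.lhom_ext fun w s => ?_
  induction w with
  | nil => exact h₀ s
  | cons a w ih =>
    have h1 := LinearMap.congr_fun (h a) (Finsupp.single w s)
    rw [Module.End.mul_apply, letter_single, LinearMap.smul_apply, Module.End.mul_apply, ih] at h1
    simpa using h1

lemma eq_of_mul_letter {T T' : Module.End F (WordModule I S)}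
    (h₀ : ∀ s, T (base F I S s) = T' (base F I S s)) (c : I → F)
    (h : ∀ a, T * letter F S a - c a • (letter F S a * T) =
      T' * letter F S a - c a • (letter F S a * T')) : T = T' := by
  rw [← sub_eq_zero]
  refine eq_zero_of_mul_letter (fun s => by rw [LinearMap.sub_apply, h₀, sub_self]) c fun a => ?_
  rw [sub_mul, mul_sub, smul_sub]
  linear_combination (norm := module) h a

end WordModule

end WordModule

section HeisenbergModule

variable {Γ : Type*} [CommRing Γ] [Algebra Fq Γ]

/-- The polynomials in the variables `h_{i,-l-1}`. -/
abbrev HeisenbergModule (N : ℕ) (Γ : Type*) [CommRing Γ] : Type _ := MvPolynomial (Fin N × ℕ) Γ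

namespace HeisenbergModule

open MvPolynomial

variable (N) in
/-- The rescaling by the degree. -/
def scaling (ε : ℤ) : HeisenbergModule N Γ →ₐ[Γ] HeisenbergModule N Γ :=
  aeval fun v => (qq ^ (ε * (v.2 + 1)) : Fq) • X v

/-- The structure constants of the Heisenberg relations. -/
def pairing (i j : Fin N) (k : ℤ) : Fq :=
  (k : Fq)⁻¹ * qint d i (k * A i j) * (qi d j - (qi d j)⁻¹)⁻¹

/-- The annihilation operators. -/
def annihilator (g : Γˣ) (i : Fin N) (s : ℤ) :
    Derivation Γ (HeisenbergModule N Γ) (HeisenbergModule N Γ) :=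
  mkDerivation Γ fun v => if (v.2 + 1 : ℤ) = s then
    C (pairing d A i v.1 s • (((g ^ (2 * s) : Γˣ) : Γ) - ((g ^ (-(2 * s)) : Γˣ) : Γ))) else 0

/-- The action of the generators `h_{i,s}`. -/
def hOp (g : Γˣ) (i : Fin N) (s : ℤ) : HeisenbergModule N Γ →ₗ[Γ] HeisenbergModule N Γ :=
  if s = 0 then 0 else if s < 0 then LinearMap.mulLeft Γ (X (i, (-s).toNat - 1))
  else (annihilator d A g i s).toLinearMap

/-- The action of the generators other than the modes of `x^±`. -/
def genOp (g : Γˣ) (κ : Fq) : Gen N → (HeisenbergModule N Γ →ₗ[Γ] HeisenbergModule N Γ)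
  | .xp _ _ => 0
  | .xm _ _ => 0
  | .h i s => hOp d A g i s
  | .K _ => κ • 1
  | .Kinv _ => κ⁻¹ • 1
  | .g2 => (g : Γ) • 1
  | .g2inv => ((g⁻¹ : Γˣ) : Γ) • 1
  | .D => (scaling N (-1)).toLinearMap
  | .Dinv => (scaling N 1).toLinearMap

variable {d A}

lemma scaling_X (ε : ℤ) (v : Fin N × ℕ) :
    scaling N ε (X v : HeisenbergModule N Γ) = (qq ^ (ε * (v.2 + 1)) : Fq) • X v := by
  rw [scaling, aeval_X]

lemma scaling_smul (ε : ℤ) (c : Fq) (p : HeisenbergModule N Γ) :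
    scaling N ε (c • p) = c • scaling N ε p :=
  (scaling N ε).toLinearMap.map_smul_of_tower c p

lemma scaling_scaling_neg (ε : ℤ) (p : HeisenbergModule N Γ) :
    scaling N ε (scaling N (-ε) p) = p := by
  rw [← AlgHom.comp_apply]
  conv_rhs => rw [← AlgHom.id_apply (R := Γ) p]
  congr 1
  refine algHom_ext fun v => ?_
  rw [AlgHom.comp_apply, scaling_X, scaling_smul, scaling_X, smul_smul, ← zpow_add₀ qq_ne_zero]
  simp

lemma annihilator_X (g : Γˣ) (i : Fin N) (s : ℤ) (v : Fin N × ℕ) :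
    annihilator d A g i s (X v) = if (v.2 + 1 : ℤ) = s then
      C (pairing d A i v.1 s • (((g ^ (2 * s) : Γˣ) : Γ) - ((g ^ (-(2 * s)) : Γˣ) : Γ))) else 0 :=
  mkDerivation_X _ _ _

lemma scaling_annihilator (g : Γˣ) (i : Fin N) (s : ℤ) (p : HeisenbergModule N Γ) :
    scaling N (-1) (annihilator d A g i s p) =
      (qq ^ s : Fq) • annihilator d A g i s (scaling N (-1) p) := by
  induction p using MvPolynomial.induction_on with
  | C c => simp [scaling]
  | add p p' hp hp' => simp only [map_add, smul_add, hp, hp']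
  | mul_X p v hp =>
    rw [Derivation.leibniz, map_add, map_mul, Derivation.leibniz]
    simp only [smul_eq_mul, map_mul, hp, scaling_X]
    rw [Derivation.map_smul_of_tower, annihilator_X]
    split_ifs with hv
    · have h1 : ∀ c : Γ, scaling N (-1) (C c : HeisenbergModule N Γ) = C c := fun c => by
        rw [scaling, aeval_C]; rfl
      rw [h1, ← hv, smul_add, mul_smul_comm _ (scaling N (-1) p), smul_smul, ← zpow_add₀ qq_ne_zero]
      simp
    · simp

lemma pairing_symm (hsym : ∀ i j, d i * A i j = d j * A j i) (i j : Fin N) (k : ℤ) :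
    pairing d A i j (-k) = pairing d A j i k := by
  have h1 : ∀ i j : Fin N, qint d i (k * A i j) =
      (qq ^ (k * (d i * A i j)) - qq ^ (-(k * (d i * A i j)))) / (qi d i - (qi d i)⁻¹) := by
    intro i j
    rw [qint]
    nth_rw 1 [qi]
    nth_rw 1 [qi]
    rw [← zpow_mul, ← zpow_mul]
    congr 3 <;> ring
  have h2 : qint d i (-k * A i j) = -qint d i (k * A i j) := by
    rw [qint, qint, neg_mul, neg_neg, ← neg_sub (_ ^ _), neg_div]
  rw [pairing, pairing, h2, h1, h1, hsym, Int.cast_neg]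
  ring

lemma commutator_hOp (hsym : ∀ i j, d i * A i j = d j * A j i) (g : Γˣ) (i j : Fin N) {k l : ℤ}
    (hk : k ≠ 0) (hl : l ≠ 0) (p : HeisenbergModule N Γ) :
    hOp d A g i k (hOp d A g j l p) - hOp d A g j l (hOp d A g i k p) =
      if l = -k then pairing d A i j k •
        ((((g ^ (2 * k) : Γˣ) : Γ) - ((g ^ (-(2 * k)) : Γˣ) : Γ)) • p) else 0 := by
  have mixed : ∀ (i j : Fin N) (k l : ℤ), 0 < k → l < 0 →
      hOp d A g i k (hOp d A g j l p) - hOp d A g j l (hOp d A g i k p) =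
      if l = -k then pairing d A i j k •
        ((((g ^ (2 * k) : Γˣ) : Γ) - ((g ^ (-(2 * k)) : Γˣ) : Γ)) • p) else 0 := by
    intro i j k l hk hl
    simp only [hOp, if_neg hk.ne', if_neg hk.le.not_gt, if_neg hl.ne, if_pos hl,
      LinearMap.mulLeft_apply, Derivation.coeFn_coe, Derivation.leibniz, annihilator_X]
    rw [smul_eq_mul, add_sub_cancel_left]
    by_cases h1 : l = -k
    · rw [if_pos h1, if_pos (by omega), smul_eq_mul, mul_comm, ← MvPolynomial.smul_eq_C_mul,
        smul_assoc]
    · rw [if_neg h1, if_neg (by omega), smul_zero]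
  rcases lt_or_gt_of_ne hk with hk' | hk' <;> rcases lt_or_gt_of_ne hl with hl' | hl'
  · rw [if_neg (by omega)]
    simp only [hOp, if_neg hk, if_pos hk', if_neg hl, if_pos hl', LinearMap.mulLeft_apply]
    ring
  · rw [← neg_sub, mixed j i l k hl' hk']
    by_cases h1 : l = -k
    · obtain rfl : k = -l := by omega
      rw [if_pos rfl, if_pos (neg_neg l).symm, pairing_symm hsym, ← smul_neg, ← neg_smul, neg_sub]
      congr 5 <;> ring
    · rw [if_neg h1, if_neg (by omega), neg_zero]
  · exact mixed i j k l hk' hl'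
  · rw [if_neg (by omega)]
    simp only [hOp, if_neg hk, if_neg hl, if_neg hk'.le.not_gt, if_neg hl'.le.not_gt,
      Derivation.coeFn_coe]
    rw [← Derivation.commutator_apply]
    have h1 : ⁅annihilator d A g i k, annihilator d A g j l⁆ = 0 := by
      refine MvPolynomial.derivation_ext fun v => ?_
      rw [Derivation.commutator_apply, annihilator_X, annihilator_X]
      split_ifs <;> simp
    rw [h1, Derivation.zero_apply]

end HeisenbergModule

end HeisenbergModule

section HeisenbergRepresentation

variable {Γ : Type*} [CommRing Γ] [Algebra Fq Γ]

namespace HeisenbergModule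

open MvPolynomial

/-- The action of the generators, as operators over the base field. -/
def action (g : Γˣ) (κ : Fq) : FA N →ₐ[Fq] Module.End Fq (HeisenbergModule N Γ) :=
  FreeAlgebra.lift Fq fun x => (genOp d A g κ x).restrictScalars Fq

variable {d A}

lemma action_e (g : Γˣ) (κ : Fq) (x : Gen N) (p : HeisenbergModule N Γ) :
    action d A g κ (e x) p = genOp d A g κ x p := by
  rw [action, e, FreeAlgebra.lift_ι_apply]
  rfl

lemma scaling_neg_scaling (ε : ℤ) (p : HeisenbergModule N Γ) :
    scaling N (-ε) (scaling N ε p) = p := by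
  have h := scaling_scaling_neg (-ε) p
  rwa [neg_neg] at h

lemma scaling_hOp (g : Γˣ) (i : Fin N) (s : ℤ) (p : HeisenbergModule N Γ) :
    scaling N (-1) (hOp d A g i s p) = (qq ^ s : Fq) • hOp d A g i s (scaling N (-1) p) := by
  rw [hOp]
  split_ifs with h0 hs
  · simp
  · rw [LinearMap.mulLeft_apply, LinearMap.mulLeft_apply, map_mul, scaling_X, smul_mul_assoc]
    congr 2
    push_cast
    omega
  · exact scaling_annihilator g i s p

lemma action_gammaHalf (g : Γˣ) (κ : Fq) (m : ℤ) (p : HeisenbergModule N Γ) :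
    action d A g κ (gammaHalf m) p = ((g ^ m : Γˣ) : Γ) • p := by
  have h1 : ∀ (x : Gen N) (c : Γ) (hx : genOp d A g κ x = c • 1) (n : ℕ),
      action d A g κ (e x ^ n) p = c ^ n • p := by
    intro x c hx n
    induction n with
    | zero => simp
    | succ n ih =>
      rw [pow_succ', map_mul, Module.End.mul_apply, ih, action_e, hx, LinearMap.smul_apply,
        Module.End.one_apply, smul_smul, pow_succ']
  rw [gammaHalf]
  split_ifs with hm
  · obtain ⟨n, rfl⟩ := Int.eq_ofNat_of_zero_le hm
    rw [h1 _ _ rfl]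
    simp
  · obtain ⟨n, hn⟩ := Int.eq_ofNat_of_zero_le (by omega : 0 ≤ -m)
    obtain rfl : m = -n := by omega
    rw [h1 _ _ rfl]
    simp

lemma respects_action (hsym : ∀ i j, d i * A i j = d j * A j i) (g : Γˣ) {κ : Fq} (hκ : κ ≠ 0) :
    Respects (CartanRel N d A) (action d A g κ) := by
  have hsc : ∀ (c : Fq) (T : HeisenbergModule N Γ →ₗ[Γ] HeisenbergModule N Γ)
      (p : HeisenbergModule N Γ), T (c • p) = c • T p := fun c T p => T.map_smul_of_tower c p
  intro a b hab
  refine LinearMap.ext fun p => ?_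
  cases hab with
  | K_Kinv i => simp [action_e, genOp, smul_smul, hκ]
  | Kinv_K i => simp [action_e, genOp, smul_smul, hκ]
  | D_Dinv =>
    simp only [map_mul, Module.End.mul_apply, action_e, map_one, Module.End.one_apply, genOp]
    exact scaling_neg_scaling 1 p
  | Dinv_D =>
    simp only [map_mul, Module.End.mul_apply, action_e, map_one, Module.End.one_apply, genOp]
    exact scaling_scaling_neg 1 p
  | g_ginv => simp [action_e, genOp, smul_smul]
  | ginv_g => simp [action_e, genOp, smul_smul]
  | g2_comm x =>
    simp only [map_mul, Module.End.mul_apply, action_e]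
    rw [genOp, LinearMap.smul_apply, LinearMap.smul_apply, map_smul]
    rfl
  | g2inv_comm x =>
    simp only [map_mul, Module.End.mul_apply, action_e]
    rw [genOp, LinearMap.smul_apply, LinearMap.smul_apply, map_smul]
    rfl
  | K_comm_K i j => simp [action_e, genOp, smul_smul]
  | K_comm_D i =>
    simp only [map_mul, Module.End.mul_apply, action_e, genOp, LinearMap.smul_apply, hsc]
    rfl
  | K_comm_h i j s =>
    simp only [map_mul, Module.End.mul_apply, action_e, genOp, LinearMap.smul_apply, hsc]
    rfl
  | h_zero i => simp [action_e, genOp, hOp]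
  | D_h i s =>
    simp only [map_mul, map_smul, LinearMap.smul_apply, Module.End.mul_apply, action_e, genOp,
      AlgHom.toLinearMap_apply, scaling_hOp]
    rw [scaling_neg_scaling]
  | h_h i j k l hk hl =>
    rw [map_sub, map_mul, map_mul, LinearMap.sub_apply, Module.End.mul_apply, Module.End.mul_apply]
    simp only [action_e, genOp]
    rw [commutator_hOp hsym g i j hk hl]
    split_ifs
    · rw [map_smul, map_sub, LinearMap.smul_apply, LinearMap.sub_apply, gammaPow, gammaPow,
        action_gammaHalf, action_gammaHalf, sub_smul, mul_neg, pairing]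
    · rw [map_zero, LinearMap.zero_apply]

end HeisenbergModule

end HeisenbergRepresentation

section InducedModule

namespace InducedModule

open WordModule

variable {S : Type*} [AddCommGroup S] [Module Fq S] (σ : FA N →ₐ[Fq] Module.End Fq S)

variable (N S) in
/-- The space underlying the module induced from `S`. -/
abbrev Space : Type _ := WordModule (Fin N × ℤ) S

/-- The scalars by which the generators commute with `x^-_{j,m}`. -/
def weight : Gen N → Fin N × ℤ → Fq
  | .K i, a => (qp d A i a.1)⁻¹
  | .Kinv i, a => qp d A i a.1
  | .D, a => qq ^ a.2
  | .Dinv, a => qq ^ (-a.2)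
  | _, _ => 1

/-- The operator commuting with the letters which extends the action of a generator. -/
def diagOp (x : Gen N) : Module.End Fq (Space N S) :=
  lift (base Fq (Fin N × ℤ) S ∘ₗ σ (e x)) (weight d A x) 0

/-- The commutators of the generators with `x^-_{j,m}`. -/
def shiftTerm : Gen N → Fin N × ℤ → Module.End Fq (Space N S)
  | .h i k, a => (-((k : Fq)⁻¹ * qint d i (k * A i a.1))) •
      (diagOp d A σ .g2 ^ |k|.toNat * letter Fq S (a.1, k + a.2))
  | _, _ => 0

/-- The action of the generators other than the `x^+_{i,r}`. -/
def lowerOp : Gen N → Module.End Fq (Space N S)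
  | .xp _ _ => 0
  | .xm i r => letter Fq S (i, r)
  | x => lift (base Fq (Fin N × ℤ) S ∘ₗ σ (e x)) (weight d A x) (shiftTerm d A σ x)

/-- The commutators of the `x^+_{i,k}` with the letters. -/
def crossTerm (i : Fin N) (k : ℤ) (a : Fin N × ℤ) : FA N :=
  if i = a.1 then
    ((qi d i - (qi d i)⁻¹)⁻¹) •
      (gammaHalf (k - a.2) * psiEl d i (k + a.2) - gammaHalf (a.2 - k) * phiEl d i (k + a.2))
  else 0

/-- The action of the generators. -/
def genOp : Gen N → Module.End Fq (Space N S)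
  | .xp i k => lift 0 1 fun a => FreeAlgebra.lift Fq (lowerOp d A σ) (crossTerm d i k a)
  | x => lowerOp d A σ x

/-- The action on the induced module. -/
def action : FA N →ₐ[Fq] Module.End Fq (Space N S) := FreeAlgebra.lift Fq (genOp d A σ)

lemma map_eq_of_eqOn {R : Type*} [Ring R] [Algebra Fq R] {ρ ρ' : FA N →ₐ[Fq] R}
    (h : ∀ x : Gen N, (∀ i r, x ≠ .xp i r) → ρ (e x) = ρ' (e x)) :
    (∀ m, ρ (gammaHalf m) = ρ' (gammaHalf m)) ∧ (∀ i k, ρ (psiEl d i k) = ρ' (psiEl d i k)) ∧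
      ∀ i k, ρ (phiEl d i k) = ρ' (phiEl d i k) := by
  have hpos : ∀ i k, ρ (Ppos d i k) = ρ' (Ppos d i k) := by
    intro i k
    induction k using Nat.strong_induction_on with
    | _ k ih =>
      cases k with
      | zero => rw [Ppos, map_one, map_one]
      | succ k =>
        rw [Ppos, map_smul, map_smul, map_sum, map_sum]
        congr 1
        refine Finset.sum_congr rfl fun l hl => ?_
        rw [map_smul, map_smul, map_mul, map_mul, h _ (by simp), ih _ (by omega)]
  have hneg : ∀ i k, ρ (Pneg d i k) = ρ' (Pneg d i k) := by
    intro i k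
    induction k using Nat.strong_induction_on with
    | _ k ih =>
      cases k with
      | zero => rw [Pneg, map_one, map_one]
      | succ k =>
        rw [Pneg, map_smul, map_smul, map_sum, map_sum]
        congr 1
        refine Finset.sum_congr rfl fun l hl => ?_
        rw [map_smul, map_smul, map_mul, map_mul, h _ (by simp), ih _ (by omega)]
  refine ⟨fun m => ?_, fun i k => ?_, fun i k => ?_⟩
  · rw [gammaHalf]
    split_ifs
    · rw [map_pow, map_pow, h _ (by simp)]
    · rw [map_pow, map_pow, h _ (by simp)]
  · rw [map_psiEl, map_psiEl, hpos, h _ (by simp)]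
  · rw [← neg_neg k, map_phiEl_neg, map_phiEl_neg, hneg, h _ (by simp)]

variable {d A}

lemma action_e (x : Gen N) : action d A σ (e x) = genOp d A σ x := by
  rw [action, e, FreeAlgebra.lift_ι_apply]

lemma action_xm (i : Fin N) (r : ℤ) : action d A σ (e (.xm i r)) = letter Fq S (i, r) :=
  action_e σ _

lemma action_xp_base (i : Fin N) (k : ℤ) (s : S) :
    action d A σ (e (.xp i k)) (base Fq _ S s) = 0 := by
  rw [action_e, genOp, lift_base, LinearMap.zero_apply]

lemma action_crossTerm (i : Fin N) (k : ℤ) (a : Fin N × ℤ) :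
    FreeAlgebra.lift Fq (lowerOp d A σ) (crossTerm d i k a) =
      action d A σ (crossTerm d i k a) := by
  obtain ⟨h1, h2, h3⟩ := map_eq_of_eqOn d (ρ := FreeAlgebra.lift Fq (lowerOp d A σ))
    (ρ' := action d A σ) fun x hx => by
      rw [action_e, e, FreeAlgebra.lift_ι_apply]
      cases x with
      | xp i r => exact absurd rfl (hx i r)
      | _ => rfl
  rw [crossTerm]
  split_ifs
  · simp only [map_smul, map_sub, map_mul, h1, h2, h3]
  · rw [map_zero, map_zero]

lemma action_xp_mul_letter (i : Fin N) (k : ℤ) (a : Fin N × ℤ) :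
    action d A σ (e (.xp i k)) * letter Fq S a =
      letter Fq S a * action d A σ (e (.xp i k)) + action d A σ (crossTerm d i k a) := by
  rw [action_e, genOp, lift_mul_letter, action_crossTerm, Pi.one_apply, one_smul]

/-- The generators other than the modes of `x^±`. -/
def IsCartan (x : Gen N) : Prop := (∀ i r, x ≠ .xp i r) ∧ ∀ i r, x ≠ .xm i r

lemma action_base {x : Gen N} (hx : IsCartan x) (s : S) :
    action d A σ (e x) (base Fq _ S s) = base Fq _ S (σ (e x) s) := by
  rw [action_e]
  cases x with
  | xp i r => exact absurd rfl (hx.1 i r)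
  | xm i r => exact absurd rfl (hx.2 i r)
  | _ => rw [genOp, lowerOp, lift_base, LinearMap.comp_apply] <;> simp

lemma action_mul_letter {x : Gen N} (hx : IsCartan x) (a : Fin N × ℤ) :
    action d A σ (e x) * letter Fq S a =
      weight d A x a • (letter Fq S a * action d A σ (e x)) + shiftTerm d A σ x a := by
  rw [action_e]
  cases x with
  | xp i r => exact absurd rfl (hx.1 i r)
  | xm i r => exact absurd rfl (hx.2 i r)
  | _ => rw [genOp, lowerOp, lift_mul_letter] <;> simp

lemma diagOp_g2 : diagOp d A σ .g2 = action d A σ (e .g2) := by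
  rw [action_e]; rfl

lemma action_h_mul_letter (i : Fin N) (k : ℤ) (a : Fin N × ℤ) :
    action d A σ (e (.h i k)) * letter Fq S a = letter Fq S a * action d A σ (e (.h i k)) +
      (-((k : Fq)⁻¹ * qint d i (k * A i a.1))) •
        (action d A σ (e .g2) ^ |k|.toNat * letter Fq S (a.1, k + a.2)) := by
  rw [action_mul_letter σ (by simp [IsCartan]), weight, one_smul, shiftTerm, diagOp_g2]
  all_goals simp

lemma action_K_mul_letter (i : Fin N) (a : Fin N × ℤ) :
    action d A σ (e (.K i)) * letter Fq S a =
      (qp d A i a.1)⁻¹ • (letter Fq S a * action d A σ (e (.K i))) := by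
  rw [action_mul_letter σ (by simp [IsCartan]), weight, shiftTerm, add_zero]
  all_goals simp

lemma action_Kinv_mul_letter (i : Fin N) (a : Fin N × ℤ) :
    action d A σ (e (.Kinv i)) * letter Fq S a =
      qp d A i a.1 • (letter Fq S a * action d A σ (e (.Kinv i))) := by
  rw [action_mul_letter σ (by simp [IsCartan]), weight, shiftTerm, add_zero]
  all_goals simp

lemma action_D_mul_letter (a : Fin N × ℤ) :
    action d A σ (e .D) * letter Fq S a =
      (qq ^ a.2 : Fq) • (letter Fq S a * action d A σ (e .D)) := by
  rw [action_mul_letter σ (by simp [IsCartan]), weight, shiftTerm, add_zero]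
  all_goals simp

lemma action_Dinv_mul_letter (a : Fin N × ℤ) :
    action d A σ (e .Dinv) * letter Fq S a =
      (qq ^ (-a.2) : Fq) • (letter Fq S a * action d A σ (e .Dinv)) := by
  rw [action_mul_letter σ (by simp [IsCartan]), weight, shiftTerm, add_zero]
  all_goals simp

lemma action_g2_mul_letter (a : Fin N × ℤ) :
    action d A σ (e .g2) * letter Fq S a = letter Fq S a * action d A σ (e .g2) := by
  rw [action_mul_letter σ (by simp [IsCartan]), weight, shiftTerm, add_zero, one_smul]
  all_goals simp

lemma action_g2inv_mul_letter (a : Fin N × ℤ) :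
    action d A σ (e .g2inv) * letter Fq S a = letter Fq S a * action d A σ (e .g2inv) := by
  rw [action_mul_letter σ (by simp [IsCartan]), weight, shiftTerm, add_zero, one_smul]
  all_goals simp

end InducedModule

end InducedModule

section InducedModuleCartan

namespace InducedModule

open WordModule

variable {S : Type*} [AddCommGroup S] [Module Fq S] {σ : FA N →ₐ[Fq] Module.End Fq S}
variable {d A}

variable (d A σ) in
/-- An element whose action on the induced module extends that on the inducing module. -/
def ExtendsBase (u : FA N) : Prop :=
  ∀ s, action d A σ u (base Fq _ S s) = base Fq _ S (σ u s)

namespace ExtendsBase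

lemma gen {x : Gen N} (hx : IsCartan x) : ExtendsBase d A σ (e x) := action_base σ hx

lemma one : ExtendsBase d A σ 1 := fun s => by simp

lemma mul {u v : FA N} (hu : ExtendsBase d A σ u) (hv : ExtendsBase d A σ v) :
    ExtendsBase d A σ (u * v) := fun s => by
  rw [map_mul, map_mul, Module.End.mul_apply, Module.End.mul_apply, hv, hu]

lemma pow {u : FA N} (hu : ExtendsBase d A σ u) (n : ℕ) : ExtendsBase d A σ (u ^ n) := by
  induction n with
  | zero => rw [pow_zero]; exact one
  | succ n ih => rw [pow_succ]; exact ih.mul hu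

lemma sub {u v : FA N} (hu : ExtendsBase d A σ u) (hv : ExtendsBase d A σ v) :
    ExtendsBase d A σ (u - v) := fun s => by
  rw [map_sub, map_sub, LinearMap.sub_apply, LinearMap.sub_apply, hv, hu, map_sub]

lemma smul (c : Fq) {u : FA N} (hu : ExtendsBase d A σ u) : ExtendsBase d A σ (c • u) := fun s => by
  rw [map_smul, map_smul, LinearMap.smul_apply, LinearMap.smul_apply, hu, map_smul]

lemma gammaHalf (m : ℤ) : ExtendsBase d A σ (gammaHalf m) := by
  rw [_root_.gammaHalf]
  split_ifs
  · exact (gen (by simp [IsCartan])).pow _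
  · exact (gen (by simp [IsCartan])).pow _

end ExtendsBase

lemma map_eq_of_extendsBase {u v : FA N} (hu : ExtendsBase d A σ u) (hv : ExtendsBase d A σ v)
    (huv : σ u = σ v) (c : Fin N × ℤ → Fq)
    (h : ∀ a, action d A σ u * letter Fq S a - c a • (letter Fq S a * action d A σ u) =
      action d A σ v * letter Fq S a - c a • (letter Fq S a * action d A σ v)) :
    action d A σ u = action d A σ v :=
  eq_of_mul_letter (fun s => by rw [hu, hv, huv]) c h

lemma map_eq_of_scaled {u v : FA N} (hu : ExtendsBase d A σ u) (hv : ExtendsBase d A σ v)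
    (huv : σ u = σ v) (c : Fin N × ℤ → Fq)
    (hu' : ∀ a, action d A σ u * letter Fq S a = c a • (letter Fq S a * action d A σ u))
    (hv' : ∀ a, action d A σ v * letter Fq S a = c a • (letter Fq S a * action d A σ v)) :
    action d A σ u = action d A σ v :=
  map_eq_of_extendsBase hu hv huv c fun a => by rw [hu', hv', sub_self, sub_self]

lemma scaled_mul {R : Type*} [Ring R] [Algebra Fq R] {T T' L : R} {s t : Fq}
    (hT : T * L = s • (L * T)) (hT' : T' * L = t • (L * T')) :
    (T * T') * L = (s * t) • (L * (T * T')) := by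
  rw [mul_assoc, hT', mul_smul_comm, ← mul_assoc, hT, smul_mul_assoc, smul_smul, mul_comm t,
    mul_assoc]

variable (hσ : Respects (CartanRel N d A) σ)
include hσ

lemma g2_mul_g2inv : action d A σ (e .g2) * action d A σ (e .g2inv) = 1 := by
  rw [← map_mul, ← map_one (action d A σ)]
  refine map_eq_of_scaled ((ExtendsBase.gen (by simp [IsCartan])).mul
    (ExtendsBase.gen (by simp [IsCartan]))) .one (hσ .g_ginv) 1 (fun a => ?_) (fun a => by simp)
  rw [Pi.one_apply, one_smul, map_mul, mul_assoc, action_g2inv_mul_letter, ← mul_assoc,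
    action_g2_mul_letter, mul_assoc]

lemma g2inv_mul_g2 : action d A σ (e .g2inv) * action d A σ (e .g2) = 1 := by
  rw [← map_mul, ← map_one (action d A σ)]
  refine map_eq_of_scaled ((ExtendsBase.gen (by simp [IsCartan])).mul
    (ExtendsBase.gen (by simp [IsCartan]))) .one (hσ .ginv_g) 1 (fun a => ?_) (fun a => by simp)
  rw [Pi.one_apply, one_smul, map_mul, mul_assoc, action_g2_mul_letter, ← mul_assoc,
    action_g2inv_mul_letter, mul_assoc]

lemma commute_g2_cartan {x : Gen N} (hx : IsCartan x) :
    Commute (action d A σ (e .g2)) (action d A σ (e x)) := by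
  rw [Commute, SemiconjBy, ← map_mul, ← map_mul]
  refine map_eq_of_extendsBase ((ExtendsBase.gen (by simp [IsCartan])).mul (.gen hx))
    ((ExtendsBase.gen hx).mul (.gen (by simp [IsCartan]))) (hσ (.g2_comm x)) (weight d A x)
    fun a => ?_
  have hs : action d A σ (e .g2) * shiftTerm d A σ x a = shiftTerm d A σ x a * action d A σ (e .g2) := by
    cases x with
    | h i k =>
      rw [shiftTerm, mul_smul_comm, smul_mul_assoc, diagOp_g2, ← mul_assoc, ← pow_succ',
        mul_assoc _ (letter _ _ _), ← action_g2_mul_letter, ← mul_assoc, ← pow_succ]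
    | _ => simp [shiftTerm]
  simp only [map_mul]
  rw [mul_assoc, action_mul_letter σ hx, mul_assoc, action_g2_mul_letter, mul_add, hs,
    mul_smul_comm, ← mul_assoc, action_g2_mul_letter, ← mul_assoc (action d A σ (e x)), 
    action_mul_letter σ hx, add_mul, smul_mul_assoc, mul_assoc, mul_assoc]
  abel

lemma commute_g2_gen (x : Gen N) : Commute (action d A σ (e .g2)) (action d A σ (e x)) := by
  have hlow : ∀ x : Gen N, (∀ i r, x ≠ .xp i r) →
      Commute (action d A σ (e .g2)) (action d A σ (e x)) := by
    intro x hx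
    cases x with
    | xp i r => exact absurd rfl (hx i r)
    | xm i r => rw [action_xm]; exact action_g2_mul_letter σ (i, r)
    | _ => exact commute_g2_cartan hσ (by simp [IsCartan])
  have hlow' : ∀ x : Gen N, (∀ i r, x ≠ .xp i r) →
      Commute (action d A σ (e .g2)) (FreeAlgebra.lift Fq (lowerOp d A σ) (e x)) := by
    intro x hx
    have h := hlow x hx
    rw [action_e _ x] at h
    rw [e.eq_1 x, FreeAlgebra.lift_ι_apply]
    cases x with
    | xp i r => exact absurd rfl (hx i r)
    | _ => exact h
  have hall : ∀ u, Commute (action d A σ (e .g2)) (FreeAlgebra.lift Fq (lowerOp d A σ) u) := by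
    intro u
    induction u using FreeAlgebra.induction with
    | grade0 r => rw [AlgHom.commutes]; exact (Algebra.commutes r _).symm
    | grade1 x =>
      cases x with
      | xp i r =>
        rw [FreeAlgebra.lift_ι_apply, lowerOp]
        exact Commute.zero_right _
      | _ => exact hlow' _ (by simp)
    | mul a b ha hb => rw [map_mul]; exact ha.mul_right hb
    | add a b ha hb => rw [map_add]; exact ha.add_right hb
  cases x with
  | xp i k =>
    refine eq_of_mul_letter (fun s => ?_) 1 fun a => ?_
    · rw [Module.End.mul_apply, Module.End.mul_apply, action_xp_base, map_zero,
        action_base σ (by simp [IsCartan]), action_xp_base]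
    · have h := hall (crossTerm d i k a)
      rw [action_crossTerm] at h
      rw [Pi.one_apply, one_smul, one_smul, mul_assoc, action_xp_mul_letter, mul_assoc,
        action_g2_mul_letter, mul_add, ← mul_assoc, action_g2_mul_letter, h.eq,
        ← mul_assoc (action d A σ (e (.xp i k))), action_xp_mul_letter, add_mul, mul_assoc,
        mul_assoc]
      abel
  | _ => exact hlow _ (by simp)

lemma commute_g2inv_gen (x : Gen N) : Commute (action d A σ (e .g2inv)) (action d A σ (e x)) :=
  Commute.units_inv_left (u := ⟨_, _, g2_mul_g2inv hσ, g2inv_mul_g2 hσ⟩) (commute_g2_gen hσ x)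

omit hσ in
lemma mul_dressed {R : Type*} [Ring R] [Algebra Fq R] {T g L : R} {w : Fq} (hg : Commute g T)
    (hT : T * L = w • (L * T)) (c : Fq) (n : ℕ) :
    T * (c • (g ^ n * L)) = w • ((c • (g ^ n * L)) * T) := by
  rw [mul_smul_comm, ← mul_assoc, ← (hg.pow_left n).eq, mul_assoc, hT, mul_smul_comm,
    smul_mul_assoc, mul_assoc, smul_comm]

lemma D_mul_Dinv : action d A σ (e .D) * action d A σ (e .Dinv) = 1 := by
  rw [← map_mul, ← map_one (action d A σ)]
  refine map_eq_of_scaled ((ExtendsBase.gen (by simp [IsCartan])).mul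
    (ExtendsBase.gen (by simp [IsCartan]))) .one (hσ .D_Dinv) 1 (fun a => ?_) (fun a => by simp)
  rw [map_mul, scaled_mul (action_D_mul_letter σ a) (action_Dinv_mul_letter σ a),
    ← zpow_add₀ qq_ne_zero, add_neg_cancel, zpow_zero, Pi.one_apply]

lemma Dinv_mul_D : action d A σ (e .Dinv) * action d A σ (e .D) = 1 := by
  rw [← map_mul, ← map_one (action d A σ)]
  refine map_eq_of_scaled ((ExtendsBase.gen (by simp [IsCartan])).mul
    (ExtendsBase.gen (by simp [IsCartan]))) .one (hσ .Dinv_D) 1 (fun a => ?_) (fun a => by simp)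
  rw [map_mul, scaled_mul (action_Dinv_mul_letter σ a) (action_D_mul_letter σ a),
    ← zpow_add₀ qq_ne_zero, neg_add_cancel, zpow_zero, Pi.one_apply]

lemma K_mul_Kinv (i : Fin N) : action d A σ (e (.K i)) * action d A σ (e (.Kinv i)) = 1 := by
  rw [← map_mul, ← map_one (action d A σ)]
  refine map_eq_of_scaled ((ExtendsBase.gen (by simp [IsCartan])).mul
    (ExtendsBase.gen (by simp [IsCartan]))) .one (hσ (.K_Kinv i)) 1 (fun a => ?_)
    (fun a => by simp)
  rw [map_mul, scaled_mul (action_K_mul_letter σ i a) (action_Kinv_mul_letter σ i a),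
    inv_mul_cancel₀ (qp_ne_zero i a.1), Pi.one_apply]

lemma Kinv_mul_K (i : Fin N) : action d A σ (e (.Kinv i)) * action d A σ (e (.K i)) = 1 := by
  rw [← map_mul, ← map_one (action d A σ)]
  refine map_eq_of_scaled ((ExtendsBase.gen (by simp [IsCartan])).mul
    (ExtendsBase.gen (by simp [IsCartan]))) .one (hσ (.Kinv_K i)) 1 (fun a => ?_)
    (fun a => by simp)
  rw [map_mul, scaled_mul (action_Kinv_mul_letter σ i a) (action_K_mul_letter σ i a),
    mul_inv_cancel₀ (qp_ne_zero i a.1), Pi.one_apply]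

lemma commute_K_h (i j : Fin N) (s : ℤ) :
    action d A σ (e (.K i) * e (.h j s)) = action d A σ (e (.h j s) * e (.K i)) := by
  refine map_eq_of_extendsBase ((ExtendsBase.gen (by simp [IsCartan])).mul
    (.gen (by simp [IsCartan]))) ((ExtendsBase.gen (by simp [IsCartan])).mul
    (.gen (by simp [IsCartan]))) (hσ (.K_comm_h i j s)) (fun a => (qp d A i a.1)⁻¹) fun a => ?_
  have h1 := mul_dressed (commute_g2_gen hσ (.K i)) (action_K_mul_letter σ i (a.1, s + a.2))
    (-((s : Fq)⁻¹ * qint d j (s * A j a.1))) |s|.toNat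
  simp only [map_mul]
  rw [mul_assoc, action_h_mul_letter, mul_assoc, action_K_mul_letter, mul_add, h1,
    mul_smul_comm, ← mul_assoc, action_K_mul_letter, ← mul_assoc (action d A σ (e (.h j s))),
    action_h_mul_letter, add_mul, smul_mul_assoc]
  simp only [mul_assoc, smul_add]
  abel

lemma D_mul_h_mul_Dinv (i : Fin N) (s : ℤ) :
    action d A σ (e .D * e (.h i s) * e .Dinv) = action d A σ ((qq ^ s : Fq) • e (.h i s)) := by
  refine map_eq_of_extendsBase (((ExtendsBase.gen (by simp [IsCartan])).mul
    (.gen (by simp [IsCartan]))).mul (.gen (by simp [IsCartan])))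
    ((ExtendsBase.gen (by simp [IsCartan])).smul _) (hσ (.D_h i s)) 1 fun a => ?_
  have h1 := mul_dressed (commute_g2_gen hσ .D) (action_D_mul_letter σ (a.1, s + a.2))
    (-((s : Fq)⁻¹ * qint d i (s * A i a.1))) |s|.toNat
  have h2 : (qq ^ (-a.2) * qq ^ a.2 : Fq) = 1 := by
    rw [← zpow_add₀ qq_ne_zero, neg_add_cancel, zpow_zero]
  have h3 : (qq ^ (-a.2) * qq ^ (s + a.2) : Fq) = qq ^ s := by
    rw [← zpow_add₀ qq_ne_zero]
    congr 1
    ring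
  simp only [map_mul, map_smul]
  rw [mul_assoc, action_Dinv_mul_letter, mul_smul_comm, mul_assoc, ← mul_assoc _ (letter _ _ _),
    action_h_mul_letter, add_mul, mul_add, ← mul_assoc _ (_ • _) (action d A σ (e .Dinv)), h1,
    smul_mul_assoc, mul_assoc _ (action d A σ (e .D)) (action d A σ (e .Dinv)), D_mul_Dinv hσ,
    mul_one, ← mul_assoc _ _ (action d A σ (e .Dinv)),
    ← mul_assoc _ (letter _ _ _), action_D_mul_letter, smul_add, smul_smul, h3, smul_mul_assoc,
    smul_mul_assoc, smul_smul, h2, smul_mul_assoc, action_h_mul_letter]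
  simp only [mul_assoc, Pi.one_apply, one_smul, smul_add, mul_smul_comm]
  abel

lemma commutator_h_h (i j : Fin N) {k l : ℤ} (hk : k ≠ 0) (hl : l ≠ 0) :
    action d A σ (e (.h i k) * e (.h j l) - e (.h j l) * e (.h i k)) =
      action d A σ (if l = -k then
          ((k : Fq)⁻¹ * qint d i (k * A i j) * (qi d j - (qi d j)⁻¹)⁻¹) •
            (gammaPow k - gammaPow (-k))
         else 0) := by
  have hpow : ∀ (x : Gen N) (hx : IsCartan x) (a : Fin N × ℤ) (n : ℕ)
      (h : Commute (action d A σ (e x)) (letter Fq S a)),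
      Commute (action d A σ (e x ^ n)) (letter Fq S a) := fun x hx a n h => by
    rw [map_pow]; exact h.pow_left n
  have hγ : ∀ m a, Commute (action d A σ (gammaHalf m)) (letter Fq S a) := by
    intro m a
    rw [gammaHalf]
    split_ifs
    · exact hpow _ (by simp [IsCartan]) _ _ (action_g2_mul_letter σ a)
    · exact hpow _ (by simp [IsCartan]) _ _ (action_g2inv_mul_letter σ a)
  refine map_eq_of_extendsBase (.sub (.mul (.gen (by simp [IsCartan]))
    (.gen (by simp [IsCartan]))) (.mul (.gen (by simp [IsCartan])) (.gen (by simp [IsCartan]))))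
    ?_ (hσ (.h_h i j k l hk hl)) 1 fun a => ?_
  · split_ifs
    · exact ((ExtendsBase.gammaHalf _).sub (.gammaHalf _)).smul _
    · intro s; simp
  · have hR : action d A σ (if l = -k then
          ((k : Fq)⁻¹ * qint d i (k * A i j) * (qi d j - (qi d j)⁻¹)⁻¹) •
            (gammaPow k - gammaPow (-k))
         else 0) * letter Fq S a = letter Fq S a * action d A σ (if l = -k then
          ((k : Fq)⁻¹ * qint d i (k * A i j) * (qi d j - (qi d j)⁻¹)⁻¹) •
            (gammaPow k - gammaPow (-k))
         else 0) := by
      split_ifs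
      · rw [map_smul, map_sub, smul_mul_assoc, mul_smul_comm, sub_mul, mul_sub, gammaPow, gammaPow,
          (hγ _ a).eq, (hγ _ a).eq]
      · rw [map_zero, zero_mul, mul_zero]
    rw [Pi.one_apply, one_smul, one_smul, hR, sub_self, map_sub, map_mul, map_mul]
    have hS : ∀ (i : Fin N) (k : ℤ) (c : Fq) (n : ℕ) (b : ℤ), action d A σ (e (.h i k)) *
        (c • (action d A σ (e .g2) ^ n * letter Fq S (a.1, b))) =
        (c • (action d A σ (e .g2) ^ n * letter Fq S (a.1, b))) * action d A σ (e (.h i k)) +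
        (c * (-((k : Fq)⁻¹ * qint d i (k * A i a.1)))) • (action d A σ (e .g2) ^ (n + |k|.toNat) *
          letter Fq S (a.1, k + b)) := by
      intro i k c n b
      rw [mul_smul_comm, ← mul_assoc, ← ((commute_g2_gen hσ (.h i k)).pow_left n).eq, mul_assoc,
        action_h_mul_letter, mul_add, smul_add, mul_smul_comm, smul_smul, ← mul_assoc _ (_ ^ _),
        ← pow_add, smul_mul_assoc, mul_assoc]
    have hT : ∀ (i j : Fin N) (k l : ℤ), action d A σ (e (.h i k)) * action d A σ (e (.h j l)) *
        letter Fq S a = letter Fq S a * (action d A σ (e (.h i k)) * action d A σ (e (.h j l))) +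
        (-((k : Fq)⁻¹ * qint d i (k * A i a.1))) •
          (action d A σ (e .g2) ^ |k|.toNat * letter Fq S (a.1, k + a.2)) *
            action d A σ (e (.h j l)) +
        (-((l : Fq)⁻¹ * qint d j (l * A j a.1))) •
          (action d A σ (e .g2) ^ |l|.toNat * letter Fq S (a.1, l + a.2)) *
            action d A σ (e (.h i k)) +
        ((-((l : Fq)⁻¹ * qint d j (l * A j a.1))) * (-((k : Fq)⁻¹ * qint d i (k * A i a.1)))) •
          (action d A σ (e .g2) ^ (|l|.toNat + |k|.toNat) * letter Fq S (a.1, k + (l + a.2))) := by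
      intro i j k l
      rw [mul_assoc, action_h_mul_letter, mul_add, hS, ← mul_assoc, action_h_mul_letter, add_mul,
        mul_assoc]
      abel
    rw [sub_mul, hT, hT, add_comm |k|.toNat, add_left_comm l, mul_comm (-((k : Fq)⁻¹ * _)), mul_sub]
    abel

lemma respects_cartan : Respects (CartanRel N d A) (action d A σ) := by
  intro a b hab
  cases hab with
  | K_Kinv i => rw [map_mul, map_one, K_mul_Kinv hσ]
  | Kinv_K i => rw [map_mul, map_one, Kinv_mul_K hσ]
  | D_Dinv => rw [map_mul, map_one, D_mul_Dinv hσ]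
  | Dinv_D => rw [map_mul, map_one, Dinv_mul_D hσ]
  | g_ginv => rw [map_mul, map_one, g2_mul_g2inv hσ]
  | ginv_g => rw [map_mul, map_one, g2inv_mul_g2 hσ]
  | g2_comm x => rw [map_mul, map_mul, commute_g2_gen hσ]
  | g2inv_comm x => rw [map_mul, map_mul, commute_g2inv_gen hσ]
  | K_comm_K i j =>
    refine map_eq_of_scaled ((ExtendsBase.gen (by simp [IsCartan])).mul
      (.gen (by simp [IsCartan]))) ((ExtendsBase.gen (by simp [IsCartan])).mul
      (.gen (by simp [IsCartan]))) (hσ (.K_comm_K i j))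
      (fun a => (qp d A i a.1)⁻¹ * (qp d A j a.1)⁻¹) (fun a => ?_) fun a => ?_
    · rw [map_mul, scaled_mul (action_K_mul_letter σ i a) (action_K_mul_letter σ j a)]
    · rw [map_mul, scaled_mul (action_K_mul_letter σ j a) (action_K_mul_letter σ i a), mul_comm _⁻¹]
  | K_comm_D i =>
    refine map_eq_of_scaled ((ExtendsBase.gen (by simp [IsCartan])).mul
      (.gen (by simp [IsCartan]))) ((ExtendsBase.gen (by simp [IsCartan])).mul
      (.gen (by simp [IsCartan]))) (hσ (.K_comm_D i))
      (fun a => (qp d A i a.1)⁻¹ * qq ^ a.2) (fun a => ?_) fun a => ?_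
    · rw [map_mul, scaled_mul (action_K_mul_letter σ i a) (action_D_mul_letter σ a)]
    · rw [map_mul, scaled_mul (action_D_mul_letter σ a) (action_K_mul_letter σ i a), mul_comm (qq ^ _)]
  | K_comm_h i j s => exact commute_K_h hσ i j s
  | h_zero i =>
    rw [map_zero]
    refine eq_zero_of_mul_letter (fun s => ?_) 1 fun a => ?_
    · rw [action_base σ (by simp [IsCartan]), hσ (.h_zero i), map_zero, LinearMap.zero_apply,
        map_zero]
    · rw [action_h_mul_letter]
      simp
  | D_h i s => exact D_mul_h_mul_Dinv hσ i s
  | h_h i j k l hk hl => exact commutator_h_h hσ i j hk hl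

end InducedModule

end InducedModuleCartan

section InducedModuleBase

namespace Respects

open InducedModule

variable {d A} {R : Type*} [Ring R] [Algebra Fq R] {ρ : FA N →ₐ[Fq] R}
variable (hρ : Respects (CartanRel N d A) ρ)
include hρ

lemma commute_K_crossTerm (i j : Fin N) (k : ℤ) (a : Fin N × ℤ) :
    Commute (ρ (e (.K i))) (ρ (crossTerm d j k a)) := by
  rw [crossTerm]
  split_ifs
  · rw [map_smul, map_sub, map_mul, map_mul]
    exact (((hρ.commute_gammaHalf _ _).symm.mul_right (hρ.commute_K_psiEl i j _)).sub_right
      ((hρ.commute_gammaHalf _ _).symm.mul_right (hρ.commute_K_phiEl i j _))).smul_right _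
  · rw [map_zero]; exact Commute.zero_right _

lemma D_mul_crossTerm (j : Fin N) (k : ℤ) (a : Fin N × ℤ) :
    ρ (e .D) * ρ (crossTerm d j k a) = (qq ^ (k + a.2) : Fq) • (ρ (crossTerm d j k a) * ρ (e .D)) := by
  have h1 : ∀ m (u : FA N), ρ (e .D) * ρ u = (qq ^ (k + a.2) : Fq) • (ρ u * ρ (e .D)) →
      ρ (e .D) * (ρ (gammaHalf m) * ρ u) =
        (qq ^ (k + a.2) : Fq) • (ρ (gammaHalf m) * ρ u * ρ (e .D)) := by
    intro m u hu
    rw [← mul_assoc, ← (hρ.commute_gammaHalf m _).eq, mul_assoc, hu, mul_smul_comm, mul_assoc]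
  rw [crossTerm]
  split_ifs
  · rw [map_smul, map_sub, map_mul, map_mul, mul_smul_comm, smul_mul_assoc, mul_sub,
      h1 _ _ (hρ.D_mul_psiEl j _), h1 _ _ (hρ.D_mul_phiEl j _), ← smul_sub, sub_mul, smul_comm]
  · rw [map_zero, mul_zero, zero_mul, smul_zero]

lemma commutator_h_crossTerm (hd : ∀ i, 0 < d i) (i j : Fin N) {k : ℤ} (hk : k ≠ 0) (l : ℤ)
    (a : Fin N × ℤ) :
    ρ (e (.h i k)) * ρ (crossTerm d j l a) - ρ (crossTerm d j l a) * ρ (e (.h i k)) =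
      ((k : Fq)⁻¹ * qint d i (k * A i j)) •
          (((hρ.gUnit ^ (-|k|) : Rˣ) : R) * ρ (crossTerm d j (k + l) a)) -
        ((k : Fq)⁻¹ * qint d i (k * A i j)) •
          (((hρ.gUnit ^ |k| : Rˣ) : R) * ρ (crossTerm d j l (a.1, k + a.2))) := by
  simp only [crossTerm]
  split_ifs with hj
  swap
  · simp
  have hu := fun m => hρ.commute_gUnit_zpow m (e (.h i k))
  have hcomm : ∀ (m : ℤ) (x y : R) (hx : Commute ((hρ.gUnit ^ m : Rˣ) : R) x),
      x * (((hρ.gUnit ^ m : Rˣ) : R) * y) - ((hρ.gUnit ^ m : Rˣ) : R) * y * x =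
        ((hρ.gUnit ^ m : Rˣ) : R) * (x * y - y * x) := by
    intro m x y hx
    rw [← mul_assoc, ← hx.eq, mul_sub, mul_assoc, mul_assoc]
  have hmul : ∀ (m n : ℤ) (y : R), ((hρ.gUnit ^ m : Rˣ) : R) * (((hρ.gUnit ^ n : Rˣ) : R) * y) =
      ((hρ.gUnit ^ (m + n) : Rˣ) : R) * y := by
    intro m n y
    rw [← mul_assoc, ← Units.val_mul, ← zpow_add]
  have hlhs : ∀ (c : Fq) (x y z : R), x * (c • (y - z)) - (c • (y - z)) * x =
      c • ((x * y - y * x) - (x * z - z * x)) := by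
    intro c x y z
    rw [mul_smul_comm, smul_mul_assoc, ← smul_sub]
    congr 1
    noncomm_ring
  simp only [map_smul, map_sub, map_mul, hρ.map_gammaHalf]
  rw [hlhs, hcomm _ _ _ (hu _), hcomm _ _ _ (hu _), hρ.commutator_h_psiEl hd i j hk,
    hρ.commutator_h_phiEl hd i j hk]
  rw [mul_smul_comm, mul_smul_comm, smul_comm _ (qi d j - (qi d j)⁻¹)⁻¹,
    smul_comm _ (qi d j - (qi d j)⁻¹)⁻¹, ← smul_sub]
  congr 1
  rw [mul_sub, mul_sub, hmul, hmul, hmul, hmul, show k + l + a.2 = l + a.2 + k by ring,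
    show l + (k + a.2) = l + a.2 + k by ring]
  rcases lt_or_gt_of_ne hk with hk' | hk'
  · rw [if_pos hk', if_neg hk'.le.not_gt, mul_zero, sub_zero, mul_smul_comm, sub_mul, mul_sub, hmul,
      hmul, abs_of_neg hk', ← smul_sub]
    congr 1
    rw [show - -k + (k + l - a.2) = l - a.2 + 2 * k by ring,
      show -k + (l - (k + a.2)) = l - a.2 + -(2 * k) by ring,
      show - -k + (a.2 - (k + l)) = -k + (k + a.2 - l) by ring]
    abel
  · rw [if_pos hk', if_neg hk'.le.not_gt, mul_zero, zero_sub, mul_smul_comm, sub_mul, mul_sub, hmul,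
      hmul, abs_of_pos hk', ← smul_sub, neg_smul, neg_neg]
    congr 1
    rw [show -k + (k + l - a.2) = k + (l - (k + a.2)) by ring,
      show k + (k + a.2 - l) = a.2 - l + 2 * k by ring,
      show -k + (a.2 - (k + l)) = a.2 - l + -(2 * k) by ring]
    abel

end Respects

namespace InducedModule

open WordModule

variable {S : Type*} [AddCommGroup S] [Module Fq S] {σ : FA N →ₐ[Fq] Module.End Fq S}
variable {d A}
variable (hσ : Respects (CartanRel N d A) σ)
include hσ

lemma K_mul_xp_mul_Kinv (i j : Fin N) (r : ℤ) :
    action d A σ (e (.K i)) * action d A σ (e (.xp j r)) * action d A σ (e (.Kinv i)) =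
      qp d A i j • action d A σ (e (.xp j r)) := by
  refine eq_of_mul_letter (fun s => ?_) 1 fun a => ?_
  · rw [Module.End.mul_apply, Module.End.mul_apply, action_base σ (by simp [IsCartan]),
      action_xp_base, map_zero, LinearMap.smul_apply, action_xp_base, smul_zero]
  · have h1 := (respects_cartan hσ).commute_K_crossTerm i j r a
    have h2 : qp d A i a.1 • action d A σ (crossTerm d j r a) =
        qp d A i j • action d A σ (crossTerm d j r a) := by
      by_cases hj : j = a.1
      · rw [hj]
      · rw [crossTerm, if_neg hj, map_zero, smul_zero, smul_zero]
    rw [mul_assoc, action_Kinv_mul_letter, mul_smul_comm, mul_assoc,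
      ← mul_assoc _ (letter _ _ _), action_xp_mul_letter, add_mul, mul_add,
      ← mul_assoc _ (action d A σ (crossTerm d j r a)), h1.eq, mul_assoc _ (action d A σ (e (.K i))),
      K_mul_Kinv hσ, mul_one, smul_add, h2, mul_assoc (letter _ _ _), ← mul_assoc _ (letter _ _ _),
      action_K_mul_letter, smul_mul_assoc, smul_smul, mul_inv_cancel₀ (qp_ne_zero i a.1), one_smul,
      smul_mul_assoc, action_xp_mul_letter]
    simp only [Pi.one_apply, one_smul, smul_add, mul_smul_comm, mul_assoc]
    abel

lemma D_mul_xp_mul_Dinv (j : Fin N) (r : ℤ) :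
    action d A σ (e .D) * action d A σ (e (.xp j r)) * action d A σ (e .Dinv) =
      (qq ^ r : Fq) • action d A σ (e (.xp j r)) := by
  refine eq_of_mul_letter (fun s => ?_) 1 fun a => ?_
  · rw [Module.End.mul_apply, Module.End.mul_apply, action_base σ (by simp [IsCartan]),
      action_xp_base, map_zero, LinearMap.smul_apply, action_xp_base, smul_zero]
  · have h1 := (respects_cartan hσ).D_mul_crossTerm j r a
    have h2 : (qq ^ (-a.2) * qq ^ (r + a.2) : Fq) = qq ^ r := by
      rw [← zpow_add₀ qq_ne_zero]
      congr 1
      ring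
    have h3 : (qq ^ (-a.2) * qq ^ a.2 : Fq) = 1 := by
      rw [← zpow_add₀ qq_ne_zero, neg_add_cancel, zpow_zero]
    rw [mul_assoc, action_Dinv_mul_letter, mul_smul_comm, mul_assoc,
      ← mul_assoc _ (letter _ _ _), action_xp_mul_letter, add_mul, mul_add,
      ← mul_assoc _ (action d A σ (crossTerm d j r a)), h1, smul_mul_assoc,
      mul_assoc _ (action d A σ (e .D)),
      D_mul_Dinv hσ, mul_one, smul_add, smul_smul, h2, mul_assoc (letter _ _ _),
      ← mul_assoc _ (letter _ _ _),
      action_D_mul_letter, smul_mul_assoc, smul_smul, h3, one_smul,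
      smul_mul_assoc, action_xp_mul_letter]
    simp only [Pi.one_apply, one_smul, smul_add, mul_smul_comm, mul_assoc]
    abel

lemma commutator_h_xp (hd : ∀ i, 0 < d i) (i j : Fin N) {k : ℤ} (hk : k ≠ 0) (l : ℤ) :
    action d A σ (e (.h i k)) * action d A σ (e (.xp j l)) -
        action d A σ (e (.xp j l)) * action d A σ (e (.h i k)) =
      ((k : Fq)⁻¹ * qint d i (k * A i j)) •
        (action d A σ (gammaHalf (-|k|)) * action d A σ (e (.xp j (k + l)))) := by
  refine eq_of_mul_letter (fun s => ?_) 1 fun a => ?_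
  · rw [LinearMap.sub_apply, Module.End.mul_apply, Module.End.mul_apply,
      action_xp_base, action_base (x := .h i k) σ (by simp [IsCartan]), action_xp_base, map_zero,
      sub_zero, LinearMap.smul_apply, Module.End.mul_apply, action_xp_base, map_zero, smul_zero]
  · have hC := respects_cartan hσ
    have h1 := hC.commutator_h_crossTerm hd i j hk l a
    have h2 : (-((k : Fq)⁻¹ * qint d i (k * A i a.1))) • (action d A σ (e .g2) ^ |k|.toNat *
        action d A σ (crossTerm d j l (a.1, k + a.2))) =
        -(((k : Fq)⁻¹ * qint d i (k * A i j)) • (action d A σ (e .g2) ^ |k|.toNat *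
        action d A σ (crossTerm d j l (a.1, k + a.2)))) := by
      by_cases hj : j = a.1
      · rw [hj]
        exact neg_smul (M := Module.End Fq (Space N S)) _ _
      · rw [crossTerm, if_neg (by simpa using hj), map_zero, mul_zero, smul_zero, smul_zero, neg_zero]
    have hg : ((hC.gUnit ^ |k| : (Module.End Fq (Space N S))ˣ) : Module.End Fq (Space N S)) =
        action d A σ (e .g2) ^ |k|.toNat := by
      rw [← hC.map_gammaHalf, gammaHalf, if_pos (abs_nonneg k), map_pow]
    rw [hg] at h1
    have hgl : Commute (action d A σ (gammaHalf (-|k|))) (letter Fq S a) := by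
      rw [← Prod.mk.eta (p := a), ← action_xm]
      exact hC.commute_gammaHalf _ _
    have h3 : action d A σ (e (.xp j l)) * ((-((k : Fq)⁻¹ * qint d i (k * A i a.1))) •
        (action d A σ (e .g2) ^ |k|.toNat * letter Fq S (a.1, k + a.2))) =
        ((-((k : Fq)⁻¹ * qint d i (k * A i a.1))) •
        (action d A σ (e .g2) ^ |k|.toNat * letter Fq S (a.1, k + a.2))) *
          action d A σ (e (.xp j l)) - (((k : Fq)⁻¹ * qint d i (k * A i j)) •
          (action d A σ (e .g2) ^ |k|.toNat *
        action d A σ (crossTerm d j l (a.1, k + a.2)))) := by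
      rw [sub_eq_add_neg, ← h2, mul_smul_comm, ← mul_assoc,
        ← ((commute_g2_gen hσ (.xp j l)).pow_left _).eq, mul_assoc, action_xp_mul_letter, mul_add,
        smul_add, smul_mul_assoc, mul_assoc]
    rw [Pi.one_apply, one_smul, one_smul, sub_mul, mul_assoc _ _ (letter _ _ _),
      action_xp_mul_letter, mul_add, ← mul_assoc _ (letter _ _ _), action_h_mul_letter, add_mul,
      mul_assoc _ _ (letter _ _ _), action_h_mul_letter, mul_add, h3, ← mul_assoc _ (letter _ _ _),
      action_xp_mul_letter, add_mul, smul_mul_assoc _ _ (letter _ _ _), mul_assoc _ _ (letter _ _ _),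
      action_xp_mul_letter, mul_add, ← mul_assoc _ (letter _ _ _), hgl.eq, smul_add, mul_smul_comm,
      mul_sub]
    rw [← hC.map_gammaHalf] at h1
    rw [sub_eq_iff_eq_add] at h1
    rw [h1]
    simp only [mul_assoc]
    abel

lemma respects_base (hd : ∀ i, 0 < d i) : Respects (BaseRel N d A) (action d A σ) := by
  have hC := respects_cartan hσ
  intro a b hab
  cases hab with
  | cartan hab => exact hC hab
  | D_xp i r => rw [map_mul, map_mul, map_smul, D_mul_xp_mul_Dinv hσ]
  | D_xm i r =>
    rw [map_mul, map_mul, map_smul, action_xm, action_D_mul_letter, smul_mul_assoc, mul_assoc,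
      D_mul_Dinv hσ, mul_one]
  | K_xp i j r => rw [map_mul, map_mul, map_smul, K_mul_xp_mul_Kinv hσ]
  | K_xm i j r =>
    rw [map_mul, map_mul, map_smul, action_xm, action_K_mul_letter, smul_mul_assoc, mul_assoc,
      K_mul_Kinv hσ, mul_one]
  | h_xp i j k l hk => rw [map_sub, map_mul, map_mul, map_smul, map_mul, commutator_h_xp hσ hd i j hk]
  | h_xm i j k l hk =>
    rw [map_sub, map_mul, map_mul, map_smul, map_mul, action_xm, action_h_mul_letter,
      add_sub_cancel_left, action_xm, gammaHalf, if_pos (abs_nonneg k), map_pow]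
  | xp_xm i j k l =>
    rw [map_sub, map_mul, map_mul, action_xm, action_xp_mul_letter, add_sub_cancel_left]
    rfl

lemma action_quadEl_true (hd : ∀ i, 0 < d i) (hsym : ∀ i j, d i * A i j = d j * A j i)
    (i j : Fin N) (k l : ℤ) : action d A σ (quadEl d A true i j k l) = 0 := by
  refine eq_zero_of_mul_letter (fun s => ?_) 1 fun a => ?_
  · simp only [quadEl, map_sub, map_mul, map_smul, LinearMap.sub_apply, LinearMap.smul_apply,
      Module.End.mul_apply, action_xp_base, map_zero, smul_zero, sub_zero]
  · rw [Pi.one_apply, one_smul, ← Prod.mk.eta (p := a), ← action_xm]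
    exact ((respects_base hσ hd).commute_quadEl hd hsym true a.1 a.2 i j k l).eq.symm

lemma action_serreEl_true (hd : ∀ i, 0 < d i) (hsym : ∀ i j, d i * A i j = d j * A j i)
    (hdiag : ∀ i, A i i = 2) (hoff : ∀ i j, i ≠ j → A i j ≤ 0) {i j : Fin N} (hij : i ≠ j)
    (ks : Fin (1 - A i j).toNat → ℤ) (l : ℤ) :
    action d A σ (serreEl d true i j (1 - A i j).toNat ks l) = 0 := by
  refine eq_zero_of_mul_letter (fun s => ?_) 1 fun a => ?_
  · have h1 : ∀ t : List (Module.End Fq (Space N S)), (∀ T ∈ t, T (base Fq _ S s) = 0) →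
        t.prod (base Fq _ S s) = 0 ∨ t.prod = 1 := by
      intro t ht
      induction t with
      | nil => exact Or.inr rfl
      | cons T t ih =>
        left
        rw [List.prod_cons, Module.End.mul_apply]
        rcases ih fun T' hT' => ht T' (List.mem_cons_of_mem _ hT') with h | h
        · rw [h, map_zero]
        · rw [h, Module.End.one_apply, ht T List.mem_cons_self]
    rw [map_serreEl (hd i)]
    simp only [LinearMap.sum_apply, LinearMap.smul_apply, insertProd, Module.End.mul_apply,
      if_true]
    refine Finset.sum_eq_zero fun τ _ => Finset.sum_eq_zero fun r _ => ?_
    rcases h1 (((List.finRange _).drop r).map fun t => action d A σ (e (.xp i (ks (τ t)))))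
      (fun T hT => by
        obtain ⟨t, -, rfl⟩ := List.mem_map.1 hT
        exact action_xp_base σ i _ s) with h | h
    · rw [h, map_zero, map_zero, smul_zero]
    · rw [h, Module.End.one_apply, action_xp_base, map_zero, smul_zero]
  · rw [Pi.one_apply, one_smul, ← Prod.mk.eta (p := a), ← action_xm]
    exact ((respects_base hσ hd).commute_serreEl hd hsym hdiag hoff true
      (action_quadEl_true hσ hd hsym) a.1 a.2 hij ks l).eq.symm

end InducedModule

end InducedModuleBase

section FockSpace

variable {d A}

lemma respects_mkAlgHom : Respects (BaseRel N d A) (RingQuot.mkAlgHom Fq (QRel N d A)) :=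
  fun _ _ hab => RingQuot.mkAlgHom_rel Fq hab.toQRel

lemma G_eq (x : Gen N) : G d A x = RingQuot.mkAlgHom Fq (QRel N d A) (e x) := rfl

namespace FockSpace

open InducedModule WordModule

variable (N d A) in
/-- The center of the quantum affine algebra. -/
abbrev Center : Subalgebra Fq (Uq N d A) := Subalgebra.center Fq (Uq N d A)

lemma commute_gen_of_central {x : Gen N} (h : ∀ y : Gen N, Commute (G d A x) (G d A y))
    (b : Uq N d A) : Commute (G d A x) b := by
  obtain ⟨u, rfl⟩ := RingQuot.mkAlgHom_surjective Fq (QRel N d A) b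
  induction u using FreeAlgebra.induction with
  | grade0 r => rw [AlgHom.commutes]; exact (Algebra.commutes r _).symm
  | grade1 y => exact h y
  | mul a b ha hb => rw [map_mul]; exact ha.mul_right hb
  | add a b ha hb => rw [map_add]; exact ha.add_right hb

lemma commute_g2 (b : Uq N d A) : Commute (G d A .g2) b :=
  commute_gen_of_central (fun y => by
    have h := respects_mkAlgHom (d := d) (A := A) (.cartan (.g2_comm y))
    rwa [map_mul, map_mul] at h) b

lemma commute_g2inv (b : Uq N d A) : Commute (G d A .g2inv) b :=
  commute_gen_of_central (fun y => by
    have h := respects_mkAlgHom (d := d) (A := A) (.cartan (.g2inv_comm y))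
    rwa [map_mul, map_mul] at h) b

lemma g2_mul_g2inv : G d A .g2 * G d A .g2inv = 1 := by
  have h := respects_mkAlgHom (d := d) (A := A) (.cartan .g_ginv)
  rwa [map_mul, map_one] at h

variable (d A) in
/-- The central unit `γ^{1/2}`. -/
def centralUnit : (Center N d A)ˣ where
  val := ⟨G d A .g2, Subalgebra.mem_center_iff.2 fun b => (commute_g2 b).eq.symm⟩
  inv := ⟨G d A .g2inv, Subalgebra.mem_center_iff.2 fun b => (commute_g2inv b).eq.symm⟩
  val_inv := Subtype.ext g2_mul_g2inv
  inv_val := Subtype.ext ((commute_g2inv _).eq.trans g2_mul_g2inv)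

variable (N d A) in
/-- The inducing module. -/
abbrev Inducing : Type := HeisenbergModule N (Center N d A)

variable (d A) in
/-- The action on the Verma-type module with the `K_i` acting by `κ` on the vacuum. -/
def verma (κ : Fq) : FA N →ₐ[Fq] Module.End Fq (Space N (Inducing N d A)) :=
  InducedModule.action d A (HeisenbergModule.action d A (centralUnit d A) κ)

variable (d A) in
/-- The constant term, as an element of the quantum affine algebra. -/
def constantTerm : Inducing N d A →ₗ[Fq] Uq N d A :=
  (Center N d A).val.toLinearMap ∘ₗ
    (MvPolynomial.lcoeff (Center N d A) (0 : Fin N × ℕ →₀ ℕ)).restrictScalars Fq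

lemma constantTerm_apply (p : Inducing N d A) :
    constantTerm d A p = (MvPolynomial.constantCoeff p : Center N d A) := rfl

variable (d A) in
/-- The projection along the image of the Heisenberg creation operators. -/
def projection : Space N (Inducing N d A) →ₗ[Fq] Uq N d A :=
  Finsupp.lsum Fq fun w =>
    LinearMap.mulLeft Fq (w.map fun a => G d A (.xm a.1 a.2)).prod ∘ₗ constantTerm d A

variable (d A) in
/-- The vacuum vector. -/
def vacuum : Space N (Inducing N d A) := base Fq _ _ 1

lemma projection_single (w : List (Fin N × ℤ)) (p : Inducing N d A) :
    projection d A (Finsupp.single w p) =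
      (w.map fun a => G d A (.xm a.1 a.2)).prod * constantTerm d A p := by
  rw [projection, Finsupp.lsum_single]
  rfl

lemma projection_base (p : Inducing N d A) :
    projection d A (base Fq _ _ p) = constantTerm d A p := by
  rw [base, Finsupp.lsingle_apply, projection_single, List.map_nil, List.prod_nil, one_mul]

lemma projection_letter (a : Fin N × ℤ) (v : Space N (Inducing N d A)) :
    projection d A (letter Fq _ a v) = G d A (.xm a.1 a.2) * projection d A v := by
  rw [← LinearMap.comp_apply, ← LinearMap.mulLeft_apply Fq, ← LinearMap.comp_apply]
  congr 1
  refine Finsupp.lhom_ext fun w p => ?_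
  rw [LinearMap.comp_apply, LinearMap.comp_apply, letter_single, projection_single,
    projection_single, List.map_cons, List.prod_cons, LinearMap.mulLeft_apply, mul_assoc]

lemma projection_verma_xm (κ : Fq) (i : Fin N) (m : ℤ) (v : Space N (Inducing N d A)) :
    projection d A (verma d A κ (e (.xm i m)) v) = G d A (.xm i m) * projection d A v := by
  rw [verma, action_xm, projection_letter]

lemma projection_verma_g2 (κ : Fq) (v : Space N (Inducing N d A)) :
    projection d A (verma d A κ (e .g2) v) = G d A .g2 * projection d A v := by
  rw [← LinearMap.comp_apply, ← LinearMap.mulLeft_apply Fq, ← LinearMap.comp_apply]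
  congr 1
  refine Finsupp.lhom_ext fun w p => ?_
  induction w with
  | nil =>
    rw [LinearMap.comp_apply, LinearMap.comp_apply, LinearMap.mulLeft_apply,
      ← Finsupp.lsingle_apply (R := Fq) [] p]
    change projection d A (verma d A κ (e .g2) (base Fq _ _ p)) =
      G d A .g2 * projection d A (base Fq _ _ p)
    rw [verma, action_base _ (by simp [IsCartan]), projection_base, projection_base,
      HeisenbergModule.action_e]
    simp [HeisenbergModule.genOp, constantTerm_apply, MvPolynomial.smul_eq_C_mul, centralUnit]
  | cons a w ih =>
    rw [LinearMap.comp_apply, LinearMap.comp_apply, LinearMap.mulLeft_apply] at ih ⊢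
    rw [← letter_single (F := Fq), ← Module.End.mul_apply, verma, action_g2_mul_letter,
      Module.End.mul_apply, projection_letter, ← verma, ih, projection_letter, ← mul_assoc,
      ← (commute_g2 (d := d) (A := A) _).eq, mul_assoc]

variable (hsym : ∀ i j, d i * A i j = d j * A j i) {κ : Fq} (hκ : κ ≠ 0)
include hsym hκ

lemma respects_heisenberg : Respects (CartanRel N d A)
    (HeisenbergModule.action (Γ := Center N d A) d A (centralUnit d A) κ) :=
  HeisenbergModule.respects_action hsym _ hκ

lemma respects_verma (hd : ∀ i, 0 < d i) : Respects (BaseRel N d A) (verma d A κ) :=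
  respects_base (respects_heisenberg hsym hκ) hd

lemma projection_verma_g2inv (v : Space N (Inducing N d A)) :
    projection d A (verma d A κ (e .g2inv) v) = G d A .g2inv * projection d A v := by
  have h1 : verma d A κ (e .g2) * verma d A κ (e .g2inv) = 1 :=
    InducedModule.g2_mul_g2inv (respects_heisenberg hsym hκ)
  have h2 := projection_verma_g2 κ (verma d A κ (e .g2inv) v)
  rw [← Module.End.mul_apply, h1, Module.End.one_apply] at h2
  rw [h2, ← mul_assoc, (commute_g2inv _).eq, g2_mul_g2inv, one_mul]

omit hsym hκ in
lemma projection_vacuum : projection d A (vacuum d A) = 1 := by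
  rw [vacuum, projection_base, constantTerm_apply, map_one]
  rfl

omit hsym hκ in
lemma verma_K_vacuum (i : Fin N) : verma d A κ (e (.K i)) (vacuum d A) = κ • vacuum d A := by
  rw [verma, vacuum, action_base _ (by simp [IsCartan]), HeisenbergModule.action_e, ← map_smul]
  rfl

omit hsym hκ in
lemma extendsBase_Pneg {S : Type*} [AddCommGroup S] [Module Fq S]
    {σ : FA N →ₐ[Fq] Module.End Fq S} (i : Fin N) (n : ℕ) :
    ExtendsBase d A σ (Pneg d i n) := by
  induction n using Nat.strong_induction_on with
  | _ n ih =>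
    cases n with
    | zero => rw [Pneg]; exact .one
    | succ n =>
      rw [Pneg]
      refine .smul _ fun s => ?_
      rw [map_sum, map_sum, LinearMap.sum_apply, LinearMap.sum_apply, map_sum]
      exact Finset.sum_congr rfl fun l hl =>
        (((ExtendsBase.gen (by simp [IsCartan])).mul (ih _ (by omega))).smul _) s

omit hsym hκ in
lemma constantTerm_Pneg (i : Fin N) (n : ℕ) :
    constantTerm d A (HeisenbergModule.action d A (centralUnit d A) κ (Pneg d i n) 1) =
      if n = 0 then 1 else 0 := by
  cases n with
  | zero =>
    rw [Pneg, map_one (HeisenbergModule.action (Γ := Center N d A) d A (centralUnit d A) κ), if_pos rfl]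
    change constantTerm d A 1 = 1
    rw [constantTerm_apply, map_one]
    rfl
  | succ n =>
    rw [if_neg n.succ_ne_zero, Pneg, map_smul, map_sum, LinearMap.smul_apply, map_smul,
      LinearMap.sum_apply, map_sum, Finset.sum_eq_zero, smul_zero]
    intro l _
    rw [map_smul, map_mul, LinearMap.smul_apply, map_smul, Module.End.mul_apply,
      HeisenbergModule.action_e, HeisenbergModule.genOp, HeisenbergModule.hOp,
      if_neg (by omega), if_pos (by omega), constantTerm_apply, LinearMap.mulLeft_apply, map_mul,
      MvPolynomial.constantCoeff_X, zero_mul]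
    exact smul_zero _

omit hsym hκ in
lemma projection_verma_phiEl_vacuum (i : Fin N) (r : ℕ) :
    projection d A (verma d A κ (phiEl d i (-(r : ℤ))) (vacuum d A)) =
      if r = 0 then κ⁻¹ • 1 else 0 := by
  have h1 : (phiEl d i (-(r : ℤ)) : FA N) = e (.Kinv i) * Pneg d i r := by
    rw [phiEl, if_pos (by omega), neg_neg, Int.toNat_natCast]
  rw [h1, verma, vacuum, ((ExtendsBase.gen (by simp [IsCartan])).mul (extendsBase_Pneg i r)),
    projection_base, map_mul, Module.End.mul_apply, HeisenbergModule.action_e,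
    HeisenbergModule.genOp, LinearMap.smul_apply, map_smul, Module.End.one_apply, constantTerm_Pneg]
  split_ifs
  · rfl
  · exact smul_zero _

end FockSpace

end FockSpace

section Singular

/-- `u` and `x` commute up to a nonzero scalar. -/
def QCommute {R : Type*} [Ring R] [Algebra Fq R] (u : Rˣ) (x : R) : Prop :=
  ∃ p : Fq, p ≠ 0 ∧ (u : R) * x = p • (x * (u : R))

namespace QCommute

variable {R : Type*} [Ring R] [Algebra Fq R] {u : Rˣ} {x : R}

lemma of_commute (h : Commute (u : R) x) : QCommute u x := ⟨1, one_ne_zero, by rw [one_smul, h.eq]⟩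

lemma exists_conj (h : QCommute u x) : ∃ p : Fq, (u : R) * x * ((u⁻¹ : Rˣ) : R) = p • x := by
  obtain ⟨p, -, hp⟩ := h
  exact ⟨p, by rw [hp, smul_mul_assoc, mul_assoc, Units.mul_inv, mul_one]⟩

lemma inv (h : QCommute u x) : QCommute u⁻¹ x := by
  obtain ⟨p, hp0, hp⟩ := h
  refine ⟨p⁻¹, inv_ne_zero hp0, ?_⟩
  have h1 : x = p⁻¹ • ((u : R) * x * ((u⁻¹ : Rˣ) : R)) := by
    rw [hp, smul_mul_assoc, mul_assoc, Units.mul_inv, mul_one, smul_smul, inv_mul_cancel₀ hp0,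
      one_smul]
  conv_lhs => rw [h1]
  rw [mul_smul_comm, mul_assoc, Units.inv_mul_cancel_left]

lemma conj_mem_adjoin {s : Set R} (hs : ∀ y ∈ s, QCommute u y) {z : R}
    (hz : z ∈ Algebra.adjoin Fq s) :
    (u : R) * z * ((u⁻¹ : Rˣ) : R) ∈ Algebra.adjoin Fq s := by
  induction hz using Algebra.adjoin_induction with
  | mem y hy =>
    obtain ⟨p, hp⟩ := (hs y hy).exists_conj
    rw [hp]
    exact Subalgebra.smul_mem _ (Algebra.subset_adjoin hy) p
  | algebraMap r =>
    rw [← Algebra.commutes, mul_assoc, Units.mul_inv, mul_one]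
    exact Subalgebra.algebraMap_mem _ r
  | add y z _ _ hy hz => rw [mul_add, add_mul]; exact add_mem hy hz
  | mul y z _ _ hy hz =>
    have h1 : (u : R) * (y * z) * ((u⁻¹ : Rˣ) : R) =
        (u : R) * y * ((u⁻¹ : Rˣ) : R) * ((u : R) * z * ((u⁻¹ : Rˣ) : R)) := by
      simp only [mul_assoc, Units.inv_mul_cancel_left]
    rw [h1]
    exact mul_mem hy hz

lemma commute_conj (h : QCommute u x) {z : R} (hz : Commute z x) :
    Commute ((u : R) * z * ((u⁻¹ : Rˣ) : R)) x := by
  obtain ⟨p, hp⟩ := h.exists_conj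
  obtain ⟨p', hp'⟩ := h.inv.exists_conj
  rw [inv_inv] at hp'
  have h1 : x = (u : R) * (p' • x) * ((u⁻¹ : Rˣ) : R) := by
    rw [← hp']
    simp only [mul_assoc, Units.mul_inv_cancel_left, Units.mul_inv, mul_one]
  have h2 : Commute z (p' • x) := hz.smul_right p'
  rw [h1]
  change _ * _ = _ * _
  simp only [mul_assoc, Units.inv_mul_cancel_left]
  rw [← mul_assoc z, h2.eq, mul_assoc]

end QCommute

variable {d A} {R : Type*} [Ring R] [Algebra Fq R] {ρ : FA N →ₐ[Fq] R}

/-- The subalgebra generated by the images of `γ^{±1/2}` and of the `x^-_{i,l}`. -/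
def lowerPart (ρ : FA N →ₐ[Fq] R) : Subalgebra Fq R :=
  Algebra.adjoin Fq ({ρ (e g2), ρ (e g2inv)} ∪
    Set.range (fun p : Fin N × ℤ => ρ (e (xm p.1 p.2))))

lemma g2_mem_lowerPart : ρ (e g2) ∈ lowerPart ρ := Algebra.subset_adjoin (.inl (.inl rfl))

lemma g2inv_mem_lowerPart : ρ (e g2inv) ∈ lowerPart ρ := Algebra.subset_adjoin (.inl (.inr rfl))

lemma xm_mem_lowerPart (i : Fin N) (m : ℤ) : ρ (e (xm i m)) ∈ lowerPart ρ :=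
  Algebra.subset_adjoin (.inr ⟨(i, m), rfl⟩)

lemma gammaHalf_mem_lowerPart (m : ℤ) : ρ (gammaHalf m) ∈ lowerPart ρ := by
  rw [gammaHalf]
  split_ifs
  · rw [map_pow]; exact pow_mem g2_mem_lowerPart _
  · rw [map_pow]; exact pow_mem g2inv_mem_lowerPart _

lemma lowerPart_le_range : lowerPart ρ ≤ ρ.range := by
  refine Algebra.adjoin_le ?_
  rintro y ((rfl | rfl) | ⟨p, rfl⟩) <;> exact AlgHom.mem_range_self ρ _

/-- The elements of the lower part commuting with the images of the `x^+_{c,n}`. -/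
def IsSingular (ρ : FA N →ₐ[Fq] R) (t : R) : Prop :=
  t ∈ lowerPart ρ ∧ ∀ c n, Commute t (ρ (e (xp c n)))

namespace Respects

/-- The image of `D` as a unit. -/
def dUnit (hρ : Respects (CartanRel N d A) ρ) : Rˣ where
  val := ρ (e D)
  inv := ρ (e Dinv)
  val_inv := by rw [← map_mul, hρ .D_Dinv, map_one]
  inv_val := by rw [← map_mul, hρ .Dinv_D, map_one]

variable (hρ : Respects (BaseRel N d A) ρ)
include hρ

lemma qcommute_K_xm (i j : Fin N) (m : ℤ) : QCommute (hρ.cartan.kUnit i) (ρ (e (xm j m))) :=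
  ⟨_, inv_ne_zero (qp_ne_zero i j), hρ.K_mul_xm i j m⟩

lemma qcommute_K_xp (i j : Fin N) (m : ℤ) : QCommute (hρ.cartan.kUnit i) (ρ (e (xp j m))) :=
  ⟨_, qp_ne_zero i j, hρ.K_mul_xp i j m⟩

lemma qcommute_D_xm (j : Fin N) (m : ℤ) : QCommute hρ.cartan.dUnit (ρ (e (xm j m))) := by
  refine ⟨_, zpow_ne_zero m qq_ne_zero, ?_⟩
  have h1 := hρ (.D_xm j m)
  rw [map_mul, map_mul, map_smul] at h1
  exact mul_unit_conj hρ.cartan.Dinv_mul_D h1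

lemma qcommute_D_xp (j : Fin N) (m : ℤ) : QCommute hρ.cartan.dUnit (ρ (e (xp j m))) := by
  refine ⟨_, zpow_ne_zero m qq_ne_zero, ?_⟩
  have h1 := hρ (.D_xp j m)
  rw [map_mul, map_mul, map_smul] at h1
  exact mul_unit_conj hρ.cartan.Dinv_mul_D h1

lemma commute_g2 (u : FA N) : Commute (ρ (e g2)) (ρ u) := hρ.cartan.commute_gUnit u

lemma commute_g2inv (u : FA N) : Commute (ρ (e g2inv)) (ρ u) :=
  (hρ.cartan.commute_gUnit u).units_inv_left

lemma conj_mem_lowerPart {u : Rˣ} {w : FA N} (hu : (u : R) = ρ w)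
    (hxm : ∀ j m, QCommute u (ρ (e (xm j m)))) {z : R} (hz : z ∈ lowerPart ρ) :
    (u : R) * z * ((u⁻¹ : Rˣ) : R) ∈ lowerPart ρ := by
  refine QCommute.conj_mem_adjoin ?_ hz
  rintro y ((rfl | rfl) | ⟨p, rfl⟩)
  · exact .of_commute (hu ▸ (hρ.commute_g2 w).symm)
  · exact .of_commute (hu ▸ (hρ.commute_g2inv w).symm)
  · exact hxm _ _

lemma commutator_h_mem_lowerPart (i : Fin N) (s : ℤ) {z : R} (hz : z ∈ lowerPart ρ) :
    ρ (e (h i s)) * z - z * ρ (e (h i s)) ∈ lowerPart ρ := by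
  induction hz using Algebra.adjoin_induction with
  | mem y hy =>
    rcases hy with ((rfl | rfl) | ⟨p, rfl⟩)
    · rw [(hρ.commute_g2 _).eq, sub_self]; exact zero_mem _
    · rw [(hρ.commute_g2inv _).eq, sub_self]; exact zero_mem _
    · rcases eq_or_ne s 0 with rfl | hs
      · rw [hρ (.cartan (.h_zero i)), map_zero, zero_mul, mul_zero, sub_self]; exact zero_mem _
      · have h1 := hρ (.h_xm i p.1 s p.2 hs)
        rw [map_sub, map_mul, map_mul, map_smul, map_mul] at h1
        rw [h1]
        exact Subalgebra.smul_mem _ (mul_mem (gammaHalf_mem_lowerPart _) (xm_mem_lowerPart _ _)) _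
  | algebraMap r => rw [← Algebra.commutes, sub_self]; exact zero_mem _
  | add y z _ _ hy hz =>
    rw [mul_add, add_mul, add_sub_add_comm]; exact add_mem hy hz
  | mul y z hy' hz' hy hz =>
    have h1 : ρ (e (h i s)) * (y * z) - y * z * ρ (e (h i s)) =
        (ρ (e (h i s)) * y - y * ρ (e (h i s))) * z +
          y * (ρ (e (h i s)) * z - z * ρ (e (h i s))) := by noncomm_ring
    rw [h1]
    exact add_mem (mul_mem hy hz') (mul_mem hy' hz)

end Respects

namespace IsSingular

variable (hρ : Respects (BaseRel N d A) ρ)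
include hρ

lemma conj {t : R} (ht : IsSingular ρ t) {u : Rˣ} {w : FA N} (hu : (u : R) = ρ w)
    (hxm : ∀ j m, QCommute u (ρ (e (xm j m)))) (hxp : ∀ j m, QCommute u (ρ (e (xp j m)))) :
    IsSingular ρ ((u : R) * t * ((u⁻¹ : Rˣ) : R)) :=
  ⟨hρ.conj_mem_lowerPart hu hxm ht.1, fun c n => (hxp c n).commute_conj (ht.2 c n)⟩

lemma commutator_h {t : R} (ht : IsSingular ρ t) (i : Fin N) (s : ℤ) :
    IsSingular ρ (ρ (e (h i s)) * t - t * ρ (e (h i s))) := by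
  refine ⟨hρ.commutator_h_mem_lowerPart i s ht.1, fun c n => ?_⟩
  rcases eq_or_ne s 0 with rfl | hs
  · rw [hρ (.cartan (.h_zero i)), map_zero, zero_mul, mul_zero, sub_self]
    exact Commute.zero_left _
  · have h1 := hρ (.h_xp i c s n hs)
    rw [map_sub, map_mul, map_mul, map_smul, map_mul] at h1
    have h2 : Commute t (ρ (e (h i s)) * ρ (e (xp c n)) - ρ (e (xp c n)) * ρ (e (h i s))) := by
      rw [h1]
      refine Commute.smul_right (Commute.mul_right ?_ (ht.2 _ _)) _
      obtain ⟨u, rfl⟩ := lowerPart_le_range ht.1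
      exact (hρ.cartan.commute_gammaHalf _ u).symm
    have h4 := ht.2 c n
    unfold Commute SemiconjBy at h2 h4 ⊢
    linear_combination (norm := noncomm_ring) -h2 + ρ (e (h i s)) * h4 - h4 * ρ (e (h i s))

end IsSingular

end Singular

section Radical

namespace Radical

variable {V U : Type*} [AddCommGroup V] [Module Fq V] [AddCommGroup U] [Module Fq U]
variable (ρ : FA N →ₐ[Fq] Module.End Fq V) (Ξ : V →ₗ[Fq] U)

/-- The largest submodule contained in the kernel of `Ξ`. -/
def radical : Submodule Fq V := ⨅ u : FA N, LinearMap.ker (Ξ ∘ₗ ρ u)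

variable {ρ Ξ}

lemma mem_radical {v : V} : v ∈ radical ρ Ξ ↔ ∀ u, Ξ (ρ u v) = 0 := by
  simp [radical, Submodule.mem_iInf]

lemma radical_le_ker : radical ρ Ξ ≤ LinearMap.ker Ξ := fun v hv => by
  have h1 := mem_radical.1 hv 1
  rwa [map_one, Module.End.one_apply] at h1

lemma radical_le_comap (u : FA N) : radical ρ Ξ ≤ (radical ρ Ξ).comap (ρ u) := fun v hv => by
  refine mem_radical.2 fun w => ?_
  rw [← Module.End.mul_apply, ← map_mul]
  exact mem_radical.1 hv _

variable (ρ Ξ)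

/-- The action on the quotient by the radical. -/
def quotientAction : FA N →ₐ[Fq] Module.End Fq (V ⧸ radical ρ Ξ) :=
  FreeAlgebra.lift Fq fun x => (radical ρ Ξ).mapQ _ (ρ (e x)) (radical_le_comap _)

/-- The map induced by `Ξ` on the quotient. -/
def quotientForm : V ⧸ radical ρ Ξ →ₗ[Fq] U := (radical ρ Ξ).liftQ Ξ radical_le_ker

@[simp]
lemma quotientForm_mk (v : V) : quotientForm ρ Ξ (Submodule.Quotient.mk v) = Ξ v := rfl

@[simp]
lemma quotientAction_mk (u : FA N) (v : V) :
    quotientAction ρ Ξ u (Submodule.Quotient.mk v) = Submodule.Quotient.mk (ρ u v) := by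
  induction u using FreeAlgebra.induction generalizing v with
  | grade0 r => rw [AlgHom.commutes, AlgHom.commutes]; rfl
  | grade1 x => rw [quotientAction, FreeAlgebra.lift_ι_apply]; rfl
  | mul a b ha hb => rw [map_mul, map_mul, Module.End.mul_apply, hb, ha]; rfl
  | add a b ha hb => rw [map_add, map_add, LinearMap.add_apply, hb, ha]; rfl

variable {ρ Ξ}

lemma quotientAction_eq {a b : FA N} (h : ρ a = ρ b) :
    quotientAction ρ Ξ a = quotientAction ρ Ξ b := by
  refine LinearMap.ext fun v => ?_
  obtain ⟨v, rfl⟩ := Submodule.Quotient.mk_surjective _ v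
  rw [quotientAction_mk, quotientAction_mk, h]

lemma eq_zero_of_quotientForm {v : V ⧸ radical ρ Ξ}
    (h : ∀ u, quotientForm ρ Ξ (quotientAction ρ Ξ u v) = 0) : v = 0 := by
  obtain ⟨v, rfl⟩ := Submodule.Quotient.mk_surjective _ v
  refine (Submodule.Quotient.mk_eq_zero _).2 (mem_radical.2 fun u => ?_)
  rw [← quotientForm_mk ρ Ξ, ← quotientAction_mk]
  exact h u

end Radical

end Radical

section Faithful

variable {d A}

lemma Ppos_mem {S : Subalgebra Fq (FA N)} (hS : ∀ i s, e (h i s) ∈ S) (i : Fin N) (n : ℕ) :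
    Ppos d i n ∈ S := by
  induction n using Nat.strong_induction_on with
  | _ n ih =>
    cases n with
    | zero => rw [Ppos]; exact one_mem _
    | succ n =>
      rw [Ppos]
      exact S.smul_mem (sum_mem fun l hl => S.smul_mem (mul_mem (hS _ _) (ih _ (by omega))) _) _

lemma Pneg_mem {S : Subalgebra Fq (FA N)} (hS : ∀ i s, e (h i s) ∈ S) (i : Fin N) (n : ℕ) :
    Pneg d i n ∈ S := by
  induction n using Nat.strong_induction_on with
  | _ n ih =>
    cases n with
    | zero => rw [Pneg]; exact one_mem _
    | succ n =>
      rw [Pneg]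
      exact S.smul_mem (sum_mem fun l hl => S.smul_mem (mul_mem (hS _ _) (ih _ (by omega))) _) _

lemma gammaHalf_mem {S : Subalgebra Fq (FA N)} (h1 : e g2 ∈ S) (h2 : e g2inv ∈ S) (m : ℤ) :
    gammaHalf m ∈ S := by
  rw [gammaHalf]
  split_ifs
  · exact pow_mem h1 _
  · exact pow_mem h2 _

variable {V : Type*} [AddCommGroup V] [Module Fq V]

/-- The elements of the free algebra preserving a submodule. -/
def stabilizing (ρ : FA N →ₐ[Fq] Module.End Fq V) (W : Submodule Fq V) : Subalgebra Fq (FA N) where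
  carrier := {u | W ≤ W.comap (ρ u)}
  mul_mem' {a b} ha hb v hv := by
    change ρ (a * b) v ∈ W
    rw [map_mul, Module.End.mul_apply]
    exact ha (hb hv)
  add_mem' {a b} ha hb v hv := by
    change ρ (a + b) v ∈ W
    rw [map_add, LinearMap.add_apply]
    exact W.add_mem (ha hv) (hb hv)
  algebraMap_mem' r v hv := by
    change ρ (algebraMap Fq _ r) v ∈ W
    rw [AlgHom.commutes, Module.algebraMap_end_apply]
    exact W.smul_mem r hv

lemma mem_stabilizing {ρ : FA N →ₐ[Fq] Module.End Fq V} {W : Submodule Fq V} {u : FA N} :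
    u ∈ stabilizing ρ W ↔ ∀ v ∈ W, ρ u v ∈ W := Iff.rfl

lemma mem_of_gen_mem {S : Subalgebra Fq (FA N)} (hS : ∀ x, e x ∈ S) (u : FA N) : u ∈ S := by
  induction u using FreeAlgebra.induction with
  | grade0 r => exact S.algebraMap_mem r
  | grade1 x => exact hS x
  | mul a b ha hb => exact mul_mem ha hb
  | add a b ha hb => exact add_mem ha hb

/-- The hypotheses on a module over the base relations used to verify the remaining relations. -/
structure IsFaithfulModule (ρ : FA N →ₐ[Fq] Module.End Fq V) (Ξ : V →ₗ[Fq] Uq N d A) : Prop where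
  respects : Respects (BaseRel N d A) ρ
  form_g2 : ∀ v, Ξ (ρ (e g2) v) = G d A g2 * Ξ v
  form_g2inv : ∀ v, Ξ (ρ (e g2inv) v) = G d A g2inv * Ξ v
  form_xm : ∀ i m v, Ξ (ρ (e (xm i m)) v) = G d A (xm i m) * Ξ v
  faithful : ∀ v, (∀ u, Ξ (ρ u v) = 0) → v = 0

namespace IsFaithfulModule

variable {ρ : FA N →ₐ[Fq] Module.End Fq V} {Ξ : V →ₗ[Fq] Uq N d A}

variable (ρ d A) in
/-- The pair of `ρ` and of the projection onto the quantum affine algebra. -/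
def pairing : FA N →ₐ[Fq] Module.End Fq V × Uq N d A :=
  ρ.prod (RingQuot.mkAlgHom Fq (QRel N d A))

lemma pairing_fst (u : FA N) : (pairing d A ρ u).1 = ρ u := rfl

variable (hV : IsFaithfulModule ρ Ξ)
include hV

lemma respects_pairing : Respects (BaseRel N d A) (pairing d A ρ) := fun _ _ hab =>
  Prod.ext (hV.respects hab) (respects_mkAlgHom hab)

lemma form_lowerPart {r : Module.End Fq V × Uq N d A} (hr : r ∈ lowerPart (pairing d A ρ)) (v : V) :
    Ξ (r.1 v) = r.2 * Ξ v := by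
  induction hr using Algebra.adjoin_induction generalizing v with
  | mem y hy =>
    rcases hy with ((rfl | rfl) | ⟨p, rfl⟩)
    · exact hV.form_g2 v
    · exact hV.form_g2inv v
    · exact hV.form_xm _ _ v
  | algebraMap r =>
    change Ξ (r • v) = algebraMap Fq _ r * Ξ v
    rw [map_smul, Algebra.smul_def]
  | add y z _ _ hy hz =>
    rw [Prod.fst_add, LinearMap.add_apply, map_add, hy, hz, Prod.snd_add, add_mul]
  | mul y z _ _ hy hz =>
    rw [Prod.fst_mul, Module.End.mul_apply, hy, hz, Prod.snd_mul, mul_assoc]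

omit hV in
variable (d A ρ) in
/-- The submodule generated by the singular elements vanishing in the quantum affine algebra. -/
def singularSpan : Submodule Fq V :=
  Submodule.span Fq {w | ∃ r t v, r ∈ lowerPart (pairing d A ρ) ∧
    IsSingular (pairing d A ρ) t ∧ t.2 = 0 ∧ w = r.1 (t.1 v)}

omit hV in
lemma mem_singularSpan {r t : Module.End Fq V × Uq N d A} (hr : r ∈ lowerPart (pairing d A ρ))
    (ht : IsSingular (pairing d A ρ) t) (ht0 : t.2 = 0) (v : V) :
    r.1 (t.1 v) ∈ singularSpan d A ρ := Submodule.subset_span ⟨r, t, v, hr, ht, ht0, rfl⟩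

lemma form_singularSpan {w : V} (hw : w ∈ singularSpan d A ρ) : Ξ w = 0 := by
  induction hw using Submodule.span_induction with
  | mem w hw =>
    obtain ⟨r, t, v, hr, ht, ht0, rfl⟩ := hw
    rw [hV.form_lowerPart hr, hV.form_lowerPart ht.1, ht0, zero_mul, mul_zero]
  | zero => exact map_zero _
  | add x y _ _ hx hy => rw [map_add, hx, hy, add_zero]
  | smul c x _ hx => rw [map_smul, hx, smul_zero]

omit hV in
lemma stabilizing_of_generators {u : FA N}
    (h : ∀ r t v, r ∈ lowerPart (pairing d A ρ) → IsSingular (pairing d A ρ) t → t.2 = 0 →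
      ρ u (r.1 (t.1 v)) ∈ singularSpan d A ρ) :
    u ∈ stabilizing ρ (singularSpan d A ρ) := by
  intro w hw
  change ρ u w ∈ singularSpan d A ρ
  induction hw using Submodule.span_induction with
  | mem w hw =>
    obtain ⟨r, t, v, hr, ht, ht0, rfl⟩ := hw
    exact h r t v hr ht ht0
  | zero => rw [map_zero]; exact zero_mem _
  | add x y _ _ hx hy => rw [map_add]; exact add_mem hx hy
  | smul c x _ hx => rw [map_smul]; exact Submodule.smul_mem _ _ hx

omit hV in
lemma stabilizing_of_lowerPart {u : FA N} (hu : pairing d A ρ u ∈ lowerPart (pairing d A ρ)) :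
    u ∈ stabilizing ρ (singularSpan d A ρ) :=
  stabilizing_of_generators fun _ _ v hr ht ht0 =>
    mem_singularSpan (mul_mem hu hr) ht ht0 v

lemma stabilizing_of_unit {u : (Module.End Fq V × Uq N d A)ˣ} {w : FA N}
    (hu : (u : Module.End Fq V × Uq N d A) = pairing d A ρ w)
    (hxm : ∀ j m, QCommute u (pairing d A ρ (e (xm j m))))
    (hxp : ∀ j m, QCommute u (pairing d A ρ (e (xp j m)))) :
    w ∈ stabilizing ρ (singularSpan d A ρ) :=
  stabilizing_of_generators fun r t v hr ht ht0 => by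
    have h1 := mem_singularSpan (hV.respects_pairing.conj_mem_lowerPart hu hxm hr)
      (ht.conj hV.respects_pairing hu hxm hxp) (by simp [ht0]) (ρ w v)
    rw [← pairing_fst (d := d) (A := A), ← hu]
    rw [← pairing_fst (d := d) (A := A), ← hu] at h1
    simp only [← Module.End.mul_apply, ← Prod.fst_mul] at h1 ⊢
    convert h1 using 3
    simp only [mul_assoc, Units.inv_mul_cancel_left, Units.inv_mul, mul_one]

lemma h_mem_stabilizing (i : Fin N) (s : ℤ) : e (h i s) ∈ stabilizing ρ (singularSpan d A ρ) :=
  stabilizing_of_generators fun r t v hr ht ht0 => by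
    have h1 := mem_singularSpan
      (hV.respects_pairing.commutator_h_mem_lowerPart i s hr) ht ht0 v
    have h2 := mem_singularSpan hr (ht.commutator_h hV.respects_pairing i s)
      (by simp [ht0]) v
    have h3 := mem_singularSpan hr ht ht0 (ρ (e (h i s)) v)
    have h4 := add_mem (add_mem h1 h2) h3
    convert h4 using 1
    simp [pairing]

lemma cartan_mem_stabilizing {x : Gen N} (hx : ∀ c n, x ≠ xp c n) :
    e x ∈ stabilizing ρ (singularSpan d A ρ) := by
  have hP := hV.respects_pairing
  cases x with
  | xp i r => exact absurd rfl (hx i r)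
  | xm i r => exact stabilizing_of_lowerPart (xm_mem_lowerPart i r)
  | h i s => exact hV.h_mem_stabilizing i s
  | K i => exact hV.stabilizing_of_unit rfl (hP.qcommute_K_xm i) (hP.qcommute_K_xp i)
  | Kinv i =>
    exact hV.stabilizing_of_unit (u := (hP.cartan.kUnit i)⁻¹) rfl
      (fun j m => (hP.qcommute_K_xm i j m).inv) (fun j m => (hP.qcommute_K_xp i j m).inv)
  | g2 => exact stabilizing_of_lowerPart g2_mem_lowerPart
  | g2inv => exact stabilizing_of_lowerPart g2inv_mem_lowerPart
  | D => exact hV.stabilizing_of_unit rfl hP.qcommute_D_xm hP.qcommute_D_xp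
  | Dinv =>
    exact hV.stabilizing_of_unit (u := (hP.cartan.dUnit)⁻¹) rfl
      (fun j m => (hP.qcommute_D_xm j m).inv) (fun j m => (hP.qcommute_D_xp j m).inv)

lemma commutator_mem_stabilizing (i j : Fin N) (k l : ℤ) :
    e (xp i k) * e (xm j l) - e (xm j l) * e (xp i k) ∈
      stabilizing ρ (singularSpan d A ρ) := by
  have h1 := hV.respects (.xp_xm i j k l)
  have h2 : ∀ {a b : FA N}, ρ a = ρ b → b ∈ stabilizing ρ (singularSpan d A ρ) →
      a ∈ stabilizing ρ (singularSpan d A ρ) := fun hab hb => by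
    rw [mem_stabilizing, hab]; exact hb
  refine h2 h1 ?_
  have hg := gammaHalf_mem (hV.cartan_mem_stabilizing (x := g2) (by simp))
    (hV.cartan_mem_stabilizing (x := g2inv) (by simp))
  split_ifs
  · refine Subalgebra.smul_mem _ (sub_mem (mul_mem (hg _) ?_) (mul_mem (hg _) ?_)) _
    · rw [psiEl]
      split_ifs
      · exact mul_mem (hV.cartan_mem_stabilizing (by simp)) (Ppos_mem hV.h_mem_stabilizing _ _)
      · exact zero_mem _
    · rw [phiEl]
      split_ifs
      · exact mul_mem (hV.cartan_mem_stabilizing (by simp)) (Pneg_mem hV.h_mem_stabilizing _ _)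
      · exact zero_mem _
  · exact zero_mem _

lemma lowerPart_apply_mem {y : Module.End Fq V × Uq N d A}
    (hy : y ∈ lowerPart (pairing d A ρ)) {w : V} (hw : w ∈ singularSpan d A ρ)
    (hxp : ∀ c n, ρ (e (xp c n)) w ∈ singularSpan d A ρ) :
    y.1 w ∈ singularSpan d A ρ ∧ ∀ c n, ρ (e (xp c n)) (y.1 w) ∈ singularSpan d A ρ := by
  have hcomm : ∀ (u : FA N) {w : V}, (∀ x : FA N, Commute (ρ u) (ρ x)) →
      u ∈ stabilizing ρ (singularSpan d A ρ) → w ∈ singularSpan d A ρ →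
      (∀ c n, ρ (e (xp c n)) w ∈ singularSpan d A ρ) →
      ρ u w ∈ singularSpan d A ρ ∧ ∀ c n, ρ (e (xp c n)) (ρ u w) ∈ singularSpan d A ρ := by
    intro u w h1 h2 hw hxp
    refine ⟨h2 hw, fun c n => ?_⟩
    rw [← Module.End.mul_apply, ← (h1 _).eq, Module.End.mul_apply]
    exact h2 (hxp c n)
  induction hy using Algebra.adjoin_induction generalizing w with
  | mem y hy =>
    rcases hy with ((rfl | rfl) | ⟨p, rfl⟩)
    · exact hcomm _ hV.respects.commute_g2 (hV.cartan_mem_stabilizing (by simp)) hw hxp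
    · exact hcomm _ hV.respects.commute_g2inv (hV.cartan_mem_stabilizing (by simp)) hw hxp
    · have h1 := hV.cartan_mem_stabilizing (x := xm p.1 p.2) (by simp)
      refine ⟨h1 hw, fun c n => ?_⟩
      have h2 := add_mem (mem_stabilizing.1 (hV.commutator_mem_stabilizing c p.1 n p.2) _ hw)
        (mem_stabilizing.1 h1 _ (hxp c n))
      convert h2 using 1
      simp [pairing]
  | algebraMap r =>
    refine ⟨Submodule.smul_mem _ r hw, fun c n => ?_⟩
    change ρ (e (xp c n)) (r • w) ∈ _
    rw [map_smul]
    exact Submodule.smul_mem _ r (hxp c n)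
  | add y z _ _ hy hz =>
    refine ⟨add_mem (hy hw hxp).1 (hz hw hxp).1, fun c n => ?_⟩
    rw [Prod.fst_add, LinearMap.add_apply, map_add]
    exact add_mem ((hy hw hxp).2 c n) ((hz hw hxp).2 c n)
  | mul y z _ _ hy hz => exact hy (hz hw hxp).1 (hz hw hxp).2

lemma singularSpan_eq_bot {w : V} (hw : w ∈ singularSpan d A ρ) : w = 0 := by
  suffices h : ∀ x, e x ∈ stabilizing ρ (singularSpan d A ρ) from
    hV.faithful w fun u => hV.form_singularSpan (mem_stabilizing.1 (mem_of_gen_mem h u) w hw)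
  intro x
  by_cases hx : ∀ c n, x ≠ xp c n
  · exact hV.cartan_mem_stabilizing hx
  · push Not at hx
    obtain ⟨c, n, rfl⟩ := hx
    refine stabilizing_of_generators fun r t v hr ht ht0 => ?_
    have h0 : ∀ v, t.1 v ∈ singularSpan d A ρ := mem_singularSpan (one_mem _) ht ht0
    refine (hV.lowerPart_apply_mem hr (h0 v) fun c n => ?_).2 c n
    have h1 : t.1 * ρ (e (xp c n)) = ρ (e (xp c n)) * t.1 := congrArg Prod.fst (ht.2 c n).eq
    rw [← Module.End.mul_apply, ← h1]
    exact h0 _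

lemma eq_zero_of_isSingular {u : FA N} (hu : IsSingular (pairing d A ρ) (pairing d A ρ u))
    (h0 : RingQuot.mkAlgHom Fq (QRel N d A) u = 0) : ρ u = 0 :=
  LinearMap.ext fun v => hV.singularSpan_eq_bot (mem_singularSpan (one_mem _) hu h0 v)

end IsFaithfulModule

end Faithful

section FockModule

variable {d A}

lemma mkAlgHom_quadEl (pm : Bool) (i j : Fin N) (k l : ℤ) :
    RingQuot.mkAlgHom Fq (QRel N d A) (quadEl d A pm i j k l) = 0 := by
  cases pm
  · rw [quadEl, map_sub, RingQuot.mkAlgHom_rel Fq (QRel.serre_m i j k l), sub_self]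
  · rw [quadEl, map_sub, RingQuot.mkAlgHom_rel Fq (QRel.serre_p i j k l), sub_self]

lemma mkAlgHom_serreEl (pm : Bool) {i j : Fin N} (hij : i ≠ j) (ks : Fin (1 - A i j).toNat → ℤ)
    (l : ℤ) :
    RingQuot.mkAlgHom Fq (QRel N d A) (serreEl d pm i j (1 - A i j).toNat ks l) = 0 := by
  rw [serreEl, RingQuot.mkAlgHom_rel Fq (QRel.dserre pm i j hij ks l), map_zero]

lemma Respects.of_quadEl_of_serreEl {R : Type*} [Ring R] [Algebra Fq R] {ρ : FA N →ₐ[Fq] R}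
    (hρ : Respects (BaseRel N d A) ρ)
    (hquad : ∀ pm i j k l, ρ (quadEl d A pm i j k l) = 0)
    (hserre : ∀ pm i j, i ≠ j → ∀ ks l, ρ (serreEl d pm i j (1 - A i j).toNat ks l) = 0) :
    Respects (QRel N d A) ρ := by
  intro a b hab
  cases hab with
  | serre_p i j k l => exact sub_eq_zero.1 ((map_sub ρ _ _).symm.trans (hquad true i j k l))
  | serre_m i j k l => exact sub_eq_zero.1 ((map_sub ρ _ _).symm.trans (hquad false i j k l))
  | dserre pm i j hij ks l => exact (hserre pm i j hij ks l).trans (map_zero ρ).symm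
  | D_xp i r => exact hρ (.D_xp i r)
  | D_xm i r => exact hρ (.D_xm i r)
  | K_xp i j r => exact hρ (.K_xp i j r)
  | K_xm i j r => exact hρ (.K_xm i j r)
  | h_xp i j k l hk => exact hρ (.h_xp i j k l hk)
  | h_xm i j k l hk => exact hρ (.h_xm i j k l hk)
  | xp_xm i j k l => exact hρ (.xp_xm i j k l)
  | _ => exact hρ (.cartan (by constructor <;> assumption))

namespace IsFaithfulModule

variable {V : Type*} [AddCommGroup V] [Module Fq V]
  {ρ : FA N →ₐ[Fq] Module.End Fq V} {Ξ : V →ₗ[Fq] Uq N d A} (hV : IsFaithfulModule ρ Ξ)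
  (hd : ∀ i, 0 < d i) (hsym : ∀ i j, d i * A i j = d j * A j i)
include hV hd hsym

lemma map_quadEl_false (i j : Fin N) (k l : ℤ) : ρ (quadEl d A false i j k l) = 0 := by
  refine hV.eq_zero_of_isSingular ⟨?_, fun c n => ?_⟩ (mkAlgHom_quadEl false i j k l)
  · rw [map_quadEl]
    have h1 : ∀ i m, pairing d A ρ (e (currentGen false i m)) ∈ lowerPart (pairing d A ρ) :=
      xm_mem_lowerPart
    exact sub_mem (sub_mem (mul_mem (h1 _ _) (h1 _ _))
      (Subalgebra.smul_mem _ (mul_mem (h1 _ _) (h1 _ _)) _))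
      (sub_mem (Subalgebra.smul_mem _ (mul_mem (h1 _ _) (h1 _ _)) _) (mul_mem (h1 _ _) (h1 _ _)))
  · exact (hV.respects_pairing.commute_quadEl hd hsym false c n i j k l).symm

lemma map_serreEl_false (hdiag : ∀ i, A i i = 2) (hoff : ∀ i j, i ≠ j → A i j ≤ 0) {i j : Fin N}
    (hij : i ≠ j) (ks : Fin (1 - A i j).toNat → ℤ) (l : ℤ) :
    ρ (serreEl d false i j (1 - A i j).toNat ks l) = 0 := by
  refine hV.eq_zero_of_isSingular ⟨?_, fun c n => ?_⟩ (mkAlgHom_serreEl false hij ks l)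
  · have h1 : ∀ i m, pairing d A ρ (e (xm i m)) ∈ lowerPart (pairing d A ρ) := xm_mem_lowerPart
    rw [serreEl, map_sum]
    refine sum_mem fun σ _ => ?_
    rw [map_sum]
    refine sum_mem fun r _ => ?_
    rw [map_smul, dsTerm, map_mul, map_mul, map_list_prod, map_list_prod]
    refine Subalgebra.smul_mem _ (mul_mem (mul_mem (list_prod_mem ?_) (h1 _ _))
      (list_prod_mem ?_)) _ <;>
    · intro x hx
      simp only [List.mem_map] at hx
      obtain ⟨_, ⟨t, -, rfl⟩, rfl⟩ := hx
      exact h1 _ _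
  · exact (hV.respects_pairing.commute_serreEl hd hsym hdiag hoff false
      (fun i j k l => Prod.ext (hV.map_quadEl_false hd hsym i j k l) (mkAlgHom_quadEl _ i j k l))
      c n hij ks l).symm

end IsFaithfulModule

open FockSpace Radical in
/-- A module over the quantum affine algebra with a vacuum vector, an eigenvector of the `K_i`, and
a map to the algebra which is linear over `N_q^-` and detects the vacuum. -/
theorem exists_fock (hd : ∀ i, 0 < d i) (hdiag : ∀ i, A i i = 2)
    (hoff : ∀ i j, i ≠ j → A i j ≤ 0) (hsym : ∀ i j, d i * A i j = d j * A j i)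
    {κ : Fq} (hκ : κ ≠ 0) :
    ∃ (V : Type) (_ : AddCommGroup V) (_ : Module Fq V) (ρ : Uq N d A →ₐ[Fq] Module.End Fq V)
      (vac : V) (Ξ : V →ₗ[Fq] Uq N d A),
      (∀ b ∈ Nq d A, ∀ v, Ξ (ρ b v) = b * Ξ v) ∧ Ξ vac = 1 ∧
      (∀ i, ρ (G d A (K i)) vac = κ • vac) ∧
      ∀ (i : Fin N) (r : ℕ), Ξ (ρ (phiU d A i (-(r : ℤ))) vac) = if r = 0 then κ⁻¹ • 1 else 0 := by
  let ρ₀ := verma d A κ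
  let Ξ₀ := projection d A
  let ρ := quotientAction ρ₀ Ξ₀
  let Ξ := quotientForm ρ₀ Ξ₀
  have hform : ∀ x : Gen N, (∀ v, Ξ₀ (ρ₀ (e x) v) = G d A x * Ξ₀ v) →
      ∀ v, Ξ (ρ (e x) v) = G d A x * Ξ v := fun x hx v => by
    obtain ⟨v, rfl⟩ := Submodule.Quotient.mk_surjective _ v
    simp only [ρ, Ξ, quotientAction_mk, quotientForm_mk, hx]
  have hV : IsFaithfulModule ρ Ξ :=
    { respects := fun a b hab => quotientAction_eq (respects_verma hsym hκ hd hab)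
      form_g2 := hform _ (projection_verma_g2 κ)
      form_g2inv := hform _ (projection_verma_g2inv hsym hκ)
      form_xm := fun i m => hform _ (projection_verma_xm κ i m)
      faithful := fun v hv => eq_zero_of_quotientForm hv }
  have hzero : ∀ {u}, ρ₀ u = 0 → ρ u = 0 := fun {u} hu => by
    have h1 := quotientAction_eq (Ξ := Ξ₀) (hu.trans (map_zero ρ₀).symm)
    exact h1.trans (map_zero ρ)
  have hR : Respects (QRel N d A) ρ := by
    refine hV.respects.of_quadEl_of_serreEl (fun pm i j k l => ?_) fun pm i j hij ks l => ?_
    · cases pm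
      · exact hV.map_quadEl_false hd hsym i j k l
      · exact hzero (InducedModule.action_quadEl_true (respects_heisenberg hsym hκ) hd hsym i j k l)
    · cases pm
      · exact hV.map_serreEl_false hd hsym hdiag hoff hij ks l
      · exact hzero (InducedModule.action_serreEl_true (respects_heisenberg hsym hκ) hd hsym hdiag
          hoff hij ks l)
  let ρ' : Uq N d A →ₐ[Fq] Module.End Fq _ := RingQuot.liftAlgHom Fq ⟨ρ, hR⟩
  have hρ' : ∀ u, ρ' (RingQuot.mkAlgHom Fq (QRel N d A) u) = ρ u :=
    RingQuot.liftAlgHom_mkAlgHom_apply Fq ρ hR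
  refine ⟨_, inferInstance, inferInstance, ρ', Submodule.Quotient.mk (vacuum d A), Ξ, ?_, ?_,
    fun i => ?_, fun i r => ?_⟩
  · intro b hb
    induction hb using Algebra.adjoin_induction with
    | mem y hy =>
      rcases hy with ((rfl | rfl) | ⟨p, rfl⟩) <;> intro v
      · rw [G_eq, hρ']; exact hV.form_g2 v
      · rw [G_eq, hρ']; exact hV.form_g2inv v
      · beta_reduce; rw [G_eq, hρ']; exact hV.form_xm _ _ v
    | algebraMap r =>
      intro v
      rw [AlgHom.commutes, Module.algebraMap_end_apply, map_smul, Algebra.smul_def]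
    | add y z _ _ hy hz => intro v; rw [map_add, LinearMap.add_apply, map_add, hy, hz, add_mul]
    | mul y z _ _ hy hz => intro v; rw [map_mul, Module.End.mul_apply, hy, hz, mul_assoc]
  · exact projection_vacuum
  · rw [G_eq, hρ', quotientAction_mk, verma_K_vacuum]
    rfl
  · rw [phiU, hρ', quotientAction_mk, quotientForm_mk, projection_verma_phiEl_vacuum]

end FockModule

section Expansion

lemma gcoef_succ {a : Fq} (ha : a ≠ 0) (s : ℕ) :
    gcoef a (s + 1) = a⁻¹ * gcoef a s - if s = 0 then 1 else 0 := by
  cases s with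
  | zero =>
    rw [if_pos rfl, gcoef, gcoef]
    norm_num
    rw [pow_two, mul_inv]
  | succ s =>
    rw [if_neg s.succ_ne_zero, gcoef, gcoef, sub_zero, mul_sub, ← zpow_neg_one,
      ← zpow_add₀ ha, ← zpow_add₀ ha]
    congr 2 <;> push_cast <;> ring

lemma expand_of_recurrence {M : Type*} [AddCommGroup M] [Module Fq M] {a : Fq} (ha : a ≠ 0)
    {f f' : ℤ → ℕ → M} (h0 : ∀ l, f l 0 = a⁻¹ • f' l 0)
    (hs : ∀ l k, f l (k + 1) = a⁻¹ • f' l (k + 1) - f' (l + 1) k + a⁻¹ • f (l + 1) k)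
    (l : ℤ) (k : ℕ) :
    f l k = ∑ s ∈ Finset.range (k + 1), gcoef a s • f' (l + s) (k - s) := by
  induction k generalizing l with
  | zero => simp [h0, gcoef]
  | succ k ih =>
    have h1 : ∀ s ∈ Finset.range (k + 1),
        gcoef a (s + 1) • f' (l + (s + 1 : ℕ)) (k + 1 - (s + 1)) =
          a⁻¹ • gcoef a s • f' (l + 1 + s) (k - s) -
            if s = 0 then f' (l + 1 + s) (k - s) else 0 := fun s _ => by
      rw [gcoef_succ ha, Nat.add_sub_add_right, sub_smul, mul_smul, ite_smul, one_smul, zero_smul,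
        Nat.cast_succ, add_comm (s : ℤ) 1, add_assoc]
    rw [Finset.sum_range_succ', Finset.sum_congr rfl h1, Finset.sum_sub_distrib,
      ← Finset.smul_sum, ← ih, hs]
    simp only [Finset.sum_ite_eq', Finset.mem_range, Nat.succ_pos, if_true, gcoef, Nat.cast_zero,
      add_zero, Nat.sub_zero]
    abel

namespace Exch

variable {R : Type*} [Ring R] [Algebra Fq R] {a : Fq} {c y : ℤ → R}

lemma mul_expand (h : Exch a c y) (ha : a ≠ 0) (hc : ∀ k < 0, c k = 0) (l : ℤ) (k : ℕ) :
    y l * c k = ∑ s ∈ Finset.range (k + 1), gcoef a s • (c (k - s : ℕ) * y (l + s)) := by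
  refine expand_of_recurrence (f := fun l k => y l * c k) (f' := fun l k => c k * y l) ha
    (fun l => ?_) (fun l k => ?_) l k
  · have h1 := h (-1) l
    rw [hc (-1) (by norm_num)] at h1
    simp only [neg_add_cancel, zero_mul, smul_zero, mul_zero, sub_zero] at h1
    rw [Nat.cast_zero, sub_eq_zero.1 h1, smul_smul, inv_mul_cancel₀ ha, one_smul]
  · have h1 := congrArg (fun z => a⁻¹ • z) (h k l)
    simp only [smul_sub, smul_smul, inv_mul_cancel₀ ha, one_smul] at h1
    push_cast
    linear_combination (norm := abel) -h1

lemma expand_mul (h : Exch a c y) (ha : a ≠ 0) (hc : ∀ k < 0, c k = 0) (l : ℤ) (k : ℕ) :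
    c k * y l = ∑ s ∈ Finset.range (k + 1), gcoef a⁻¹ s • (y (l + s) * c (k - s : ℕ)) := by
  refine expand_of_recurrence (f := fun l k => c k * y l) (f' := fun l k => y l * c k)
    (inv_ne_zero ha) (fun l => ?_) (fun l k => ?_) l k
  · have h1 := h (-1) l
    rw [hc (-1) (by norm_num)] at h1
    simp only [neg_add_cancel, zero_mul, smul_zero, mul_zero, sub_zero] at h1
    rw [Nat.cast_zero, inv_inv, sub_eq_zero.1 h1]
  · have h1 := h k l
    rw [inv_inv]
    push_cast
    linear_combination (norm := abel) h1

end Exch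

section Transport

variable {R : Type*} [Ring R] [Algebra Fq R] {a : Fq} {c x Y : ℤ → R} {u : Rˣ} {b : ℤ}

/-- The sum `∑_s g(s) u^{2s} x_{m+s} Y_{k-s}` for a sequence `Y` vanishing up to `b`. -/
def transport (a : Fq) (u : Rˣ) (x Y : ℤ → R) (b m k : ℤ) : R :=
  ∑ s ∈ Finset.range (k - b).toNat,
    gcoef a s • (((u ^ (2 * (s : ℤ)) : Rˣ) : R) * (x (m + s) * Y (k - s)))

lemma transport_eq (hY : ∀ n ≤ b, Y n = 0) {m k : ℤ} {M : ℕ} (hM : k - b ≤ M) :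
    transport a u x Y b m k = ∑ s ∈ Finset.range M,
      gcoef a s • (((u ^ (2 * (s : ℤ)) : Rˣ) : R) * (x (m + s) * Y (k - s))) := by
  refine Finset.sum_subset (Finset.range_subset_range.2 (by omega)) fun s _ hs => ?_
  rw [hY _ (by rw [Finset.mem_range] at hs; omega), mul_zero, mul_zero, smul_zero]

lemma transport_eq_zero (hY : ∀ n ≤ b, Y n = 0) {m k : ℤ} (hk : k ≤ b) :
    transport a u x Y b m k = 0 := by
  rw [transport_eq hY (M := 0) (by simpa using hk), Finset.range_zero, Finset.sum_empty]

lemma mul_sum_eq_sum_transport (ha : a ≠ 0)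
    (h : Exch a c fun l => ((u ^ l : Rˣ) : R) * x l) (hc : ∀ k < 0, c k = 0)
    (huc : ∀ k, Commute (u : R) (c k)) (hux : ∀ l, Commute (u : R) (x l))
    (hY : ∀ n ≤ b, Y n = 0) (m k : ℤ) {M : ℕ} (hM : k - b ≤ M) :
    x m * ∑ p ∈ Finset.range M, c p * ((u ^ (p : ℤ) : Rˣ) : R) * Y (k - p) =
      ∑ p ∈ Finset.range M, c p * ((u ^ (p : ℤ) : Rˣ) : R) * transport a u x Y b m (k - p) := by
  have hexp : ∀ p : ℕ, x m * c p = ∑ s ∈ Finset.range (p + 1),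
      gcoef a s • (c (p - s : ℕ) * (((u ^ (s : ℤ) : Rˣ) : R) * x (m + s))) := fun p => by
    have h1 := congrArg (fun z => ((u ^ (-m) : Rˣ) : R) * z) (h.mul_expand ha hc m p)
    simp only [← mul_assoc, ← Units.val_mul, ← zpow_add, neg_add_cancel, zpow_zero, Units.val_one,
      one_mul, Finset.mul_sum, mul_smul_comm] at h1
    rw [h1]
    refine Finset.sum_congr rfl fun s _ => ?_
    rw [((huc _).units_zpow_left (-m)).eq, ← mul_assoc, mul_assoc (c _), ← Units.val_mul,
      ← zpow_add, neg_add_cancel_left]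
  let F : ℕ → ℕ → R := fun s p =>
    gcoef a s • (c p * ((u ^ ((p : ℤ) + 2 * s) : Rˣ) : R) * (x (m + s) * Y (k - p - s)))
  have h1 : ∀ p : ℕ, x m * (c p * ((u ^ (p : ℤ) : Rˣ) : R) * Y (k - p)) =
      ∑ s ∈ Finset.range (p + 1), F s (p - s) := fun p => by
    rw [← mul_assoc, ← mul_assoc, hexp, Finset.sum_mul, Finset.sum_mul]
    refine Finset.sum_congr rfl fun s hs => ?_
    have hsp : s ≤ p := Nat.lt_succ_iff.1 (Finset.mem_range.1 hs)
    simp only [F, smul_mul_assoc]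
    rw [Nat.cast_sub hsp, show (p : ℤ) - s + 2 * s = s + p by ring,
      show k - ((p : ℤ) - s) - s = k - p by ring, zpow_add, Units.val_mul]
    simp only [mul_assoc]
    rw [← mul_assoc (x _), ← ((hux _).units_zpow_left (p : ℤ)).eq, mul_assoc]
  have h2 : ∀ p : ℕ, c p * ((u ^ (p : ℤ) : Rˣ) : R) * transport a u x Y b m (k - p) =
      ∑ s ∈ Finset.range M, F s p := fun p => by
    rw [transport_eq hY (M := M) (by omega), Finset.mul_sum]
    refine Finset.sum_congr rfl fun s _ => ?_
    simp only [F, mul_smul_comm]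
    rw [zpow_add, Units.val_mul]
    simp only [mul_assoc]
  rw [Finset.mul_sum, Finset.sum_congr rfl fun p _ => h1 p, Finset.sum_range_diag_flip,
    Finset.sum_congr rfl fun p _ => h2 p, Finset.sum_comm]
  refine Finset.sum_congr rfl fun s _ =>
    Finset.sum_subset (Finset.range_subset_range.2 (by omega)) fun p _ hp => ?_
  simp only [F]
  rw [hY _ (by rw [Finset.mem_range] at hp; omega), mul_zero, mul_zero, smul_zero]

end Transport

end Expansion

section PhiSpan

/-- The central unit `γ^{1/2}` of the quantum affine algebra. -/
def gammaUnit : (Uq N d A)ˣ := (respects_mkAlgHom (d := d) (A := A)).cartan.gUnit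

variable {d A}

lemma gU_eq (m : ℤ) : gU d A m = ((gammaUnit d A ^ m : (Uq N d A)ˣ) : Uq N d A) :=
  respects_mkAlgHom.cartan.map_gammaHalf m

lemma coe_gN (m : ℤ) :
    ((gN d A m : Nq d A) : Uq N d A) = ((gammaUnit d A ^ m : (Uq N d A)ˣ) : Uq N d A) := by
  rw [← gU_eq, gN, gU, gammaHalf]
  split_ifs <;> rw [map_pow, SubmonoidClass.coe_pow] <;> rfl

lemma commute_gammaUnit (z : Uq N d A) : Commute (gammaUnit d A : Uq N d A) z := by
  obtain ⟨u, rfl⟩ := RingQuot.mkAlgHom_surjective Fq (QRel N d A) z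
  exact respects_mkAlgHom.cartan.commute_gUnit u

lemma commute_gammaUnit_zpow (m : ℤ) (z : Uq N d A) :
    Commute ((gammaUnit d A ^ m : (Uq N d A)ˣ) : Uq N d A) z :=
  (commute_gammaUnit z).units_zpow_left m

lemma gammaUnit_zpow_mem (m : ℤ) :
    ((gammaUnit d A ^ m : (Uq N d A)ˣ) : Uq N d A) ∈ Nq d A := by
  rw [← gU_eq]
  exact gammaHalf_mem_lowerPart m

lemma G_xm_mem (i : Fin N) (m : ℤ) : G d A (xm i m) ∈ Nq d A := xm_mem_lowerPart i m

lemma psiU_exch_xm (hd : ∀ i, 0 < d i) (i j : Fin N) :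
    Exch (qp d A i j)⁻¹ (fun k => psiU d A i k)
      (fun m => ((gammaUnit d A ^ m : (Uq N d A)ˣ) : Uq N d A) * G d A (xm j m)) :=
  respects_mkAlgHom.psi_exch_xm hd i j

lemma phiU_exch_xm (hd : ∀ i, 0 < d i) (i j : Fin N) :
    Exch (qp d A i j) (fun k => phiU d A i (-k))
      (fun m => ((gammaUnit d A ^ m : (Uq N d A)ˣ) : Uq N d A) * G d A (xm j (-m))) := by
  have h1 := (respects_mkAlgHom.phi_exch_xm (A := A) hd i j).reflect (inv_ne_zero (qp_ne_zero i j))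
  simp only [inv_inv, neg_neg] at h1
  exact h1

lemma psiU_neg (i : Fin N) {k : ℤ} (hk : k < 0) : psiU d A i k = 0 := by
  rw [psiU, psiEl, if_neg (by omega), map_zero]

lemma phiU_pos (i : Fin N) {k : ℤ} (hk : 0 < k) : phiU d A i k = 0 := by
  rw [phiU, phiEl, if_neg (by omega), map_zero]

lemma psiU_zero (i : Fin N) : psiU d A i 0 = G d A (K i) := by
  rw [psiU, psiEl, if_pos le_rfl, Int.toNat_zero, Ppos, mul_one]
  rfl

variable (d A) in
/-- The span of the elements `b φ_{j,-t}` with `b` in `N_q^-`. -/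
def phiSpan (j : Fin N) : Submodule Fq (Uq N d A) :=
  Submodule.span Fq {z | ∃ b ∈ Nq d A, ∃ t : ℕ, b * phiU d A j (-(t : ℤ)) = z}

lemma mul_phiU_mem_phiSpan {j : Fin N} {b : Uq N d A} (hb : b ∈ Nq d A) (t : ℕ) :
    b * phiU d A j (-(t : ℤ)) ∈ phiSpan d A j := Submodule.subset_span ⟨b, hb, t, rfl⟩

lemma mul_mem_phiSpan_left {j : Fin N} {b z : Uq N d A} (hb : b ∈ Nq d A)
    (hz : z ∈ phiSpan d A j) : b * z ∈ phiSpan d A j := by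
  induction hz using Submodule.span_induction with
  | mem z hz =>
    obtain ⟨c, hc, t, rfl⟩ := hz
    rw [← mul_assoc]
    exact mul_phiU_mem_phiSpan (mul_mem hb hc) t
  | zero => rw [mul_zero]; exact zero_mem _
  | add y z _ _ hy hz => rw [mul_add]; exact add_mem hy hz
  | smul r z _ hz => rw [mul_smul_comm]; exact Submodule.smul_mem _ r hz

lemma phiU_mul_xm_mem_phiSpan (hd : ∀ i, 0 < d i) (j i : Fin N) (t : ℕ) (l : ℤ) :
    phiU d A j (-(t : ℤ)) * G d A (xm i l) ∈ phiSpan d A j := by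
  have h1 := (phiU_exch_xm (A := A) hd j i).expand_mul (qp_ne_zero j i)
    (fun k hk => phiU_pos j (by omega)) (-l) t
  rw [neg_neg] at h1
  have h2 : phiU d A j (-(t : ℤ)) * G d A (xm i l) =
      ((gammaUnit d A ^ l : (Uq N d A)ˣ) : Uq N d A) * (phiU d A j (-(t : ℤ)) *
        (((gammaUnit d A ^ (-l) : (Uq N d A)ˣ) : Uq N d A) * G d A (xm i l))) := by
    rw [← mul_assoc, (commute_gammaUnit_zpow l _).eq, mul_assoc, ← mul_assoc _ _ (G d A _),
      ← Units.val_mul, ← zpow_add, add_neg_cancel, zpow_zero, Units.val_one, one_mul]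
  rw [h2, h1]
  refine mul_mem_phiSpan_left (gammaUnit_zpow_mem l) (Submodule.sum_mem _ fun s _ =>
    Submodule.smul_mem _ _ (mul_phiU_mem_phiSpan (mul_mem (gammaUnit_zpow_mem _) (G_xm_mem _ _)) _))

lemma mul_mem_phiSpan_right (hd : ∀ i, 0 < d i) {j : Fin N} {y : Uq N d A} (hy : y ∈ Nq d A) :
    ∀ z ∈ phiSpan d A j, z * y ∈ phiSpan d A j := by
  induction hy using Algebra.adjoin_induction with
  | mem y hy =>
    rcases hy with ((rfl | rfl) | ⟨p, rfl⟩) <;> intro z hz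
    · rw [← (FockSpace.commute_g2 z).eq]
      exact mul_mem_phiSpan_left g2_mem_lowerPart hz
    · rw [← (FockSpace.commute_g2inv z).eq]
      exact mul_mem_phiSpan_left g2inv_mem_lowerPart hz
    · beta_reduce
      induction hz using Submodule.span_induction with
      | mem z hz =>
        obtain ⟨c, hc, t, rfl⟩ := hz
        rw [mul_assoc]
        exact mul_mem_phiSpan_left hc (phiU_mul_xm_mem_phiSpan hd j _ t _)
      | zero => rw [zero_mul]; exact zero_mem _
      | add y z _ _ hy hz => rw [add_mul]; exact add_mem hy hz
      | smul r z _ hz => rw [smul_mul_assoc]; exact Submodule.smul_mem _ r hz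
  | algebraMap r =>
    intro z hz
    rw [← Algebra.commutes, ← Algebra.smul_def]
    exact Submodule.smul_mem _ r hz
  | add x y _ _ hx hy => intro z hz; rw [mul_add]; exact add_mem (hx z hz) (hy z hz)
  | mul x y _ _ hx hy => intro z hz; rw [← mul_assoc]; exact hy _ (hx z hz)

lemma phiU_mul_mem_phiSpan (hd : ∀ i, 0 < d i) {j : Fin N} {y : Uq N d A} (hy : y ∈ Nq d A)
    (t : ℕ) : phiU d A j (-(t : ℤ)) * y ∈ phiSpan d A j := by
  refine mul_mem_phiSpan_right hd hy _ ?_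
  have h1 := mul_phiU_mem_phiSpan (j := j) (one_mem (Nq d A)) t
  rwa [one_mul] at h1

section Uniqueness

variable (hd : ∀ i, 0 < d i) (hdiag : ∀ i, A i i = 2) (hoff : ∀ i j, i ≠ j → A i j ≤ 0)
  (hsym : ∀ i j, d i * A i j = d j * A j i)
include hd hdiag hoff hsym

lemma eq_zero_of_K_mul_mem_phiSpan {j : Fin N} {a : Uq N d A} (ha : a ∈ Nq d A)
    (h : G d A (K j) * a ∈ phiSpan d A j) : a = 0 := by
  obtain ⟨V₁, _, _, ρ₁, v₁, Ξ₁, hmul₁, hv₁, hK₁, hphi₁⟩ :=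
    exists_fock hd hdiag hoff hsym (one_ne_zero (α := Fq))
  obtain ⟨V₂, _, _, ρ₂, v₂, Ξ₂, hmul₂, hv₂, hK₂, hphi₂⟩ :=
    exists_fock hd hdiag hoff hsym (two_ne_zero (α := Fq))
  have hspan : ∀ z ∈ phiSpan d A j, Ξ₁ (ρ₁ z v₁) = (2 : Fq) • Ξ₂ (ρ₂ z v₂) := fun z hz => by
    induction hz using Submodule.span_induction with
    | mem z hz =>
      obtain ⟨c, hc, t, rfl⟩ := hz
      rw [map_mul, map_mul, Module.End.mul_apply, Module.End.mul_apply, hmul₁ c hc, hmul₂ c hc,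
        hphi₁, hphi₂]
      split_ifs
      · rw [mul_smul_comm, mul_smul_comm, smul_smul, mul_inv_cancel₀ two_ne_zero, inv_one]
      · rw [mul_zero, smul_zero]
    | zero => simp only [map_zero, LinearMap.zero_apply, smul_zero]
    | add y z _ _ hy hz => simp only [map_add, LinearMap.add_apply, smul_add, hy, hz]
    | smul r z _ hz => simp only [map_smul, LinearMap.smul_apply, hz, smul_comm r]
  let u : (Uq N d A)ˣ := (respects_mkAlgHom (d := d) (A := A)).cartan.kUnit j
  have hu : (u : Uq N d A) = G d A (K j) := rfl
  have hX : (u : Uq N d A) * a * ((u⁻¹ : (Uq N d A)ˣ) : Uq N d A) ∈ Nq d A :=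
    respects_mkAlgHom.conj_mem_lowerPart (u := u) hu
      (fun i m => respects_mkAlgHom.qcommute_K_xm j i m) ha
  obtain ⟨X, hXdef⟩ : ∃ X, X = (u : Uq N d A) * a * ((u⁻¹ : (Uq N d A)ˣ) : Uq N d A) := ⟨_, rfl⟩
  rw [← hXdef] at hX
  have hXK : G d A (K j) * a = X * G d A (K j) := by
    rw [hXdef, ← hu, mul_assoc _ _ (u : Uq N d A), Units.inv_mul, mul_one]
  have h1 := hspan _ h
  rw [hXK, map_mul, map_mul, Module.End.mul_apply, Module.End.mul_apply, hmul₁ X hX, hmul₂ X hX,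
    hK₁, hK₂, map_smul, map_smul, hv₁, hv₂, one_smul, mul_smul_comm, mul_one, smul_smul] at h1
  have h2 : (3 : Fq) • X = 0 := by
    rw [show (2 * 2 : Fq) = 1 + 3 by norm_num, add_smul, one_smul] at h1
    exact left_eq_add.1 h1
  have h3 : X = 0 := (smul_eq_zero.1 h2).resolve_left (by norm_num)
  rw [h3, zero_mul, ← hu] at hXK
  simpa using hXK

lemma eq_zero_of_sum_psiU_eq_sum_phiU {j : Fin N} {a b : ℤ → Uq N d A} {n₀ : ℤ}
    (ha : ∀ n, a n ∈ Nq d A) (hb : ∀ n, b n ∈ Nq d A) (h0 : ∀ n ≤ n₀, a n = 0)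
    (h : ∀ k, ∃ M : ℕ, ∑ p ∈ Finset.range (M + 1), psiU d A j p * gU d A p * a (k - p) =
      ∑ r ∈ Finset.range (M + 1), phiU d A j (-(r : ℤ)) * gU d A r * b (k + r)) (k : ℤ) :
    a k = 0 := by
  have key : ∀ n : ℕ, ∀ k ≤ n₀ + n, a k = 0 := fun n => by
    induction n with
    | zero => exact fun k hk => h0 k (by simpa using hk)
    | succ n ih =>
      intro k hk
      obtain ⟨M, hM⟩ := h k
      refine eq_zero_of_K_mul_mem_phiSpan hd hdiag hoff hsym (ha k) (j := j) ?_
      rw [Finset.sum_range_succ', Finset.sum_eq_zero fun p _ => by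
        rw [ih (k - (p + 1 : ℕ)) (by push_cast at hk ⊢; omega), mul_zero]] at hM
      rw [zero_add, Nat.cast_zero, psiU_zero, gU_eq, zpow_zero, Units.val_one, mul_one,
        sub_zero] at hM
      rw [hM]
      refine Submodule.sum_mem _ fun r _ => ?_
      rw [mul_assoc, gU_eq]
      exact phiU_mul_mem_phiSpan hd (mul_mem (gammaUnit_zpow_mem _) (hb _)) r
  exact key (k - n₀).toNat k (by omega)

end Uniqueness

end PhiSpan

section Commutation

section Sequences

variable {R : Type*} [Ring R] [Algebra Fq R] {a : Fq} {c x Y : ℤ → R} {u : Rˣ} {b : ℤ}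

/-- The right-hand side of the commutation rule for a sequence `Y` vanishing up to `b`. -/
def commutedSeq (a : Fq) (u : Rˣ) (x Y : ℤ → R) (b : ℤ) (Q : Prop) [Decidable Q] (y : R)
    (m k : ℤ) : R :=
  (if Q ∧ k = -m then ((u ^ (2 * k) : Rˣ) : R) * y else 0) + transport a u x Y b m k

omit [Algebra Fq R] in
lemma sum_mul_ite_eq (hc : ∀ k < 0, c k = 0) (y : R) {k m : ℤ} {M : ℕ} (hM : k + m < M) :
    ∑ p ∈ Finset.range M, c p * ((u ^ (p : ℤ) : Rˣ) : R) *
        (if k - p = -m then ((u ^ (2 * (k - p)) : Rˣ) : R) * y else 0) =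
      c (k + m) * ((u ^ (k - m) : Rˣ) : R) * y := by
  rcases lt_or_ge (k + m) 0 with hneg | hnn
  · rw [hc _ hneg, zero_mul, zero_mul]
    exact Finset.sum_eq_zero fun p _ => by rw [if_neg (by omega), mul_zero]
  · rw [Finset.sum_eq_single (k + m).toNat (fun p _ hp => by rw [if_neg (by omega), mul_zero])
      (fun hp => absurd (Finset.mem_range.2 (by omega)) hp), Int.toNat_of_nonneg hnn,
      if_pos (by ring), ← mul_assoc, mul_assoc (c _), ← Units.val_mul, ← zpow_add,
      show k + m + 2 * (k - (k + m)) = k - m by ring]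

lemma sum_mul_commutedSeq (ha : a ≠ 0)
    (h : Exch a c fun l => ((u ^ l : Rˣ) : R) * x l) (hc : ∀ k < 0, c k = 0)
    (huc : ∀ k, Commute (u : R) (c k)) (hux : ∀ l, Commute (u : R) (x l))
    (hY : ∀ n ≤ b, Y n = 0) (Q : Prop) [Decidable Q] (y : R) (m k : ℤ) {M : ℕ}
    (hM : k - b ≤ M) (hM' : k + m < M) :
    ∑ p ∈ Finset.range M, c p * ((u ^ (p : ℤ) : Rˣ) : R) * commutedSeq a u x Y b Q y m (k - p) =
      (if Q then c (k + m) * ((u ^ (k - m) : Rˣ) : R) * y else 0) +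
        x m * ∑ p ∈ Finset.range M, c p * ((u ^ (p : ℤ) : Rˣ) : R) * Y (k - p) := by
  simp only [commutedSeq, mul_add, Finset.sum_add_distrib]
  rw [← mul_sum_eq_sum_transport ha h hc huc hux hY m k hM]
  congr 1
  by_cases hQ : Q
  · simp only [hQ, true_and, if_true]
    exact sum_mul_ite_eq hc y hM'
  · simp only [hQ, false_and, if_false, mul_zero, Finset.sum_const_zero]

lemma commutedSeq_eq_zero (hY : ∀ n ≤ b, Y n = 0) (Q : Prop) [Decidable Q] (y : R) {m k : ℤ}
    (hk : k ≤ b) (hkm : k < -m) : commutedSeq a u x Y b Q y m k = 0 := by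
  rw [commutedSeq, transport_eq_zero hY hk, if_neg (by omega), add_zero]

end Sequences

variable {d A}

lemma commutedSeq_mem {a : Fq} {x Y : ℤ → Uq N d A} {b : ℤ} (Q : Prop) [Decidable Q]
    {y : Uq N d A} {m k : ℤ} (hx : ∀ n, x n ∈ Nq d A) (hY : ∀ n, Y n ∈ Nq d A)
    (hy : y ∈ Nq d A) : commutedSeq a (gammaUnit d A) x Y b Q y m k ∈ Nq d A := by
  refine add_mem ?_ (sum_mem fun s _ => Subalgebra.smul_mem _
    (mul_mem (gammaUnit_zpow_mem _) (mul_mem (hx _) (hY _))) _)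
  split_ifs
  · exact mul_mem (gammaUnit_zpow_mem _) hy
  · exact zero_mem _

lemma commutator_xp_xm (hd : ∀ i, 0 < d i) (i j : Fin N) (k m : ℤ) (y : Uq N d A) :
    (qi d j - (qi d j)⁻¹) •
        ((G d A (xp j k) * G d A (xm i m) - G d A (xm i m) * G d A (xp j k)) * y) =
      (if i = j then
          psiU d A j (k + m) * ((gammaUnit d A ^ (k - m) : (Uq N d A)ˣ) : Uq N d A) * y else 0) -
        if i = j then
          phiU d A j (k + m) * ((gammaUnit d A ^ (m - k) : (Uq N d A)ˣ) : Uq N d A) * y else 0 := by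
  have h1 : G d A (xp j k) * G d A (xm i m) - G d A (xm i m) * G d A (xp j k) =
      RingQuot.mkAlgHom Fq (QRel N d A) (if j = i then
          ((qi d j - (qi d j)⁻¹)⁻¹) •
            (gammaHalf (k - m) * psiEl d j (k + m) - gammaHalf (m - k) * phiEl d j (k + m))
         else 0) := by
    rw [← respects_mkAlgHom (d := d) (A := A) (.xp_xm j i k m), map_sub, map_mul, map_mul]
    rfl
  rw [h1]
  by_cases hij : i = j
  · rw [if_pos hij.symm, if_pos hij, if_pos hij, map_smul, smul_mul_assoc, smul_smul,
      mul_inv_cancel₀ (qi_sub_inv_ne_zero (hd j)), one_smul, map_sub, map_mul, map_mul, sub_mul]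
    change gU d A (k - m) * psiU d A j (k + m) * y - gU d A (m - k) * phiU d A j (k + m) * y = _
    rw [gU_eq, gU_eq, (commute_gammaUnit_zpow _ _).eq, (commute_gammaUnit_zpow (m - k) _).eq]
  · rw [if_neg (Ne.symm hij), if_neg hij, if_neg hij, map_zero, zero_mul, smul_zero, sub_zero]

lemma IsOmegaFamily.exists_commutator_eq {Ωψ Ωφ : Fin N → ℤ → ((Nq d A) →ₗ[Fq] (Nq d A))}
    (hfam : IsOmegaFamily d A Ωψ Ωφ) (hd : ∀ i, 0 < d i) (j : Fin N) (k : ℤ) (P : Nq d A) :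
    ∃ M₀ : ℕ, ∀ M ≥ M₀,
      (qi d j - (qi d j)⁻¹) •
          (G d A (xp j k) * (P : Uq N d A) - (P : Uq N d A) * G d A (xp j k)) =
        (∑ p ∈ Finset.range M, psiU d A j p *
            ((gammaUnit d A ^ (p : ℤ) : (Uq N d A)ˣ) : Uq N d A) * (Ωψ j (k - p) P : Nq d A)) -
          ∑ r ∈ Finset.range M, phiU d A j (-(r : ℤ)) *
            ((gammaUnit d A ^ (r : ℤ) : (Uq N d A)ˣ) : Uq N d A) * (Ωφ j (k + r) P : Nq d A) := by
  obtain ⟨M₀, hM₀, h⟩ := hfam.2.2 j k P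
  refine ⟨M₀ + 1, fun M hM => ?_⟩
  rw [h, smul_smul, mul_inv_cancel₀ (qi_sub_inv_ne_zero (hd j)), one_smul]
  simp only [gU_eq]
  have hsub : Finset.range (M₀ + 1) ⊆ Finset.range M := Finset.range_subset_range.2 hM
  congr 1
  · refine Finset.sum_subset hsub fun p _ hp => ?_
    rw [(hM₀ p (by rw [Finset.mem_range] at hp; omega)).1, ZeroMemClass.coe_zero, mul_zero]
  · refine Finset.sum_subset hsub fun p _ hp => ?_
    rw [(hM₀ p (by rw [Finset.mem_range] at hp; omega)).2, ZeroMemClass.coe_zero, mul_zero]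

lemma IsOmegaFamily.psi_xm_mul {Ωψ Ωφ : Fin N → ℤ → ((Nq d A) →ₗ[Fq] (Nq d A))}
    (hfam : IsOmegaFamily d A Ωψ Ωφ) (hd : ∀ i, 0 < d i) (hdiag : ∀ i, A i i = 2)
    (hoff : ∀ i j, i ≠ j → A i j ≤ 0) (hsym : ∀ i j, d i * A i j = d j * A j i)
    (i j : Fin N) (m : ℤ) (P : Nq d A) {b : ℤ} (hb : ∀ n ≤ b, Ωψ j n P = 0) (k : ℤ) :
    ((Ωψ j k (xmN d A i m * P) : Nq d A) : Uq N d A) =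
      commutedSeq (qp d A j i)⁻¹ (gammaUnit d A) (fun l => G d A (xm i l))
        (fun n => (Ωψ j n P : Nq d A)) b (i = j) P m k := by
  obtain ⟨b', hb'⟩ := hfam.2.1 j P
  obtain ⟨b₁, hb₁⟩ := hfam.1 j (xmN d A i m * P)
  have hY : ∀ n ≤ b, ((Ωψ j n P : Nq d A) : Uq N d A) = 0 := fun n hn => by rw [hb n hn]; rfl
  have hZ : ∀ n ≤ -b', ((Ωφ j (-n) P : Nq d A) : Uq N d A) = 0 := fun n hn => by
    rw [hb' _ (by omega)]; rfl
  let S : ℤ → Uq N d A := commutedSeq (qp d A j i)⁻¹ (gammaUnit d A) (fun l => G d A (xm i l))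
    (fun n => (Ωψ j n P : Nq d A)) b (i = j) P m
  let T : ℤ → Uq N d A := commutedSeq (qp d A j i) (gammaUnit d A) (fun l => G d A (xm i (-l)))
    (fun n => (Ωφ j (-n) P : Nq d A)) (-b') (i = j) P (-m)
  have hS : ∀ n, S n ∈ Nq d A := fun n =>
    commutedSeq_mem _ (fun _ => G_xm_mem _ _) (fun _ => Subtype.coe_prop _) P.2
  have hT : ∀ n, T n ∈ Nq d A := fun n =>
    commutedSeq_mem _ (fun _ => G_xm_mem _ _) (fun _ => Subtype.coe_prop _) P.2
  refine sub_eq_zero.1 (eq_zero_of_sum_psiU_eq_sum_phiU hd hdiag hoff hsym (j := j)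
    (a := fun n => (Ωψ j n (xmN d A i m * P) : Nq d A) - S n)
    (b := fun n => (Ωφ j n (xmN d A i m * P) : Nq d A) - T (-n)) (n₀ := min b₁ (min b (-m - 1)))
    (fun n => sub_mem (Subtype.coe_prop _) (hS n)) (fun n => sub_mem (Subtype.coe_prop _) (hT _))
    (fun n hn => ?_) (fun k => ?_) k)
  · have h1 : S n = 0 := commutedSeq_eq_zero hY _ _ (by omega) (by omega)
    rw [h1, hb₁ n (by omega), ZeroMemClass.coe_zero, sub_zero]
  · obtain ⟨M₁, h₁⟩ := hfam.exists_commutator_eq hd j k (xmN d A i m * P)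
    obtain ⟨M₂, h₂⟩ := hfam.exists_commutator_eq hd j k P
    refine ⟨M₁ + M₂ + (k - b).toNat + (-k + b').toNat + (k + m).natAbs, ?_⟩
    generalize hM : M₁ + M₂ + (k - b).toNat + (-k + b').toNat + (k + m).natAbs + 1 = M
    have hS1 := sum_mul_commutedSeq (inv_ne_zero (qp_ne_zero j i)) (psiU_exch_xm (A := A) hd j i)
      (fun k hk => psiU_neg j hk) (fun k => commute_gammaUnit _) (fun l => commute_gammaUnit _)
      hY (i = j) (P : Uq N d A) m k (M := M) (by omega) (by omega)
    have hT1 := sum_mul_commutedSeq (qp_ne_zero j i) (phiU_exch_xm (A := A) hd j i)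
      (fun k hk => phiU_pos j (by omega)) (fun k => commute_gammaUnit _)
      (fun l => commute_gammaUnit _) hZ (i = j) (P : Uq N d A) (-m) (-k) (M := M) (by omega)
      (by omega)
    have hc := commutator_xp_xm (A := A) hd i j k m (P : Uq N d A)
    have e1 := h₁ M (by omega)
    have e2 := congrArg (fun z => G d A (xm i m) * z) (h₂ M (by omega))
    have hcoe : ((xmN d A i m * P : Nq d A) : Uq N d A) = G d A (xm i m) * P := rfl
    have hsplit : G d A (xp j k) * (G d A (xm i m) * P) - G d A (xm i m) * P * G d A (xp j k) =
        (G d A (xp j k) * G d A (xm i m) - G d A (xm i m) * G d A (xp j k)) * P +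
          G d A (xm i m) * (G d A (xp j k) * P - P * G d A (xp j k)) := by
      simp only [mul_sub, sub_mul, mul_assoc]; abel
    rw [hcoe, hsplit, smul_add, hc] at e1
    simp only [mul_smul_comm] at e2
    rw [e2] at e1
    have hkr : ∀ r : ℤ, -(-k - r) = k + r := fun r => by ring
    have hkr' : ∀ r : ℤ, -(k + r) = -k - r := fun r => by ring
    rw [show -(-k + -m) = k + m by ring, show -k - -m = m - k by ring, neg_neg] at hT1
    simp only [hkr] at hT1
    simp only [gU_eq, mul_sub, Finset.sum_sub_distrib, hkr', S, T]
    rw [hS1, hT1]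
    rw [mul_sub] at e1
    linear_combination (norm := abel) -e1

end Commutation

/-- `Ω_{ψ_j}(k)(x^-_{i,m} P) = δ_{ij} δ_{k,-m} γ^k P +
∑_{r ≥ 0} g_{i,j,q^{-1}}(r) γ^r x^-_{i,m+r} (Ω_{ψ_j}(k-r)(P))`,
with only finitely many nonzero summands. -/
theorem omega_psi_commutation
    (hN : 0 < N)
    (hdpos : ∀ i, 0 < d i)
    (hgcd : Finset.univ.gcd (fun i => (d i).natAbs) = 1)
    (hdiag : ∀ i, A i i = 2)
    (hoff : ∀ i j, i ≠ j → A i j ≤ 0)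
    (hsym : ∀ i j, d i * A i j = d j * A j i)
    (Ωψ Ωφ : Fin N → ℤ → ((Nq d A) →ₗ[Fq] (Nq d A)))
    (hfam : IsOmegaFamily d A Ωψ Ωφ)
    (i j : Fin N) (k m : ℤ) (P : Nq d A) :
    ∃ M : ℕ, (∀ r : ℕ, M < r → Ωψ j (k - (r : ℤ)) P = 0) ∧
      Ωψ j k (xmN d A i m * P) =
        (if i = j ∧ k = -m then gN d A (2 * k) * P else 0) +
        ∑ r ∈ Finset.range (M + 1),
          gcoef (qq ^ (-(d i * A i j))) r •
            (gN d A (2 * (r : ℤ)) * (xmN d A i (m + (r : ℤ)) * Ωψ j (k - (r : ℤ)) P)) := by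
  obtain ⟨b, hb⟩ := hfam.1 j P
  refine ⟨(k - b).toNat, fun r hr => hb _ (by omega), Subtype.ext ?_⟩
  have hY : ∀ n ≤ b, ((Ωψ j n P : Nq d A) : Uq N d A) = 0 := fun n hn => by rw [hb n hn]; rfl
  rw [hfam.psi_xm_mul hdpos hdiag hoff hsym i j m P hb k, commutedSeq,
    transport_eq hY (M := (k - b).toNat + 1) (by omega), zpow_neg,
    show qq ^ (d i * A i j) = qp d A j i from qp_comm hsym i j]
  push_cast
  congr 1
  split_ifs
  · rw [MulMemClass.coe_mul, coe_gN]
  · rfl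

end
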